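/- For every three integers ℓ, r, t ≥ 0 there exists an integer n₀ such that for every simple graph G on n ≥ n₀ vertices with average degree at least 6 − r/n and every generic drawing γ of G with at most ℓ crossings, there exists an s-nest in γ of size t for some s ∈ {0,1,2}. -/

import Mathlib

open Set Bornology

noncomputable section

namespace CrossingPaper

/-- Points of the plane. -/
abbrev Plane : Type := ℝ × ℝ

/-- A drawing of a (simple) graph `G` in the plane: each vertex is mapped to a point
(injectively), and each edge `e = uv` is mapped to an arc with ends `vmap u`, `vmap v`
whose interior `emap e` avoids all vertex images; any two distinct edges intersect in
finitely many points. -/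
structure Drawing {V : Type} (G : SimpleGraph V) where
  vmap : V → Plane
  emap : Sym2 V → Set Plane
  vmap_inj : Function.Injective vmap
  arc : ∀ e ∈ G.edgeSet, ∀ u v : V, e = s(u, v) →
    ∃ f : ℝ → Plane, ContinuousOn f (Icc 0 1) ∧ InjOn f (Icc 0 1) ∧
      f 0 = vmap u ∧ f 1 = vmap v ∧ emap e = f '' Ioo 0 1
  avoid : ∀ e ∈ G.edgeSet, ∀ v : V, vmap v ∉ emap e
  finite_inter : ∀ e ∈ G.edgeSet, ∀ e' ∈ G.edgeSet, e ≠ e' → (emap e ∩ emap e').Finite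

variable {V : Type} {G : SimpleGraph V}

/-- The set of crossings of a drawing: points lying on (the interiors of) two distinct
edges. -/
def Drawing.crossings (γ : Drawing G) : Set Plane :=
  {p | ∃ e ∈ G.edgeSet, ∃ e' ∈ G.edgeSet, e ≠ e' ∧ p ∈ γ.emap e ∧ p ∈ γ.emap e'}

/-- The crossing number of a graph: the minimum number of crossings over all drawings. -/
def crossingNumber (G : SimpleGraph V) : ℕ :=
  sInf {n | ∃ γ : Drawing G, γ.crossings.Finite ∧ γ.crossings.ncard = n}

/-- `G` is `k`-crossing-critical: `cr(G) ≥ k` and `cr(G - e) < k` for every edge `e`. -/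
def CrossingCritical (G : SimpleGraph V) (k : ℕ) : Prop :=
  k ≤ crossingNumber G ∧
    ∀ e ∈ G.edgeSet, crossingNumber (G.deleteEdges {e}) < k

/-- The image of a subgraph under a drawing. -/
def Drawing.image (γ : Drawing G) (H : G.Subgraph) : Set Plane :=
  γ.vmap '' H.verts ∪ ⋃ e ∈ H.edgeSet, γ.emap e

/-- The image of a whole drawing. -/
def Drawing.totalImage (γ : Drawing G) : Set Plane :=
  range γ.vmap ∪ ⋃ e ∈ G.edgeSet, γ.emap e

/-- The union of all bounded complementary components of a set in the plane: for a
Jordan curve this is the open disk bounded by the curve. -/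
def boundedSide (s : Set Plane) : Set Plane :=
  {p | p ∉ s ∧ IsBounded (connectedComponentIn sᶜ p)}

/-- For a Jordan curve, the closed disk bounded by the curve. -/
def closedRegion (s : Set Plane) : Set Plane :=
  s ∪ boundedSide s

/-- A subgraph is a cycle: connected, finite, and every vertex has exactly two
neighbours. -/
def IsCycleSubgraph (H : G.Subgraph) : Prop :=
  H.Connected ∧ H.verts.Finite ∧ ∀ v ∈ H.verts, (H.neighborSet v).ncard = 2

/-- A subgraph is crossing-free in a drawing if none of its edges is crossed by
another edge of `G`. -/
def Drawing.CrossingFree (γ : Drawing G) (H : G.Subgraph) : Prop :=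
  ∀ e ∈ H.edgeSet, ∀ e' ∈ G.edgeSet, e ≠ e' → γ.emap e ∩ γ.emap e' = ∅

/-- A sequence of cycles `C 0, …, C (t-1)` is a nest in `γ`: the cycles are pairwise
edge-disjoint, each is crossing-free in `γ`, and the image of each cycle is contained
in the closed disk bounded by the image of the previous one. -/
def Drawing.IsNest (γ : Drawing G) {t : ℕ} (C : Fin t → G.Subgraph) : Prop :=
  (∀ i, IsCycleSubgraph (C i)) ∧
  (∀ i j, i ≠ j → Disjoint (C i).edgeSet (C j).edgeSet) ∧
  (∀ i, γ.CrossingFree (C i)) ∧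
  (∀ i : ℕ, ∀ h : i + 1 < t,
    γ.image (C ⟨i + 1, h⟩) ⊆ closedRegion (γ.image (C ⟨i, by omega⟩)))

/-- An `s`-nest: a nest such that any two distinct cycles intersect exactly in a fixed
set `X` of `s` vertices. -/
def Drawing.IsSNest (γ : Drawing G) (s : ℕ) {t : ℕ} (C : Fin t → G.Subgraph) : Prop :=
  γ.IsNest C ∧ ∃ X : Set V, X.Finite ∧ X.ncard = s ∧
    ∀ i j, i ≠ j → (C i).verts ∩ (C j).verts = X

/-- A nest `C 0, …, C (t-1)` in `γ` is clean if every crossing of `γ` lies either in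
the open disk bounded by the image of the last cycle or outside the closed disk
bounded by the image of the first cycle. -/
def Drawing.IsCleanNest (γ : Drawing G) {t : ℕ} (C : Fin t → G.Subgraph) : Prop :=
  ∀ h : 0 < t, ∀ p ∈ γ.crossings,
    p ∈ boundedSide (γ.image (C ⟨t - 1, by omega⟩)) ∨
      p ∉ closedRegion (γ.image (C ⟨0, h⟩))

/-- A drawing is generic: no point lies on three distinct edges, and no two adjacent
edges cross. -/
def Drawing.Generic (γ : Drawing G) : Prop :=
  (∀ p : Plane, ∀ e₁ ∈ G.edgeSet, ∀ e₂ ∈ G.edgeSet, ∀ e₃ ∈ G.edgeSet,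
    p ∈ γ.emap e₁ → p ∈ γ.emap e₂ → p ∈ γ.emap e₃ → e₁ = e₂ ∨ e₁ = e₃ ∨ e₂ = e₃) ∧
  (∀ e ∈ G.edgeSet, ∀ e' ∈ G.edgeSet, e ≠ e' → (∃ v : V, v ∈ e ∧ v ∈ e') →
    γ.emap e ∩ γ.emap e' = ∅)

/-- The faces of a (crossing-free) drawing: the connected components of the complement
of its image. -/
def Drawing.faces (γ : Drawing G) : Set (Set Plane) :=
  {F | ∃ x, x ∉ γ.totalImage ∧ F = connectedComponentIn γ.totalImageᶜ x}

/-- The length of (the boundary of) a face: the number of edges of the graph drawn on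
its frontier. -/
def Drawing.faceLength (γ : Drawing G) (F : Set Plane) : ℕ :=
  {e | e ∈ G.edgeSet ∧ γ.emap e ⊆ frontier F}.ncard

/-- A drawing is a plane triangulation if it has no crossings and every face (including
the outer face) is bounded by a triangle of the graph. -/
def Drawing.IsPlaneTriangulation (γ : Drawing G) : Prop :=
  γ.crossings = ∅ ∧
  ∀ F ∈ γ.faces, ∃ T : G.Subgraph, IsCycleSubgraph T ∧ T.verts.ncard = 3 ∧
    frontier F = γ.image T

section


/-! ### Continuous logarithms -/

/-- `g` has a continuous logarithm on `K`. -/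
def HasLog (K : Set ℂ) (g : ℂ → ℂ) : Prop :=
  ∃ h : ℂ → ℂ, ContinuousOn h K ∧ ∀ z ∈ K, Complex.exp (h z) = g z

theorem HasLog.mono {K L : Set ℂ} {g : ℂ → ℂ} (h : HasLog L g) (hKL : K ⊆ L) : HasLog K g := by
  obtain ⟨f, hf, hf'⟩ := h
  exact ⟨f, hf.mono hKL, fun z hz => hf' z (hKL hz)⟩

theorem HasLog.congr {K : Set ℂ} {g g' : ℂ → ℂ} (h : HasLog K g) (hg : ∀ z ∈ K, g z = g' z) :
    HasLog K g' := by
  obtain ⟨f, hf, hf'⟩ := h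
  exact ⟨f, hf, fun z hz => (hf' z hz).trans (hg z hz)⟩

theorem HasLog.mul {K : Set ℂ} {g g' : ℂ → ℂ} (h : HasLog K g) (h' : HasLog K g') :
    HasLog K (fun z => g z * g' z) := by
  obtain ⟨f, hf, hf'⟩ := h
  obtain ⟨k, hk, hk'⟩ := h'
  exact ⟨fun z => f z + k z, hf.add hk, fun z hz => by
    rw [Complex.exp_add, hf' z hz, hk' z hz]⟩

theorem HasLog.inv {K : Set ℂ} {g : ℂ → ℂ} (h : HasLog K g) :
    HasLog K (fun z => (g z)⁻¹) := by
  obtain ⟨f, hf, hf'⟩ := h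
  exact ⟨fun z => - f z, hf.neg, fun z hz => by
    rw [Complex.exp_neg, hf' z hz]⟩

/-- Two continuous functions with the same exponential on a preconnected set differ by a
constant. -/
theorem exp_eq_const {α : Type*} [TopologicalSpace α] {S : Set α} (hS : IsPreconnected S)
    {h₁ h₂ : α → ℂ} (c₁ : ContinuousOn h₁ S) (c₂ : ContinuousOn h₂ S)
    (he : ∀ z ∈ S, Complex.exp (h₁ z) = Complex.exp (h₂ z)) {x y : α} (hx : x ∈ S) (hy : y ∈ S) :
    h₁ x - h₂ x = h₁ y - h₂ y := by
  have key : ∀ z ∈ S, ∃ n : ℤ, h₁ z - h₂ z = n * (2 * Real.pi * Complex.I) := by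
    intro z hz
    obtain ⟨n, hn⟩ := Complex.exp_eq_exp_iff_exists_int.1 (he z hz)
    exact ⟨n, by rw [hn]; ring⟩
  have hpi : (2 * Real.pi * Complex.I : ℂ) ≠ 0 := Complex.two_pi_I_ne_zero
  have cont : ContinuousOn (fun z => ((h₁ z - h₂ z) / (2 * Real.pi * Complex.I)).re) S :=
    Complex.continuous_re.comp_continuousOn ((c₁.sub c₂).div_const _)
  have hmaps : MapsTo (fun z => ((h₁ z - h₂ z) / (2 * Real.pi * Complex.I)).re) S
      (range (fun n : ℤ => (n : ℝ))) := by
    intro z hz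
    obtain ⟨n, hn⟩ := key z hz
    refine ⟨n, ?_⟩
    simp only [hn]
    rw [mul_div_cancel_right₀ _ hpi]; simp
  have hdisc : IsDiscrete (range (fun n : ℤ => (n : ℝ))) := by
    have := Int.isClosedEmbedding_coe_real.toIsEmbedding
    exact ⟨(this.toHomeomorph.symm.isEmbedding.discreteTopology)⟩
  have h := hS.constant_of_mapsTo hdisc cont hmaps hx hy
  obtain ⟨n, hn⟩ := key x hx
  obtain ⟨m, hm⟩ := key y hy
  simp only [hn, hm] at h
  rw [mul_div_cancel_right₀ _ hpi, mul_div_cancel_right₀ _ hpi] at h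
  have : n = m := by simpa using h
  rw [hn, hm, this]

/-- Nonvanishing functions on compact star-shaped sets have logarithms. -/
theorem exists_log_starConvex {E : Type*} [NormedAddCommGroup E] [NormedSpace ℝ E] {S : Set E}
    (hS : IsCompact S) (hst : StarConvex ℝ 0 S) (h0 : (0 : E) ∈ S) {g : E → ℂ}
    (hg : ContinuousOn g S)
    (hne : ∀ z ∈ S, g z ≠ 0) :
    ∃ h : E → ℂ, ContinuousOn h S ∧ ∀ z ∈ S, Complex.exp (h z) = g z := by
  have hsm : ∀ z ∈ S, ∀ t : ℝ, 0 ≤ t → t ≤ 1 → t • z ∈ S := by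
    intro z hz t h1 h2
    exact hst.smul_mem hz h1 h2
  -- lower bound
  obtain ⟨z0, hz0, hmin⟩ := hS.exists_isMinOn ⟨0, h0⟩ (hg.norm)
  set δ := ‖g z0‖ with hδ
  have hδpos : 0 < δ := norm_pos_iff.2 (hne z0 hz0)
  have hlow : ∀ z ∈ S, δ ≤ ‖g z‖ := fun z hz => hmin hz
  have huc : UniformContinuousOn g S := hS.uniformContinuousOn_of_continuous hg
  rw [Metric.uniformContinuousOn_iff] at huc
  obtain ⟨ε, hε, hεg⟩ := huc δ hδpos
  obtain ⟨M, hM⟩ := hS.isBounded.exists_norm_le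
  obtain ⟨N, hN⟩ := exists_nat_gt (M / ε)
  have hM0 : 0 ≤ M := (norm_nonneg _).trans (hM 0 h0)
  have hNpos : (0 : ℝ) < N := lt_of_le_of_lt (by positivity) hN
  have hclose : ∀ k : ℕ, k + 1 ≤ N → ∀ z ∈ S,
      g (((k + 1 : ℕ) / N : ℝ) • z) / g ((k / N : ℝ) • z) ∈ Complex.slitPlane := by
    intro k hk z hz
    have hk' : ((k : ℝ) + 1) ≤ N := by exact_mod_cast hk
    have m1 : (((k + 1 : ℕ) / N : ℝ) • z) ∈ S := hsm z hz _ (by positivity) (by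
      rw [div_le_one hNpos]; push_cast; linarith)
    have m2 : ((k / N : ℝ) • z) ∈ S := hsm z hz _ (by positivity) (by
      rw [div_le_one hNpos]; linarith)
    have hd : dist (((k + 1 : ℕ) / N : ℝ) • z) ((k / N : ℝ) • z) < ε := by
      rw [dist_eq_norm, ← sub_smul]
      have : (((k + 1 : ℕ) / N : ℝ) - k / N) = 1 / N := by push_cast; ring
      rw [this, norm_smul, Real.norm_of_nonneg (by positivity)]
      calc 1 / (N : ℝ) * ‖z‖ ≤ 1 / N * M := by gcongr; exact hM z hz
        _ = M / N := by ring
        _ < ε := by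
          rw [div_lt_iff₀ hNpos]
          rw [div_lt_iff₀ hε] at hN; linarith
    have hlt := hεg _ m1 _ m2 hd
    have hw := hne _ m2
    set w := g ((k / N : ℝ) • z)
    set w' := g (((k + 1 : ℕ) / N : ℝ) • z)
    have : ‖w' / w - 1‖ < 1 := by
      have : w' / w - 1 = (w' - w) / w := by field_simp
      rw [this, norm_div, div_lt_one (norm_pos_iff.2 hw)]
      rw [dist_eq_norm] at hlt
      exact lt_of_lt_of_le hlt (hlow _ m2)
    have := Complex.mem_slitPlane_of_norm_lt_one this
    simpa using this
  have main : ∀ k : ℕ, k ≤ N → ∃ h : E → ℂ, ContinuousOn h S ∧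
      ∀ z ∈ S, Complex.exp (h z) = g ((k / N : ℝ) • z) := by
    intro k
    induction k with
    | zero =>
      intro _
      refine ⟨fun _ => Complex.log (g 0), continuousOn_const, fun z hz => ?_⟩
      simp [Complex.exp_log (hne 0 h0)]
    | succ k ih =>
      intro hk
      obtain ⟨h, hc, he⟩ := ih (by omega)
      have hk' : ((k : ℝ) + 1) ≤ N := by exact_mod_cast hk
      have c1 : ∀ t : ℝ, 0 ≤ t → t ≤ 1 → ContinuousOn (fun z => g (t • z)) S := fun t h1 h2 =>
        hg.comp (continuous_const_smul t).continuousOn (fun z hz => hsm z hz t h1 h2)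
      have b2 : (k / N : ℝ) ≤ 1 := by rw [div_le_one hNpos]; linarith
      have b1 : (((k + 1 : ℕ) : ℝ) / N : ℝ) ≤ 1 := by rw [div_le_one hNpos]; push_cast; linarith
      have hne2 : ∀ z ∈ S, g ((k / N : ℝ) • z) ≠ 0 := fun z hz =>
        hne _ (hsm z hz _ (by positivity) b2)
      refine ⟨fun z => h z + Complex.log
        (g (((k + 1 : ℕ) / N : ℝ) • z) / g ((k / N : ℝ) • z)), ?_, ?_⟩
      · refine hc.add (ContinuousOn.clog ?_ (fun z hz => hclose k hk z hz))
        exact (c1 _ (by positivity) b1).div (c1 _ (by positivity) b2) hne2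
      · intro z hz
        rw [Complex.exp_add, he z hz, Complex.exp_log]
        · field_simp [hne2 z hz]
        · exact Complex.slitPlane_ne_zero (hclose k hk z hz)
  obtain ⟨h, hc, he⟩ := main N le_rfl
  refine ⟨h, hc, fun z hz => ?_⟩
  rw [he z hz, div_self hNpos.ne', one_smul]

theorem exists_log_Icc {f : ℝ → ℂ} (hf : ContinuousOn f (Icc 0 1)) (hne : ∀ t ∈ Icc (0:ℝ) 1, f t ≠ 0) :
    ∃ h : ℝ → ℂ, ContinuousOn h (Icc 0 1) ∧ ∀ t ∈ Icc (0:ℝ) 1, Complex.exp (h t) = f t :=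
  exists_log_starConvex isCompact_Icc ((convex_Icc 0 1).starConvex (by simp)) (by simp) hf hne

/-- No logarithm of `(z-a)^k` on a circle around `a`. -/
theorem not_hasLog_circle (a : ℂ) {r : ℝ} (hr : 0 < r) {k : ℤ} (hk : k ≠ 0) :
    ¬ HasLog (Metric.sphere a r) (fun z => (z - a) ^ k) := by
  rintro ⟨h, hc, he⟩
  set c : ℝ → ℂ := fun θ => circleMap a r θ with hcdef
  have hmem : ∀ θ, c θ ∈ Metric.sphere a r := fun θ => circleMap_mem_sphere a hr.le θ
  have hr' : (r : ℂ) ≠ 0 := by exact_mod_cast hr.ne'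
  have h1 : ContinuousOn (fun θ : ℝ => h (c θ)) univ :=
    hc.comp (continuous_circleMap a r).continuousOn (fun θ _ => hmem θ)
  have h2 : ContinuousOn (fun θ : ℝ => k * (Complex.log r + θ * Complex.I)) univ := by fun_prop
  have hee : ∀ θ ∈ (univ : Set ℝ), Complex.exp (h (c θ)) =
      Complex.exp (k * (Complex.log r + θ * Complex.I)) := by
    intro θ _
    rw [he _ (hmem θ), Complex.exp_int_mul, Complex.exp_add, Complex.exp_log hr']
    simp [hcdef, circleMap]
  have := exp_eq_const isPreconnected_univ h1 h2 hee (mem_univ 0) (mem_univ (2 * Real.pi))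
  have hc0 : c 0 = c (2 * Real.pi) := by simp [hcdef, circleMap]
  rw [hc0] at this
  have h3 : (k : ℂ) * (2 * Real.pi * Complex.I) = 0 := by
    push_cast at this
    linear_combination this
  rcases mul_eq_zero.1 h3 with h | h
  · exact hk (by exact_mod_cast h)
  · exact Complex.two_pi_I_ne_zero h

/-- Logarithms of `(z-p)/(z-q)` for `p`, `q` in a preconnected subset of the complement. -/
theorem hasLog_of_preconnected {K S : Set ℂ} (hK : IsCompact K) (hS : IsPreconnected S)
    (hSK : S ⊆ Kᶜ) {p q : ℂ} (hp : p ∈ S) (hq : q ∈ S) :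
    HasLog K (fun z => (z - p) / (z - q)) := by
  have loc : ∀ x ∈ Kᶜ, ∃ ε > 0, ∀ y, dist y x < ε → y ∈ Kᶜ ∧ HasLog K (fun z => (z - y) / (z - x)) := by
    intro x hx
    obtain ⟨ε, hε, hb⟩ := Metric.isOpen_iff.1 hK.isClosed.isOpen_compl x hx
    refine ⟨ε, hε, fun y hy => ⟨hb hy, ?_⟩⟩
    have hslit : ∀ z ∈ K, (z - y) / (z - x) ∈ Complex.slitPlane := by
      intro z hz
      have hzx : ε ≤ ‖z - x‖ := by
        by_contra hlt
        exact hb (by rw [Metric.mem_ball, dist_eq_norm]; push Not at hlt; exact hlt) hz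
      have hpos : 0 < ‖z - x‖ := lt_of_lt_of_le hε hzx
      have hne : z - x ≠ 0 := norm_pos_iff.1 hpos
      have : ‖(z - y) / (z - x) - 1‖ < 1 := by
        have : (z - y) / (z - x) - 1 = (x - y) / (z - x) := by field_simp; ring
        rw [this, norm_div, div_lt_one hpos]
        rw [dist_comm, dist_eq_norm] at hy
        linarith
      have := Complex.mem_slitPlane_of_norm_lt_one this
      simpa using this
    refine ⟨fun z => Complex.log ((z - y) / (z - x)), ContinuousOn.clog ?_ hslit, fun z hz =>
      Complex.exp_log (Complex.slitPlane_ne_zero (hslit z hz))⟩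
    refine ContinuousOn.div (by fun_prop) (by fun_prop) fun z hz h0 => hx ?_
    rw [sub_eq_zero] at h0; rwa [← h0]
  have trans : ∀ a b c : ℂ, b ∈ Kᶜ → HasLog K (fun z => (z - a) / (z - b)) →
      HasLog K (fun z => (z - b) / (z - c)) → HasLog K (fun z => (z - a) / (z - c)) := by
    intro a b c hb h1 h2
    refine (h1.mul h2).congr fun z hz => ?_
    have : z - b ≠ 0 := fun h0 => hb (by rw [sub_eq_zero] at h0; rwa [← h0])
    field_simp
  have symm : ∀ a b : ℂ, HasLog K (fun z => (z - a) / (z - b)) →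
      HasLog K (fun z => (z - b) / (z - a)) := by
    intro a b h1
    refine h1.inv.congr fun z hz => ?_
    rw [inv_div]
  -- open-closed argument
  let A : Set ℂ := {x | x ∈ Kᶜ ∧ HasLog K (fun z => (z - x) / (z - q))}
  let B : Set ℂ := {x | x ∈ Kᶜ ∧ ¬ HasLog K (fun z => (z - x) / (z - q))}
  have hA : IsOpen A := by
    rw [Metric.isOpen_iff]
    rintro x ⟨hx, hxl⟩
    obtain ⟨ε, hε, h⟩ := loc x hx
    exact ⟨ε, hε, fun y hy => ⟨(h y hy).1, trans y x q hx (h y hy).2 hxl⟩⟩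
  have hB : IsOpen B := by
    rw [Metric.isOpen_iff]
    rintro x ⟨hx, hxl⟩
    obtain ⟨ε, hε, h⟩ := loc x hx
    exact ⟨ε, hε, fun y hy => ⟨(h y hy).1, fun hy' =>
      hxl (trans x y q (h y hy).1 (symm _ _ (h y hy).2) hy')⟩⟩
  by_contra hcon
  have hqq : HasLog K (fun z => (z - q) / (z - q)) := by
    refine ⟨fun _ => 0, continuousOn_const, fun z hz => ?_⟩
    have : z - q ≠ 0 := fun h0 => hSK hq (by rw [sub_eq_zero] at h0; rwa [← h0])
    simp [this]
  obtain ⟨x, _, hxA, hxB⟩ := hS A B hA hB (fun x hx => by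
      by_cases h : HasLog K (fun z => (z - x) / (z - q))
      · exact Or.inl ⟨hSK hx, h⟩
      · exact Or.inr ⟨hSK hx, h⟩) ⟨q, hq, hSK hq, hqq⟩ ⟨p, hp, hSK hp, hcon⟩
  exact hxB.2 hxA.2

theorem compl_closedBall_preconnected (R : ℝ) :
    IsPreconnected (Metric.closedBall (0 : ℂ) R)ᶜ := by
  have : (Metric.closedBall (0 : ℂ) R)ᶜ =
      (fun x : ℝ × ℝ => (x.1 : ℂ) * Complex.exp (x.2 * Complex.I)) '' (Ioi R ×ˢ univ) := by
    ext z
    simp only [mem_compl_iff, Metric.mem_closedBall, dist_zero_right, not_le, mem_image, mem_prod,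
      mem_Ioi, mem_univ, and_true, Prod.exists]
    constructor
    · intro h
      exact ⟨‖z‖, z.arg, h, Complex.norm_mul_exp_arg_mul_I z⟩
    · rintro ⟨a, b, h, rfl⟩
      rw [norm_mul, Complex.norm_exp_ofReal_mul_I, Complex.norm_real, mul_one]
      exact lt_of_lt_of_le h (le_abs_self a)
  rw [this]
  refine IsPreconnected.image (isPreconnected_Ioi.prod isPreconnected_univ) _ ?_
  fun_prop

/-- Two unbounded components coincide. -/
theorem unbounded_comp_eq {K : Set ℂ} (hK : IsCompact K) {p q : ℂ}
    (hp : ¬ IsBounded (connectedComponentIn Kᶜ p))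
    (hq : ¬ IsBounded (connectedComponentIn Kᶜ q)) :
    connectedComponentIn Kᶜ p = connectedComponentIn Kᶜ q := by
  obtain ⟨R, hR⟩ := hK.isBounded.subset_closedBall 0
  set R' := max R 0
  have hR' : K ⊆ Metric.closedBall 0 R' := hR.trans (Metric.closedBall_subset_closedBall (le_max_left _ _))
  have ex : ∀ x : ℂ, ¬ IsBounded (connectedComponentIn Kᶜ x) →
      ∃ y ∈ connectedComponentIn Kᶜ x, y ∈ (Metric.closedBall (0 : ℂ) R')ᶜ := by
    intro x hx
    by_contra hcon
    push Not at hcon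
    exact hx ((Metric.isBounded_closedBall (x := (0 : ℂ)) (r := R')).subset
      (fun y hy => by simpa using hcon y hy))
  obtain ⟨y, hy, hyR⟩ := ex p hp
  obtain ⟨y', hy', hyR'⟩ := ex q hq
  have hsub := (compl_closedBall_preconnected R').subset_connectedComponentIn hyR
    (compl_subset_compl.2 hR')
  rw [connectedComponentIn_eq hy, connectedComponentIn_eq hy']
  exact connectedComponentIn_eq (hsub hyR')

/-- Frontier of a component of the complement of a closed set. -/
theorem closure_comp_subset {K : Set ℂ} (hK : IsClosed K) (p : ℂ) :
    closure (connectedComponentIn Kᶜ p) ⊆ connectedComponentIn Kᶜ p ∪ K := by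
  intro z hz
  by_cases hzK : z ∈ K
  · exact Or.inr hzK
  · left
    have hopen : IsOpen (connectedComponentIn Kᶜ z) := hK.isOpen_compl.connectedComponentIn
    obtain ⟨y, hy1, hy2⟩ := mem_closure_iff.1 hz _ hopen (mem_connectedComponentIn hzK)
    rw [connectedComponentIn_eq hy2, ← connectedComponentIn_eq hy1]
    exact mem_connectedComponentIn hzK

/-- The basic obstruction: in a bounded component. -/
theorem no_log_bounded {K : Set ℂ} (hK : IsCompact K) {p : ℂ} (hp : p ∈ Kᶜ)
    (hb : IsBounded (connectedComponentIn Kᶜ p)) {k : ℤ} (hk : k ≠ 0) {G : ℂ → ℂ}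
    (hG : ContinuousOn G (K ∪ connectedComponentIn Kᶜ p))
    (hG0 : ∀ z ∈ K ∪ connectedComponentIn Kᶜ p, G z ≠ 0)
    (hlog : HasLog K (fun z => (z - p) ^ k * G z)) : False := by
  classical
  obtain ⟨h, hc, he⟩ := hlog
  set U := connectedComponentIn Kᶜ p with hU
  have hUo : IsOpen U := hK.isClosed.isOpen_compl.connectedComponentIn
  have hpU : p ∈ U := mem_connectedComponentIn hp
  -- Tietze extension
  obtain ⟨h', hh'⟩ : ∃ h' : C(ℂ, ℂ), ∀ z ∈ K, h' z = h z := by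
    obtain ⟨h', hh'⟩ := ContinuousMap.exists_restrict_eq hK.isClosed (⟨K.domRestrict h, hc.domRestrict⟩ : C(K, ℂ))
    refine ⟨h', fun z hz => ?_⟩
    have := congrArg (fun f : C(K, ℂ) => f ⟨z, hz⟩) hh'
    exact this
  have hcl : closure U ⊆ K ∪ U := by
    rw [union_comm]; exact closure_comp_subset hK.isClosed p
  let F : ℂ → ℂ := fun z => if z ∈ U then Complex.exp (h' z) / G z else (z - p) ^ k
  have hfr : frontier U ⊆ K := by
    intro z hz
    rcases hcl (frontier_subset_closure hz) with h | h
    · exact h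
    · exact absurd hz (by rw [hUo.frontier_eq]; exact fun hh => hh.2 h)
  have hF : Continuous F := by
    refine continuous_if ?_ ?_ ?_
    · intro z hz
      have hzK : z ∈ K := hfr hz
      rw [hh' z hzK, he z hzK]
      have := hG0 z (Or.inl hzK)
      field_simp
    · refine ContinuousOn.div (by fun_prop) (hG.mono hcl) (fun z hz => hG0 z (hcl hz))
    · have : closure {a | a ∉ U} = {a | a ∉ U} := hUo.isClosed_compl.closure_eq
      rw [this]
      refine ContinuousOn.zpow₀ (by fun_prop) _ fun z hz => Or.inl ?_
      intro h0
      rw [sub_eq_zero] at h0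
      exact hz (h0 ▸ hpU)
  have hFne : ∀ z, F z ≠ 0 := by
    intro z
    by_cases hz : z ∈ U
    · simp only [F, hz, if_true]
      exact div_ne_zero (Complex.exp_ne_zero _) (hG0 z (Or.inr hz))
    · simp only [F, hz, if_false]
      refine zpow_ne_zero _ fun h0 => ?_
      rw [sub_eq_zero] at h0
      exact hz (h0 ▸ hpU)
  obtain ⟨R, hR⟩ := hb.subset_closedBall p
  set R' := max R 0 + 1
  have hR'pos : 0 < R' := by positivity
  obtain ⟨L, hLc, hLe⟩ := exists_log_starConvex (isCompact_closedBall (0 : ℂ) R')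
    ((convex_closedBall (0 : ℂ) R').starConvex (by simp [hR'pos.le])) (by simp [hR'pos.le])
    (g := fun z => F (z + p)) (by fun_prop) (fun z _ => hFne _)
  refine not_hasLog_circle p hR'pos hk ⟨fun z => L (z - p), ?_, ?_⟩
  · refine hLc.comp (by fun_prop) ?_
    intro z hz
    simp only [mem_sphere_iff_norm] at hz
    simp [hz]
  · intro z hz
    rw [mem_sphere_iff_norm] at hz
    rw [hLe _ (by simp [hz])]
    have hzU : z ∉ U := by
      intro hzU
      have := hR hzU
      rw [Metric.mem_closedBall, dist_eq_norm, hz] at this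
      have : R ≤ max R 0 := le_max_left _ _
      linarith
    simp [F, hzU]

/-- Eilenberg's criterion. -/
theorem comp_eq_of_hasLog {K : Set ℂ} (hK : IsCompact K) {p q : ℂ} (hp : p ∈ Kᶜ) (hq : q ∈ Kᶜ)
    (hlog : HasLog K (fun z => (z - p) / (z - q))) :
    connectedComponentIn Kᶜ p = connectedComponentIn Kᶜ q := by
  by_contra hne
  have aux : ∀ p q : ℂ, p ∈ Kᶜ → q ∈ Kᶜ → HasLog K (fun z => (z - p) / (z - q)) →
      connectedComponentIn Kᶜ p ≠ connectedComponentIn Kᶜ q →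
      ¬ IsBounded (connectedComponentIn Kᶜ p) := by
    intro p q hp hq hlog hne hb
    have hqn : ∀ z ∈ K ∪ connectedComponentIn Kᶜ p, z - q ≠ 0 := by
      rintro z hz h0
      rw [sub_eq_zero] at h0
      subst h0
      rcases hz with h | h
      · exact hq h
      · exact hne (connectedComponentIn_eq h)
    refine no_log_bounded hK hp hb (k := 1) one_ne_zero (G := fun z => (z - q)⁻¹) ?_ ?_ ?_
    · exact ContinuousOn.inv₀ (by fun_prop) hqn
    · intro z hz
      exact inv_ne_zero (hqn z hz)
    · refine hlog.congr fun z _ => ?_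
      rw [zpow_one, div_eq_mul_inv]
  refine hne (unbounded_comp_eq hK (aux p q hp hq hlog hne) (aux q p hq hp ?_ (Ne.symm hne)))
  exact hlog.inv.congr fun z _ => inv_div _ _

end

section


theorem hasLog_glue {K B : Set ℂ} (hK : IsClosed K) (hB : IsClosed B) {g α β : ℂ → ℂ} {c : ℂ}
    (hα : ContinuousOn α K) (hβ : ContinuousOn β B) (eα : ∀ z ∈ K, Complex.exp (α z) = g z)
    (eβ : ∀ z ∈ B, Complex.exp (β z) = g z) (hc : Complex.exp c = 1)
    (hag : ∀ z ∈ K, z ∈ B → α z = β z + c) : HasLog (K ∪ B) g := by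
  classical
  let h : ℂ → ℂ := fun z => if z ∈ K then α z else β z + c
  have h1 : ∀ z ∈ K, h z = α z := fun z hz => by simp [h, hz]
  have h2 : ∀ z ∈ B, h z = β z + c := fun z hz => by
    by_cases hz' : z ∈ K
    · rw [h1 z hz', hag z hz' hz]
    · simp [h, hz']
  refine ⟨h, ?_, ?_⟩
  · exact (hα.congr h1).union_of_isClosed ((hβ.add continuousOn_const).congr h2) hK hB
  · rintro z (hz | hz)
    · rw [h1 z hz, eα z hz]
    · rw [h2 z hz, Complex.exp_add, hc, mul_one, eβ z hz]

/-- Three components of the complement of `K ∪ B` which are not separated by `K`, when `B` is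
an arc-like set attached to `K` at two points at most. -/
theorem three_points {K B : Set ℂ} (hK : IsCompact K) (hB : IsCompact B)
    (hBlog : ∀ g : ℂ → ℂ, ContinuousOn g B → (∀ z ∈ B, g z ≠ 0) → HasLog B g)
    {a b : ℂ} (hab : K ∩ B ⊆ {a, b}) {p₁ p₂ p₃ : ℂ}
    (h₁ : p₁ ∈ (K ∪ B)ᶜ) (h₂ : p₂ ∈ (K ∪ B)ᶜ) (h₃ : p₃ ∈ (K ∪ B)ᶜ)
    (l₂ : HasLog K (fun z => (z - p₂) / (z - p₁)))
    (l₃ : HasLog K (fun z => (z - p₃) / (z - p₁)))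
    (n₁₂ : connectedComponentIn (K ∪ B)ᶜ p₂ ≠ connectedComponentIn (K ∪ B)ᶜ p₁)
    (n₁₃ : connectedComponentIn (K ∪ B)ᶜ p₃ ≠ connectedComponentIn (K ∪ B)ᶜ p₁)
    (n₂₃ : connectedComponentIn (K ∪ B)ᶜ p₂ ≠ connectedComponentIn (K ∪ B)ᶜ p₃) : False := by
  have hKB : IsCompact (K ∪ B) := hK.union hB
  have nz : ∀ p ∈ (K ∪ B)ᶜ, ∀ z ∈ K ∪ B, z - p ≠ 0 := by
    intro p hp z hz h0
    rw [sub_eq_zero] at h0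
    exact hp (h0 ▸ hz)
  have lB : ∀ p ∈ (K ∪ B)ᶜ, HasLog B (fun z => (z - p) / (z - p₁)) := by
    intro p hp
    refine hBlog _ ?_ ?_
    · exact ContinuousOn.div (by fun_prop) (by fun_prop) fun z hz => nz p₁ h₁ z (Or.inr hz)
    · exact fun z hz => div_ne_zero (nz p hp z (Or.inr hz)) (nz p₁ h₁ z (Or.inr hz))
  obtain ⟨α₂, cα₂, eα₂⟩ := l₂
  obtain ⟨α₃, cα₃, eα₃⟩ := l₃
  obtain ⟨β₂, cβ₂, eβ₂⟩ := lB p₂ h₂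
  obtain ⟨β₃, cβ₃, eβ₃⟩ := lB p₃ h₃
  have hlat₂ : ∀ z ∈ K, z ∈ B → ∃ n : ℤ, α₂ z = β₂ z + n * (2 * Real.pi * Complex.I) :=
    fun z hz hz' => Complex.exp_eq_exp_iff_exists_int.1 ((eα₂ z hz).trans (eβ₂ z hz').symm)
  have hlat₃ : ∀ z ∈ K, z ∈ B → ∃ n : ℤ, α₃ z = β₃ z + n * (2 * Real.pi * Complex.I) :=
    fun z hz hz' => Complex.exp_eq_exp_iff_exists_int.1 ((eα₃ z hz).trans (eβ₃ z hz').symm)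
  have hexp : ∀ n : ℤ, Complex.exp (n * (2 * Real.pi * Complex.I)) = 1 :=
    fun n => Complex.exp_int_mul_two_pi_mul_I n
  -- a constant difference gives a logarithm
  have noconst : ¬ ∃ n : ℤ, ∀ z ∈ K, z ∈ B → α₂ z = β₂ z + n * (2 * Real.pi * Complex.I) := by
    rintro ⟨n, hn⟩
    exact n₁₂ (comp_eq_of_hasLog hKB h₂ h₁
      (hasLog_glue hK.isClosed hB.isClosed cα₂ cβ₂ eα₂ eβ₂ (hexp n) hn))
  have noconst₃ : ¬ ∃ n : ℤ, ∀ z ∈ K, z ∈ B → α₃ z = β₃ z + n * (2 * Real.pi * Complex.I) := by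
    rintro ⟨n, hn⟩
    exact n₁₃ (comp_eq_of_hasLog hKB h₃ h₁
      (hasLog_glue hK.isClosed hB.isClosed cα₃ cβ₃ eα₃ eβ₃ (hexp n) hn))
  have hsingle : ∀ x : ℂ, ¬ (K ∩ B ⊆ {x}) := by
    intro x hx
    by_cases hxm : x ∈ K ∧ x ∈ B
    · obtain ⟨n, hn⟩ := hlat₂ x hxm.1 hxm.2
      exact noconst ⟨n, fun z hz hz' => by
        have : z = x := hx ⟨hz, hz'⟩
        rw [this, hn]⟩
    · exact noconst ⟨0, fun z hz hz' => by
        have : z = x := hx ⟨hz, hz'⟩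
        exact absurd ⟨this ▸ hz, this ▸ hz'⟩ hxm⟩
  have ha : a ∈ K ∧ a ∈ B := by
    by_contra hcon
    refine hsingle b fun z hz => ?_
    rcases hab hz with h | h
    · exact absurd (h ▸ hz) hcon
    · exact h
  have hb : b ∈ K ∧ b ∈ B := by
    by_contra hcon
    refine hsingle a fun z hz => ?_
    rcases hab hz with h | h
    · exact h
    · exact absurd (show b ∈ K ∧ b ∈ B from (mem_singleton_iff.1 h) ▸ hz) hcon
  obtain ⟨A₂, hA₂⟩ := hlat₂ a ha.1 ha.2
  obtain ⟨B₂, hB₂⟩ := hlat₂ b hb.1 hb.2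
  obtain ⟨A₃, hA₃⟩ := hlat₃ a ha.1 ha.2
  obtain ⟨B₃, hB₃⟩ := hlat₃ b hb.1 hb.2
  have hne₂ : B₂ - A₂ ≠ 0 := by
    intro h
    refine noconst ⟨A₂, fun z hz hz' => ?_⟩
    rcases hab ⟨hz, hz'⟩ with h' | h'
    · rw [h', hA₂]
    · rw [mem_singleton_iff.1 h', hB₂, sub_eq_zero.1 h]
  have hne₃ : B₃ - A₃ ≠ 0 := by
    intro h
    refine noconst₃ ⟨A₃, fun z hz hz' => ?_⟩
    rcases hab ⟨hz, hz'⟩ with h' | h'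
    · rw [h', hA₃]
    · rw [mem_singleton_iff.1 h', hB₃, sub_eq_zero.1 h]
  set m₂ := B₂ - A₂ with hm₂
  set m₃ := B₃ - A₃ with hm₃
  have hlog : HasLog (K ∪ B)
      (fun z => ((z - p₂) / (z - p₁)) ^ m₃ * ((z - p₃) / (z - p₁)) ^ (-m₂)) := by
    refine hasLog_glue (α := fun z => m₃ * α₂ z + (-m₂ : ℤ) * α₃ z)
      (β := fun z => m₃ * β₂ z + (-m₂ : ℤ) * β₃ z)
      (c := (m₃ * A₂ - m₂ * A₃ : ℤ) * (2 * Real.pi * Complex.I)) hK.isClosed hB.isClosed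
      ((continuousOn_const.mul cα₂).add (continuousOn_const.mul cα₃))
      ((continuousOn_const.mul cβ₂).add (continuousOn_const.mul cβ₃)) ?_ ?_ (hexp _) ?_
    · intro z hz
      rw [Complex.exp_add, Complex.exp_int_mul, Complex.exp_int_mul, eα₂ z hz, eα₃ z hz]
    · intro z hz
      rw [Complex.exp_add, Complex.exp_int_mul, Complex.exp_int_mul, eβ₂ z hz, eβ₃ z hz]
    · intro z hz hz'
      rcases hab ⟨hz, hz'⟩ with h' | h'
      · rw [h', hA₂, hA₃]; push_cast; ring
      · rw [mem_singleton_iff.1 h', hB₂, hB₃, hm₂, hm₃]; push_cast; ring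
  have aux : ∀ p q : ℂ, p ∈ (K ∪ B)ᶜ → q ∈ (K ∪ B)ᶜ → ∀ k l : ℤ, k ≠ 0 →
      connectedComponentIn (K ∪ B)ᶜ p ≠ connectedComponentIn (K ∪ B)ᶜ p₁ →
      connectedComponentIn (K ∪ B)ᶜ p ≠ connectedComponentIn (K ∪ B)ᶜ q →
      HasLog (K ∪ B) (fun z => ((z - p) / (z - p₁)) ^ k * ((z - q) / (z - p₁)) ^ l) →
      ¬ IsBounded (connectedComponentIn (K ∪ B)ᶜ p) := by
    intro p q hp hq k l hk hn1 hnq hlog hbd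
    have nz' : ∀ x ∈ (K ∪ B)ᶜ, connectedComponentIn (K ∪ B)ᶜ p ≠ connectedComponentIn (K ∪ B)ᶜ x →
        ∀ z ∈ (K ∪ B) ∪ connectedComponentIn (K ∪ B)ᶜ p, z - x ≠ 0 := by
      rintro x hx hxn z (hz | hz) h0
      · exact nz x hx z hz h0
      · rw [sub_eq_zero] at h0
        exact hxn (connectedComponentIn_eq (h0 ▸ hz))
    refine no_log_bounded hKB hp hbd hk
      (G := fun z => ((z - p₁) ^ k)⁻¹ * ((z - q) / (z - p₁)) ^ l) ?_ ?_ ?_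
    · refine ContinuousOn.mul (ContinuousOn.inv₀ (ContinuousOn.zpow₀ (by fun_prop) _ ?_) ?_)
        (ContinuousOn.zpow₀ (ContinuousOn.div (by fun_prop) (by fun_prop) ?_) _ ?_)
      · exact fun z hz => Or.inl (nz' _ h₁ hn1 z hz)
      · exact fun z hz => zpow_ne_zero _ (nz' _ h₁ hn1 z hz)
      · exact fun z hz => (nz' _ h₁ hn1 z hz)
      · exact fun z hz => Or.inl (div_ne_zero (nz' _ hq hnq z hz) (nz' _ h₁ hn1 z hz))
    · intro z hz
      exact mul_ne_zero (inv_ne_zero (zpow_ne_zero _ (nz' _ h₁ hn1 z hz)))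
        (zpow_ne_zero _ (div_ne_zero (nz' _ hq hnq z hz) (nz' _ h₁ hn1 z hz)))
    · refine hlog.congr fun z _ => ?_
      rw [div_zpow (z - p)]
      ring
  have u₂ := aux p₂ p₃ h₂ h₃ m₃ (-m₂) hne₃ n₁₂ n₂₃ hlog
  have u₃ := aux p₃ p₂ h₃ h₂ (-m₂) m₃ (neg_ne_zero.2 hne₂) n₁₃ (Ne.symm n₂₃)
    (hlog.congr fun z _ => mul_comm _ _)
  exact n₂₃ (unbounded_comp_eq hKB u₂ u₃)

/-- A logarithm of `(z - f 0)/(z - f 1)` off an arc. -/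
theorem exists_arcLog {f : ℝ → ℂ} (hf : ContinuousOn f (Icc 0 1)) :
    ∃ L : ℂ → ℂ, ContinuousOn L (f '' Icc 0 1)ᶜ ∧
      ∀ z ∈ (f '' Icc 0 1)ᶜ, Complex.exp (L z) = (z - f 0) / (z - f 1) := by
  classical
  have nz : ∀ z ∈ (f '' Icc (0:ℝ) 1)ᶜ, ∀ t ∈ Icc (0:ℝ) 1, z - f t ≠ 0 := by
    intro z hz t ht h0
    rw [sub_eq_zero] at h0
    exact hz ⟨t, ht, h0.symm⟩
  have ex : ∀ z : ℂ, ∃ h : ℝ → ℂ, z ∈ (f '' Icc (0:ℝ) 1)ᶜ →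
      (ContinuousOn h (Icc 0 1) ∧ ∀ t ∈ Icc (0:ℝ) 1, Complex.exp (h t) = z - f t) := by
    intro z
    by_cases hz : z ∈ (f '' Icc (0:ℝ) 1)ᶜ
    · obtain ⟨h, hh⟩ := exists_log_Icc (f := fun t => z - f t) (continuousOn_const.sub hf) (nz z hz)
      exact ⟨h, fun _ => hh⟩
    · exact ⟨0, fun h => absurd h hz⟩
  choose l hl using ex
  have h0 : (0:ℝ) ∈ Icc (0:ℝ) 1 := by simp
  have h1 : (1:ℝ) ∈ Icc (0:ℝ) 1 := by simp
  refine ⟨fun z => l z 0 - l z 1, ?_, ?_⟩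
  · have hcl : IsOpen (f '' Icc (0:ℝ) 1)ᶜ := (isCompact_Icc.image_of_continuousOn hf).isClosed.isOpen_compl
    intro z₀ hz₀
    obtain ⟨ε, hε, hball⟩ := Metric.isOpen_iff.1 hcl z₀ hz₀
    refine ContinuousAt.continuousWithinAt ?_
    have hslit : ∀ z, dist z z₀ < ε → ∀ t ∈ Icc (0:ℝ) 1, (z - f t) / (z₀ - f t) ∈ Complex.slitPlane := by
      intro z hz t ht
      have hd : ε ≤ ‖z₀ - f t‖ := by
        by_contra hlt
        push Not at hlt
        exact hball (show f t ∈ Metric.ball z₀ ε by rw [Metric.mem_ball, dist_comm, dist_eq_norm]; exact hlt)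
          ⟨t, ht, rfl⟩
      have hpos : 0 < ‖z₀ - f t‖ := lt_of_lt_of_le hε hd
      have hne := norm_pos_iff.1 hpos
      have : ‖(z - f t) / (z₀ - f t) - 1‖ < 1 := by
        have : (z - f t) / (z₀ - f t) - 1 = (z - z₀) / (z₀ - f t) := by field_simp; ring
        rw [this, norm_div, div_lt_one hpos]
        rw [dist_eq_norm] at hz
        linarith
      have := Complex.mem_slitPlane_of_norm_lt_one this
      simpa using this
    have key : ∀ z ∈ Metric.ball z₀ ε, l z 0 - l z 1 = (l z₀ 0 - l z₀ 1) +
        (Complex.log ((z - f 0) / (z₀ - f 0)) - Complex.log ((z - f 1) / (z₀ - f 1))) := by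
      intro z hz
      have hzc : z ∈ (f '' Icc (0:ℝ) 1)ᶜ := hball hz
      have := exp_eq_const (isPreconnected_Icc : IsPreconnected (Icc (0:ℝ) 1)) (hl z hzc).1
        ((hl z₀ hz₀).1.add (ContinuousOn.clog (f := fun t => (z - f t) / (z₀ - f t))
          (ContinuousOn.div (continuousOn_const.sub hf) (continuousOn_const.sub hf) (nz z₀ hz₀))
          (hslit z hz))) (fun t ht => by
            simp only [Pi.add_apply]
            rw [(hl z hzc).2 t ht, Complex.exp_add, (hl z₀ hz₀).2 t ht,
              Complex.exp_log (Complex.slitPlane_ne_zero (hslit z hz t ht))]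
            have := nz z₀ hz₀ t ht
            field_simp) h0 h1
      simp only [Pi.add_apply] at this
      linear_combination this
    have cont : ContinuousAt (fun z => (l z₀ 0 - l z₀ 1) +
        (Complex.log ((z - f 0) / (z₀ - f 0)) - Complex.log ((z - f 1) / (z₀ - f 1)))) z₀ := by
      refine continuousAt_const.add (ContinuousAt.sub ?_ ?_)
      · exact ContinuousAt.clog (by fun_prop) (hslit z₀ (by simpa using hε) 0 h0)
      · exact ContinuousAt.clog (by fun_prop) (hslit z₀ (by simpa using hε) 1 h1)
    exact cont.congr (Filter.eventuallyEq_of_mem (Metric.ball_mem_nhds z₀ hε) (fun z hz => (key z hz).symm))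
  · intro z hz
    rw [Complex.exp_sub, (hl z hz).2 0 h0, (hl z hz).2 1 h1]

/-- An arc through an open set, whose ends are already connected outside, splits it. -/
theorem arc_splits {f : ℝ → ℂ} (hf : ContinuousOn f (Icc 0 1)) (hne : f 0 ≠ f 1)
    {F : Set ℂ} (hF : IsOpen F) (hin : f '' Ioo 0 1 ⊆ F) (h0 : f 0 ∉ F) (h1 : f 1 ∉ F)
    {L : ℂ → ℂ} (hL : ContinuousOn L F) (hLe : ∀ z ∈ F, Complex.exp (L z) = (z - f 0) / (z - f 1)) :
    ¬ IsPreconnected (F \ f '' Ioo 0 1) := by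
  classical
  intro hpre
  obtain ⟨M, hM, hMe⟩ := exists_arcLog hf
  set A := f '' Icc (0:ℝ) 1 with hA
  have hAc : IsOpen Aᶜ := (isCompact_Icc.image_of_continuousOn hf).isClosed.isOpen_compl
  have hAsplit : ∀ z ∈ A, z = f 0 ∨ z = f 1 ∨ z ∈ f '' Ioo 0 1 := by
    rintro z ⟨t, ht, rfl⟩
    rcases eq_or_lt_of_le ht.1 with h | h
    · exact Or.inl (by rw [h])
    · rcases eq_or_lt_of_le ht.2 with h' | h'
      · exact Or.inr (Or.inl (by rw [h']))
      · exact Or.inr (Or.inr ⟨t, ⟨h, h'⟩, rfl⟩)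
  have hFA : ∀ z ∈ F, z ∉ f '' Ioo (0:ℝ) 1 → z ∈ Aᶜ := by
    intro z hz hz' hzA
    rcases hAsplit z hzA with h | h | h
    · exact h0 (h ▸ hz)
    · exact h1 (h ▸ hz)
    · exact hz' h
  -- the constant
  obtain ⟨c, hc⟩ : ∃ c : ℂ, Complex.exp c = 1 ∧ ∀ z ∈ F, z ∈ Aᶜ → L z = M z + c := by
    rcases (F \ f '' Ioo (0:ℝ) 1).eq_empty_or_nonempty with hemp | ⟨x, hx⟩
    · refine ⟨0, by simp, fun z hz hz' => ?_⟩
      have : z ∈ F \ f '' Ioo (0:ℝ) 1 := ⟨hz, fun h => hz' (image_mono Ioo_subset_Icc_self h)⟩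
      rw [hemp] at this
      exact this.elim
    · refine ⟨L x - M x, ?_, ?_⟩
      · rw [Complex.exp_sub, hLe x hx.1, hMe x (hFA x hx.1 hx.2), div_self]
        have := hLe x hx.1
        rw [← this]
        exact Complex.exp_ne_zero _
      · intro z hz hz'
        have := exp_eq_const hpre (hL.mono sdiff_subset) (hM.mono fun y hy => hFA y hy.1 hy.2)
          (fun y hy => by rw [hLe y hy.1, hMe y (hFA y hy.1 hy.2)])
          (x := z) (y := x) ⟨hz, fun h => hz' (image_mono Ioo_subset_Icc_self h)⟩ hx
        linear_combination this
  let N : ℂ → ℂ := fun z => if z ∈ Aᶜ then M z + c else L z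
  have hN1 : ∀ z ∈ Aᶜ, N z = M z + c := fun z hz => by simp only [N, hz, if_true]
  have hN2 : ∀ z ∈ F, N z = L z := fun z hz => by
    by_cases hz' : z ∈ Aᶜ
    · rw [hN1 z hz', hc.2 z hz hz']
    · simp only [N, hz', if_false]
  have hNc : ContinuousOn N (Aᶜ ∪ F) :=
    ((hM.add continuousOn_const).congr hN1).union_of_isOpen (hL.congr hN2) hAc hF
  have hNe : ∀ z ∈ Aᶜ ∪ F, Complex.exp (N z) = (z - f 0) / (z - f 1) := by
    rintro z (hz | hz)
    · rw [hN1 z hz, Complex.exp_add, hc.1, mul_one, hMe z hz]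
    · rw [hN2 z hz, hLe z hz]
  -- a circle
  set r := ‖f 0 - f 1‖ / 2 with hr
  have hpos : 0 < ‖f 0 - f 1‖ := norm_pos_iff.2 (sub_ne_zero.2 hne)
  have hrpos : 0 < r := by positivity
  have hsub : Metric.sphere (f 0) r ⊆ Aᶜ ∪ F := by
    intro z hz
    by_cases hzA : z ∈ A
    · right
      rcases hAsplit z hzA with h | h | h
      · rw [h, mem_sphere_iff_norm, sub_self, norm_zero] at hz
        exact absurd hz hrpos.ne
      · rw [h, mem_sphere_iff_norm, norm_sub_rev] at hz
        linarith
      · exact hin h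
    · exact Or.inl hzA
  have hslit : ∀ z ∈ Metric.sphere (f 0) r, (z - f 1) / (f 0 - f 1) ∈ Complex.slitPlane := by
    intro z hz
    have h3 := sub_ne_zero.2 hne
    have : ‖(z - f 1) / (f 0 - f 1) - 1‖ < 1 := by
      have : (z - f 1) / (f 0 - f 1) - 1 = (z - f 0) / (f 0 - f 1) := by field_simp; ring
      rw [this, norm_div, div_lt_one hpos]
      rw [mem_sphere_iff_norm] at hz
      rw [hz]; linarith
    have := Complex.mem_slitPlane_of_norm_lt_one this
    simpa using this
  refine not_hasLog_circle (f 0) hrpos (k := 1) one_ne_zero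
    ⟨fun z => N z + (Complex.log ((z - f 1) / (f 0 - f 1)) + Complex.log (f 0 - f 1)), ?_, ?_⟩
  · refine (hNc.mono hsub).add ((ContinuousOn.clog ?_ hslit).add continuousOn_const)
    fun_prop
  · intro z hz
    have h3 := sub_ne_zero.2 hne
    have h4 := Complex.slitPlane_ne_zero (hslit z hz)
    have h5 : z - f 1 ≠ 0 := fun h => h4 (by rw [h, zero_div])
    rw [Complex.exp_add, hNe z (hsub hz), Complex.exp_add, Complex.exp_log h4, Complex.exp_log h3]
    simp only [zpow_one]
    field_simp

/-- An arc contains no circle, hence has empty interior. -/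
theorem arc_no_ball {f : ℝ → ℂ} (hf : ContinuousOn f (Icc 0 1)) (hinj : InjOn f (Icc 0 1))
    {z : ℂ} {ε : ℝ} (hε : 0 < ε) (hb : Metric.ball z ε ⊆ f '' Icc 0 1) : False := by
  set g := Function.invFunOn f (Icc (0:ℝ) 1) with hg
  have hgl : ∀ t ∈ Icc (0:ℝ) 1, g (f t) = t := fun t ht => hinj.leftInvOn_invFunOn ht
  have hgr : ∀ w ∈ f '' Icc (0:ℝ) 1, g w ∈ Icc (0:ℝ) 1 ∧ f (g w) = w := by
    rintro w ⟨t, ht, rfl⟩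
    rw [hgl t ht]; exact ⟨ht, rfl⟩
  have hgc : ContinuousOn g (f '' Icc 0 1) := by
    rw [continuousOn_iff_isClosed]
    intro C hC
    refine ⟨f '' (Icc 0 1 ∩ C), ?_, ?_⟩
    · exact ((isCompact_Icc.inter_right hC).image_of_continuousOn (hf.mono inter_subset_left)).isClosed
    · ext w
      constructor
      · rintro ⟨h1, h2⟩
        exact ⟨⟨g w, ⟨(hgr w h2).1, h1⟩, (hgr w h2).2⟩, h2⟩
      · rintro ⟨⟨t, ht, rfl⟩, h2⟩
        refine ⟨?_, h2⟩
        rw [mem_preimage, hgl t ht.1]; exact ht.2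
  set r := ε / 2
  have hr : 0 < r := by positivity
  have hc : ∀ θ, circleMap z r θ ∈ f '' Icc (0:ℝ) 1 := by
    intro θ
    refine hb (Metric.sphere_subset_closedBall.trans (Metric.closedBall_subset_ball (by simp only [r]; linarith))
      (circleMap_mem_sphere z hr.le θ))
  have hk : Continuous (fun θ => g (circleMap z r θ)) :=
    hgc.comp_continuous (continuous_circleMap z r) hc
  let k : ℝ → ℝ := fun θ => g (circleMap z r θ) - g (circleMap z r (θ + Real.pi))
  have hkc : Continuous k := hk.sub (hk.comp (by fun_prop : Continuous fun θ : ℝ => θ + Real.pi))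
  have hkpi : k Real.pi = - k 0 := by
    have : circleMap z r (Real.pi + Real.pi) = circleMap z r 0 := by
      rw [← two_mul]; simp [circleMap]
    simp only [k, this, zero_add]
    ring
  obtain ⟨θ, hθ⟩ : ∃ θ, k θ = 0 := by
    rcases le_total (k 0) 0 with h | h
    · exact mem_range_of_exists_le_of_exists_ge hkc ⟨0, h⟩ ⟨Real.pi, by rw [hkpi]; linarith⟩
    · exact mem_range_of_exists_le_of_exists_ge hkc ⟨Real.pi, by rw [hkpi]; linarith⟩ ⟨0, h⟩
  have h1 : g (circleMap z r θ) = g (circleMap z r (θ + Real.pi)) := sub_eq_zero.1 hθ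
  have h2 : circleMap z r θ = circleMap z r (θ + Real.pi) := by
    rw [← (hgr _ (hc θ)).2, h1, (hgr _ (hc _)).2]
  simp only [circleMap, Complex.ofReal_add, add_mul, Complex.exp_add, Complex.exp_pi_mul_I] at h2
  have h3 : (r : ℂ) * Complex.exp (θ * Complex.I) = 0 := by linear_combination h2 / 2
  rcases mul_eq_zero.1 h3 with h | h
  · exact hr.ne' (by exact_mod_cast h)
  · exact Complex.exp_ne_zero _ h

end

section


/-- Continuity of the inverse of an arc. -/
theorem arc_inv_continuousOn {f : ℝ → ℂ} (hf : ContinuousOn f (Icc 0 1)) (hinj : InjOn f (Icc 0 1)) :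
    ∃ g : ℂ → ℝ, ContinuousOn g (f '' Icc 0 1) ∧ ∀ t ∈ Icc (0:ℝ) 1, g (f t) = t := by
  set g := Function.invFunOn f (Icc (0:ℝ) 1) with hg
  have hgl : ∀ t ∈ Icc (0:ℝ) 1, g (f t) = t := fun t ht => hinj.leftInvOn_invFunOn ht
  refine ⟨g, ?_, hgl⟩
  rw [continuousOn_iff_isClosed]
  intro C hC
  refine ⟨f '' (Icc 0 1 ∩ C), ?_, ?_⟩
  · exact ((isCompact_Icc.inter_right hC).image_of_continuousOn (hf.mono inter_subset_left)).isClosed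
  · ext w
    constructor
    · rintro ⟨h1, ⟨t, ht, rfl⟩⟩
      rw [mem_preimage, hgl t ht] at h1
      exact ⟨⟨t, ⟨ht, h1⟩, rfl⟩, ⟨t, ht, rfl⟩⟩
    · rintro ⟨⟨t, ⟨ht, h1⟩, rfl⟩, h2⟩
      refine ⟨?_, h2⟩
      rw [mem_preimage, hgl t ht]; exact h1

theorem arc_hasLog {f : ℝ → ℂ} (hf : ContinuousOn f (Icc 0 1)) (hinj : InjOn f (Icc 0 1))
    {g : ℂ → ℂ} (hg : ContinuousOn g (f '' Icc 0 1)) (h0 : ∀ z ∈ f '' Icc 0 1, g z ≠ 0) :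
    HasLog (f '' Icc 0 1) g := by
  obtain ⟨k, hk, hkf⟩ := arc_inv_continuousOn hf hinj
  obtain ⟨h, hh, he⟩ := exists_log_Icc (f := fun t => g (f t))
    (hg.comp hf (fun t ht => ⟨t, ht, rfl⟩)) (fun t ht => h0 _ ⟨t, ht, rfl⟩)
  refine ⟨fun z => h (k z), hh.comp hk ?_, ?_⟩
  · rintro z ⟨t, ht, rfl⟩
    rw [hkf t ht]; exact ht
  · rintro z ⟨t, ht, rfl⟩
    beta_reduce
    rw [hkf t ht]; exact he t ht

/-- A plane drawing of a graph, in the complex plane. -/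
structure PlaneDr {V : Type} (P : SimpleGraph V) where
  vmap : V → ℂ
  emap : Sym2 V → Set ℂ
  inj : Function.Injective vmap
  arc : ∀ u v, P.Adj u v → ∃ f : ℝ → ℂ, ContinuousOn f (Icc 0 1) ∧ InjOn f (Icc 0 1) ∧
    f 0 = vmap u ∧ f 1 = vmap v ∧ emap s(u, v) = f '' Ioo 0 1
  avoid : ∀ e ∈ P.edgeSet, ∀ v, vmap v ∉ emap e
  disj : ∀ e ∈ P.edgeSet, ∀ e' ∈ P.edgeSet, e ≠ e' → ∀ z ∈ emap e, z ∉ emap e'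

namespace PlaneDr

variable {V : Type} {P : SimpleGraph V} (D : PlaneDr P)

/-- closed edge -/
def cl (e : Sym2 V) : Set ℂ := D.emap e ∪ D.vmap '' {v | v ∈ e}

/-- union of closed edges -/
def cim (E : Set (Sym2 V)) : Set ℂ := ⋃ e ∈ E, D.cl e

/-- union of closed edges and all vertices -/
def im (E : Set (Sym2 V)) : Set ℂ := range D.vmap ∪ D.cim E

theorem cl_arc {u v : V} (h : P.Adj u v) : ∃ f : ℝ → ℂ, ContinuousOn f (Icc 0 1) ∧
    InjOn f (Icc 0 1) ∧ f 0 = D.vmap u ∧ f 1 = D.vmap v ∧ D.emap s(u, v) = f '' Ioo 0 1 ∧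
    D.cl s(u, v) = f '' Icc 0 1 := by
  obtain ⟨f, h1, h2, h3, h4, h5⟩ := D.arc u v h
  refine ⟨f, h1, h2, h3, h4, h5, ?_⟩
  have h6 : {w : V | w ∈ s(u, v)} = {u, v} := by ext w; simp
  rw [cl, h6, image_pair, h5, ← h3, ← h4]
  have : Icc (0:ℝ) 1 = Ioo 0 1 ∪ {0, 1} := by
    ext t; simp only [mem_Icc, mem_union, mem_Ioo, mem_insert_iff, mem_singleton_iff]
    constructor
    · rintro ⟨a, b⟩
      rcases eq_or_lt_of_le a with h | h
      · right; left; exact h.symm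
      · rcases eq_or_lt_of_le b with h' | h'
        · right; right; exact h'
        · left; exact ⟨h, h'⟩
    · rintro (⟨a, b⟩ | rfl | rfl)
      · exact ⟨a.le, b.le⟩
      · norm_num
      · norm_num
  rw [this, image_union, image_pair]

theorem cl_compact {e : Sym2 V} (he : e ∈ P.edgeSet) : IsCompact (D.cl e) := by
  induction e with
  | _ u v =>
    obtain ⟨f, h1, h2, h3, h4, h5, h6⟩ := D.cl_arc he
    rw [h6]; exact isCompact_Icc.image_of_continuousOn h1

theorem cl_preconnected {e : Sym2 V} (he : e ∈ P.edgeSet) : IsPreconnected (D.cl e) := by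
  induction e with
  | _ u v =>
    obtain ⟨f, h1, h2, h3, h4, h5, h6⟩ := D.cl_arc he
    rw [h6]; exact isPreconnected_Icc.image f h1

theorem emap_preconnected {e : Sym2 V} (he : e ∈ P.edgeSet) : IsPreconnected (D.emap e) := by
  induction e with
  | _ u v =>
    obtain ⟨f, h1, h2, h3, h4, h5, h6⟩ := D.cl_arc he
    rw [h5]; exact isPreconnected_Ioo.image f (h1.mono Ioo_subset_Icc_self)

theorem emap_nonempty {e : Sym2 V} (he : e ∈ P.edgeSet) : (D.emap e).Nonempty := by
  induction e with
  | _ u v =>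
    obtain ⟨f, h1, h2, h3, h4, h5, h6⟩ := D.cl_arc he
    rw [h5]; exact (nonempty_Ioo.2 one_pos).image f

theorem emap_subset_cl (e : Sym2 V) : D.emap e ⊆ D.cl e := subset_union_left

theorem vmap_mem_cl {e : Sym2 V} {v : V} (h : v ∈ e) : D.vmap v ∈ D.cl e := Or.inr ⟨v, h, rfl⟩

theorem cl_subset_closure {e : Sym2 V} (he : e ∈ P.edgeSet) : D.cl e ⊆ closure (D.emap e) := by
  induction e with
  | _ u v =>
    obtain ⟨f, h1, h2, h3, h4, h5, h6⟩ := D.cl_arc he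
    rw [h6, h5]
    have := ContinuousOn.image_closure (f := f) (s := Ioo (0:ℝ) 1) (by
      rw [closure_Ioo (by norm_num)]; exact h1)
    rwa [closure_Ioo (by norm_num)] at this

theorem cl_hasLog {e : Sym2 V} (he : e ∈ P.edgeSet) {g : ℂ → ℂ} (hg : ContinuousOn g (D.cl e))
    (h0 : ∀ z ∈ D.cl e, g z ≠ 0) : HasLog (D.cl e) g := by
  induction e with
  | _ u v =>
    obtain ⟨f, h1, h2, h3, h4, h5, h6⟩ := D.cl_arc he
    rw [h6] at hg h0 ⊢
    exact arc_hasLog h1 h2 hg h0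

theorem cim_mono {E E' : Set (Sym2 V)} (h : E ⊆ E') : D.cim E ⊆ D.cim E' :=
  biUnion_subset_biUnion_left h

theorem im_mono {E E' : Set (Sym2 V)} (h : E ⊆ E') : D.im E ⊆ D.im E' :=
  union_subset_union_right _ (D.cim_mono h)

theorem cl_subset_cim {E : Set (Sym2 V)} {e : Sym2 V} (h : e ∈ E) : D.cl e ⊆ D.cim E :=
  subset_biUnion_of_mem (u := fun e => D.cl e) h

theorem cim_subset_im (E : Set (Sym2 V)) : D.cim E ⊆ D.im E := subset_union_right

theorem vmap_mem_im (E : Set (Sym2 V)) (v : V) : D.vmap v ∈ D.im E := Or.inl ⟨v, rfl⟩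

theorem mem_im_iff {E : Set (Sym2 V)} {z : ℂ} :
    z ∈ D.im E ↔ (∃ v, D.vmap v = z) ∨ ∃ e ∈ E, z ∈ D.emap e := by
  constructor
  · rintro (h | h)
    · exact Or.inl h
    · obtain ⟨e, he, h | ⟨v, _, h⟩⟩ := mem_iUnion₂.1 h
      · exact Or.inr ⟨e, he, h⟩
      · exact Or.inl ⟨v, h⟩
  · rintro (⟨v, rfl⟩ | ⟨e, he, h⟩)
    · exact D.vmap_mem_im E v
    · exact D.cim_subset_im E (D.cl_subset_cim he (D.emap_subset_cl e h))

theorem cim_insert (e : Sym2 V) (E : Set (Sym2 V)) : D.cim (insert e E) = D.cl e ∪ D.cim E := by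
  rw [cim, biUnion_insert]; rfl

theorem im_insert (e : Sym2 V) (E : Set (Sym2 V)) : D.im (insert e E) = D.im E ∪ D.cl e := by
  rw [im, cim_insert, im, union_assoc, union_comm (D.cl e)]

theorem cim_union (E E' : Set (Sym2 V)) : D.cim (E ∪ E') = D.cim E ∪ D.cim E' := by
  simp only [cim]; rw [biUnion_union]

/-- an edge not in `E` has interior avoiding `im E`. -/
theorem emap_disj_im {E : Set (Sym2 V)} (hE : E ⊆ P.edgeSet) {e : Sym2 V} (he : e ∈ P.edgeSet)
    (heE : e ∉ E) : D.emap e ⊆ (D.im E)ᶜ := by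
  intro z hz h
  rcases D.mem_im_iff.1 h with ⟨v, rfl⟩ | ⟨e', he', h⟩
  · exact D.avoid e he v hz
  · exact D.disj e he e' (hE he') (fun h => heE (h ▸ he')) z hz h

/-- `φ` is a potential for `e`. -/
def Good (g : ℂ → ℂ) (φ : V → ℂ) (e : Sym2 V) : Prop :=
  ∃ β : ℂ → ℂ, ContinuousOn β (D.cl e) ∧ (∀ z ∈ D.cl e, Complex.exp (β z) = g z) ∧
    ∀ v ∈ e, β (D.vmap v) = φ v

theorem good_walk {g : ℂ → ℂ} {φ : V → ℂ} {δ : ℂ → ℂ} {E : Set (Sym2 V)} {u v : V} (p : P.Walk u v)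
    (hp : ∀ e ∈ p.edges, e ∈ E)
    (hgood : ∀ e ∈ E, D.Good g φ e) (dc : ContinuousOn δ (D.cim {e | e ∈ p.edges}))
    (de : ∀ z ∈ D.cim {e | e ∈ p.edges}, Complex.exp (δ z) = g z) :
    φ u - δ (D.vmap u) = φ v - δ (D.vmap v) := by
  induction p with
  | nil => rfl
  | @cons a b c h q ih =>
    have hs : {e | e ∈ (SimpleGraph.Walk.cons h q).edges} = insert s(a, b) {e | e ∈ q.edges} := by
      ext e; simp
    rw [hs] at dc de
    rw [cim_insert] at dc de
    rw [← ih (fun e he => hp e (by simp [he])) (dc.mono subset_union_right)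
      (fun z hz => de z (Or.inr hz))]
    obtain ⟨β, bc, be, bv⟩ := hgood s(a, b) (hp _ (by simp))
    rw [← bv a (by simp), ← bv b (by simp)]
    exact exp_eq_const (D.cl_preconnected h) bc (dc.mono subset_union_left)
      (fun z hz => by rw [be z hz, de z (Or.inl hz)]) (D.vmap_mem_cl (by simp))
      (D.vmap_mem_cl (by simp))

variable [Finite V]

theorem cim_compact {E : Set (Sym2 V)} (hE : E ⊆ P.edgeSet) : IsCompact (D.cim E) :=
  (Set.toFinite E).isCompact_biUnion (fun _ he => D.cl_compact (hE he))

theorem im_compact {E : Set (Sym2 V)} (hE : E ⊆ P.edgeSet) : IsCompact (D.im E) :=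
  (Set.finite_range _).isCompact.union (D.cim_compact hE)

theorem hasLog_of_good {E : Set (Sym2 V)} (hE : E ⊆ P.edgeSet) {g : ℂ → ℂ} {φ : V → ℂ}
    (hφ : ∀ v, Complex.exp (φ v) = g (D.vmap v)) (hgood : ∀ e ∈ E, D.Good g φ e) :
    HasLog (D.im E) g := by
  classical
  have key : ∀ E : Set (Sym2 V), E.Finite → E ⊆ P.edgeSet → (∀ e ∈ E, D.Good g φ e) →
      ∃ h : ℂ → ℂ, ContinuousOn h (D.im E) ∧ (∀ z ∈ D.im E, Complex.exp (h z) = g z) ∧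
        ∀ v, h (D.vmap v) = φ v := by
    intro E hfin
    induction E, hfin using Set.Finite.induction_on with
    | empty =>
      intro _ _
      refine ⟨fun z => if h : ∃ v, D.vmap v = z then φ h.choose else 0, ?_, ?_, ?_⟩
      · have : (D.im ∅).Finite := by simp [im, cim, Set.finite_range]
        exact this.continuousOn _
      · intro z hz
        have h : ∃ v, D.vmap v = z := by
          rcases D.mem_im_iff.1 hz with h | ⟨e, he, _⟩
          · exact h
          · exact absurd he (by simp)
        beta_reduce
        rw [dif_pos h, hφ, h.choose_spec]
      · intro v
        have h : ∃ w, D.vmap w = D.vmap v := ⟨v, rfl⟩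
        beta_reduce
        rw [dif_pos h]
        congr 1
        exact D.inj h.choose_spec
    | @insert e E' heE' hfin' ih =>
      intro hE hg
      obtain ⟨h, hc, he, hv⟩ := ih (fun x hx => hE (Or.inr hx)) (fun x hx => hg x (Or.inr hx))
      obtain ⟨β, bc, be, bv⟩ := hg e (Or.inl rfl)
      have heP := hE (Or.inl rfl : e ∈ insert e E')
      have hE'P : E' ⊆ P.edgeSet := fun x hx => hE (Or.inr hx)
      have hag : ∀ z ∈ D.im E', z ∈ D.cl e → h z = β z := by
        rintro z hz (hz' | ⟨v, hve, rfl⟩)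
        · exact absurd hz (D.emap_disj_im hE'P heP heE' hz')
        · rw [hv, bv v hve]
      let k : ℂ → ℂ := fun z => if z ∈ D.im E' then h z else β z
      have h1 : ∀ z ∈ D.im E', k z = h z := fun z hz => by simp [k, hz]
      have h2 : ∀ z ∈ D.cl e, k z = β z := fun z hz => by
        by_cases hz' : z ∈ D.im E'
        · rw [h1 z hz', hag z hz' hz]
        · simp [k, hz']
      rw [im_insert]
      refine ⟨k, ?_, ?_, ?_⟩
      · exact (hc.congr h1).union_of_isClosed (bc.congr h2) (D.im_compact hE'P).isClosed
          (D.cl_compact heP).isClosed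
      · rintro z (hz | hz)
        · rw [h1 z hz, he z hz]
        · rw [h2 z hz, be z hz]
      · intro v
        rw [h1 _ (D.vmap_mem_im E' v), hv]
  obtain ⟨h, hc, he, _⟩ := key E (Set.toFinite E) hE hgood
  exact ⟨h, hc, he⟩

/-- If there is no logarithm on `im E` then some cycle has no logarithm. -/
theorem exists_cycle {E : Set (Sym2 V)} (hE : E ⊆ P.edgeSet) {g : ℂ → ℂ}
    (gc : ContinuousOn g (D.im E)) (g0 : ∀ z ∈ D.im E, g z ≠ 0) (hno : ¬ HasLog (D.im E) g) :
    ∃ (v : V) (c : P.Walk v v), c.IsCycle ∧ (∀ e ∈ c.edges, e ∈ E) ∧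
      ¬ HasLog (D.cim {e | e ∈ c.edges}) g := by
  classical
  by_contra hcon
  push Not at hcon
  apply hno
  have key : ∀ E' : Set (Sym2 V), E'.Finite → E' ⊆ E →
      ∃ φ : V → ℂ, (∀ v, Complex.exp (φ v) = g (D.vmap v)) ∧ ∀ e ∈ E', D.Good g φ e := by
    intro E' hfin
    induction E', hfin using Set.Finite.induction_on with
    | empty =>
      intro _
      exact ⟨fun v => Complex.log (g (D.vmap v)), fun v => Complex.exp_log (g0 _ (D.vmap_mem_im E v)),
        by simp⟩
    | @insert e E' heE' hfin' ih =>
      intro hE'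
      obtain ⟨φ, h1, h2⟩ := ih (fun x hx => hE' (Or.inr hx))
      have heE : e ∈ E := hE' (Or.inl rfl)
      have hE'E : E' ⊆ E := fun x hx => hE' (Or.inr hx)
      have heP := hE heE
      have hsub : D.cl e ⊆ D.im E := (D.cl_subset_cim heE).trans (D.cim_subset_im E)
      obtain ⟨β, bc, be⟩ := D.cl_hasLog heP (gc.mono hsub) (fun z hz => g0 z (hsub hz))
      induction e with
      | _ a b =>
      have hab : P.Adj a b := heP
      by_cases hr : ∃ p : P.Walk b a, ∀ e ∈ p.edges, e ∈ E'
      · obtain ⟨p, hp⟩ := hr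
        refine ⟨φ, h1, ?_⟩
        have hp' : ∀ e ∈ p.bypass.edges, e ∈ E' := fun e he => hp e (p.edges_bypass_subset_edges he)
        have hcyc : (SimpleGraph.Walk.cons hab p.bypass).IsCycle := by
          rw [SimpleGraph.Walk.cons_isCycle_iff]
          exact ⟨p.bypass_isPath, fun h => heE' (hp' _ h)⟩
        obtain ⟨δ, dc, de⟩ := hcon a _ hcyc (by
          intro e he
          rw [SimpleGraph.Walk.edges_cons, List.mem_cons] at he
          rcases he with rfl | he
          · exact heE
          · exact hE'E (hp' e he))
        have hs : {e | e ∈ (SimpleGraph.Walk.cons hab p.bypass).edges} =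
            insert s(a, b) {e | e ∈ p.bypass.edges} := by
          ext e; simp
        rw [hs, cim_insert] at dc de
        have e1 := D.good_walk p.bypass hp' h2 (dc.mono subset_union_right)
          (fun z hz => de z (Or.inr hz))
        have e2 := exp_eq_const (D.cl_preconnected heP) bc (dc.mono subset_union_left)
          (fun z hz => by rw [be z hz, de z (Or.inl hz)]) (D.vmap_mem_cl (by simp : a ∈ s(a,b)))
          (D.vmap_mem_cl (by simp : b ∈ s(a,b)))
        rintro x (rfl | hx)
        · have hexp : Complex.exp (φ a - β (D.vmap a)) = 1 := by
            rw [Complex.exp_sub, h1, be _ (D.vmap_mem_cl (by simp))]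
            exact div_self (g0 _ (D.vmap_mem_im E a))
          refine ⟨fun z => β z + (φ a - β (D.vmap a)), bc.add continuousOn_const, ?_, ?_⟩
          · intro z hz
            rw [Complex.exp_add, hexp, mul_one, be z hz]
          · intro v hv
            rcases Sym2.mem_iff.1 hv with rfl | rfl
            · ring
            · linear_combination -e2 - e1
        · exact h2 x hx
      · -- not reachable: shift
        set S : Set V := {v | ∃ p : P.Walk b v, ∀ e ∈ p.edges, e ∈ E'} with hS
        have haS : a ∉ S := hr
        have hbS : b ∈ S := ⟨SimpleGraph.Walk.nil, by simp⟩
        set c : ℂ := (φ a - β (D.vmap a)) - (φ b - β (D.vmap b)) with hc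
        have hexpa : Complex.exp (φ a - β (D.vmap a)) = 1 := by
          rw [Complex.exp_sub, h1, be _ (D.vmap_mem_cl (by simp))]
          exact div_self (g0 _ (D.vmap_mem_im E a))
        have hexpb : Complex.exp (φ b - β (D.vmap b)) = 1 := by
          rw [Complex.exp_sub, h1, be _ (D.vmap_mem_cl (by simp))]
          exact div_self (g0 _ (D.vmap_mem_im E b))
        have hexpc : Complex.exp c = 1 := by rw [hc, Complex.exp_sub, hexpa, hexpb, div_one]
        refine ⟨fun v => if v ∈ S then φ v + c else φ v, ?_, ?_⟩
        · intro v
          by_cases hv : v ∈ S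
          · simp only [hv, if_true]; rw [Complex.exp_add, hexpc, mul_one, h1]
          · simp only [hv, if_false]; exact h1 v
        · rintro x (rfl | hx)
          · refine ⟨fun z => β z + (φ a - β (D.vmap a)), bc.add continuousOn_const, ?_, ?_⟩
            · intro z hz
              rw [Complex.exp_add, hexpa, mul_one, be z hz]
            · intro v hv
              rcases Sym2.mem_iff.1 hv with rfl | rfl
              · simp only [haS, if_false]; ring
              · simp only [hbS, if_true, hc]; ring
          · obtain ⟨β', bc', be', bv'⟩ := h2 x hx
            induction x with
            | _ x y =>
            have hxy : P.Adj x y := hE (hE'E hx)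
            have hiff : x ∈ S ↔ y ∈ S := by
              constructor
              · rintro ⟨p, hp⟩
                refine ⟨p.concat hxy, ?_⟩
                intro e he
                rw [SimpleGraph.Walk.edges_concat, List.concat_eq_append, List.mem_append] at he
                rcases he with he | he
                · exact hp e he
                · rw [List.mem_singleton] at he; rw [he]; exact hx
              · rintro ⟨p, hp⟩
                refine ⟨p.concat hxy.symm, ?_⟩
                intro e he
                rw [SimpleGraph.Walk.edges_concat, List.concat_eq_append, List.mem_append] at he
                rcases he with he | he
                · exact hp e he
                · rw [List.mem_singleton] at he; rw [he, Sym2.eq_swap]; exact hx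
            by_cases hxS : x ∈ S
            · refine ⟨fun z => β' z + c, bc'.add continuousOn_const, ?_, ?_⟩
              · intro z hz
                rw [Complex.exp_add, hexpc, mul_one, be' z hz]
              · intro v hv
                rcases Sym2.mem_iff.1 hv with rfl | rfl
                · simp only [hxS, if_true]; rw [bv' _ hv]
                · simp only [hiff.1 hxS, if_true]; rw [bv' _ hv]
            · refine ⟨β', bc', be', ?_⟩
              intro v hv
              have hyS : y ∉ S := fun h => hxS (hiff.2 h)
              rcases Sym2.mem_iff.1 hv with rfl | rfl
              · simp only [hxS, if_false]; rw [bv' _ hv]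
              · simp only [hyS, if_false]; rw [bv' _ hv]
  obtain ⟨φ, h1, h2⟩ := key E (Set.toFinite E) subset_rfl
  exact D.hasLog_of_good hE h1 h2

end PlaneDr

end

section


/-- Components of the complement. -/
def faces (K : Set ℂ) : Set (Set ℂ) := {F | ∃ x ∈ Kᶜ, F = connectedComponentIn Kᶜ x}

theorem face_eq {K F : Set ℂ} (hF : F ∈ faces K) {x : ℂ} (hx : x ∈ F) :
    F = connectedComponentIn Kᶜ x := by
  obtain ⟨y, hy, rfl⟩ := hF
  exact connectedComponentIn_eq hx

theorem face_subset {K F : Set ℂ} (hF : F ∈ faces K) : F ⊆ Kᶜ := by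
  obtain ⟨y, hy, rfl⟩ := hF
  exact connectedComponentIn_subset _ _

theorem face_nonempty {K F : Set ℂ} (hF : F ∈ faces K) : F.Nonempty := by
  obtain ⟨y, hy, rfl⟩ := hF
  exact ⟨y, mem_connectedComponentIn hy⟩

theorem face_preconnected {K F : Set ℂ} (hF : F ∈ faces K) : IsPreconnected F := by
  obtain ⟨y, hy, rfl⟩ := hF
  exact isPreconnected_connectedComponentIn

theorem face_open {K F : Set ℂ} (hK : IsClosed K) (hF : F ∈ faces K) : IsOpen F := by
  obtain ⟨y, hy, rfl⟩ := hF
  exact hK.isOpen_compl.connectedComponentIn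

theorem mem_faces {K : Set ℂ} {x : ℂ} (hx : x ∈ Kᶜ) : connectedComponentIn Kᶜ x ∈ faces K :=
  ⟨x, hx, rfl⟩

theorem face_closure {K F : Set ℂ} (hK : IsClosed K) (hF : F ∈ faces K) : closure F ⊆ F ∪ K := by
  obtain ⟨y, hy, rfl⟩ := hF
  exact closure_comp_subset hK y

theorem face_eq_face {K F F' : Set ℂ} (hF : F ∈ faces K) (hF' : F' ∈ faces K) {x : ℂ}
    (hx : x ∈ F) (hx' : x ∈ F') : F = F' := (face_eq hF hx).trans (face_eq hF' hx').symm

/-- An intermediate set of obstacles containing the frontier yields the same component. -/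
theorem comp_eq_of_frontier {K K' F : Set ℂ} (hK : IsClosed K) (hKK : K' ⊆ K)
    (hF : F ∈ faces K) (hfr : ∀ z ∈ closure F, z ∈ K → z ∈ K') : F ∈ faces K' := by
  obtain ⟨q, hq⟩ := face_nonempty hF
  have hsub : F ⊆ K'ᶜ := (face_subset hF).trans (compl_subset_compl.2 hKK)
  refine ⟨q, hsub hq, subset_antisymm ((face_preconnected hF).subset_connectedComponentIn hq hsub) ?_⟩
  refine isPreconnected_connectedComponentIn.subset_of_closure_inter_subset (face_open hK hF)
    ⟨q, mem_connectedComponentIn (hsub hq), hq⟩ ?_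
  rintro z ⟨hz, hz'⟩
  rcases face_closure hK hF hz with h | h
  · exact h
  · exact absurd (hfr z hz h) (connectedComponentIn_subset _ _ hz')

namespace PlaneDr

variable {V : Type} {P : SimpleGraph V} (D : PlaneDr P)

/-- the set `F` touches the edge `e` -/
def touch (F : Set ℂ) (e : Sym2 V) : Prop := (closure F ∩ D.emap e).Nonempty

/-- touched edges -/
def tE (E : Set (Sym2 V)) (F : Set ℂ) : Set (Sym2 V) := {e | e ∈ E ∧ D.touch F e}

theorem tE_subset (E : Set (Sym2 V)) (F : Set ℂ) : D.tE E F ⊆ E := fun _ h => h.1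

theorem walk_log {E : Set (Sym2 V)} {u v : V} (p : P.Walk u v) (hp : ∀ e ∈ p.edges, e ∈ E) :
    ∃ L : ℂ → ℂ, ContinuousOn L (D.im E)ᶜ ∧
      ∀ z ∈ (D.im E)ᶜ, Complex.exp (L z) = (z - D.vmap u) / (z - D.vmap v) := by
  have nz : ∀ z ∈ (D.im E)ᶜ, ∀ v, z - D.vmap v ≠ 0 := by
    intro z hz v h
    rw [sub_eq_zero] at h
    exact hz (h ▸ D.vmap_mem_im E v)
  induction p with
  | nil => exact ⟨0, continuousOn_const, fun z hz => by
      rw [div_self (nz z hz _)]; simp⟩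
  | @cons a b c h q ih =>
    obtain ⟨L, hL, hLe⟩ := ih (fun e he => hp e (by simp [he]))
    obtain ⟨f, h1, h2, h3, h4, h5, h6⟩ := D.cl_arc h
    obtain ⟨M, hM, hMe⟩ := exists_arcLog h1
    have hs : (D.im E)ᶜ ⊆ (f '' Icc 0 1)ᶜ := by
      rw [← h6]
      exact compl_subset_compl.2 ((D.cl_subset_cim (hp _ (by simp))).trans (D.cim_subset_im E))
    refine ⟨fun z => M z + L z, (hM.mono hs).add hL, ?_⟩
    intro z hz
    rw [Complex.exp_add, hMe z (hs hz), hLe z hz, h3, h4]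
    have := nz z hz b
    have := nz z hz c
    field_simp

variable [Finite V]

theorem face_of_touched {E E' : Set (Sym2 V)} (hE : E ⊆ P.edgeSet) (hE' : E' ⊆ E) {F : Set ℂ}
    (hF : F ∈ faces (D.im E)) (ht : ∀ e ∈ E, D.touch F e → e ∈ E') : F ∈ faces (D.im E') := by
  refine comp_eq_of_frontier (D.im_compact hE).isClosed (D.im_mono hE') hF ?_
  intro z hz hzE
  rcases D.mem_im_iff.1 hzE with ⟨v, rfl⟩ | ⟨e, he, hze⟩
  · exact D.vmap_mem_im E' v
  · exact D.mem_im_iff.2 (Or.inr ⟨e, ht e he ⟨z, hz, hze⟩, hze⟩)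

theorem split {E : Set (Sym2 V)} (hE : E ⊆ P.edgeSet) {a b : V} (hab : P.Adj a b)
    (heE : s(a, b) ∉ E) (p : P.Walk a b) (hp : ∀ e ∈ p.edges, e ∈ E)
    (S : Finset (Set ℂ)) (hS : ∀ F ∈ S, F ∈ faces (D.im E)) :
    ∃ S' : Finset (Set ℂ), (∀ F ∈ S', F ∈ faces (D.im (insert s(a, b) E))) ∧
      S.card + 1 ≤ S'.card := by
  classical
  have hKc := (D.im_compact hE).isClosed
  have hE2 : insert s(a, b) E ⊆ P.edgeSet := by
    rintro x (rfl | hx)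
    · exact hab
    · exact hE hx
  obtain ⟨f, h1, h2, h3, h4, h5, h6⟩ := D.cl_arc hab
  obtain ⟨z₀, hz₀⟩ := D.emap_nonempty (e := s(a, b)) hab
  have hdis := D.emap_disj_im hE (e := s(a, b)) hab heE
  set F := connectedComponentIn (D.im E)ᶜ z₀ with hFdef
  have hF : F ∈ faces (D.im E) := mem_faces (hdis hz₀)
  have heF : D.emap s(a, b) ⊆ F :=
    (D.emap_preconnected (e := s(a, b)) hab).subset_connectedComponentIn hz₀ hdis
  have him : ∀ z, z ∈ (D.im (insert s(a, b) E))ᶜ ↔ z ∈ (D.im E)ᶜ ∧ z ∉ D.emap s(a, b) := by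
    intro z
    simp only [mem_compl_iff, D.mem_im_iff, mem_insert_iff]
    constructor
    · intro h
      refine ⟨fun h' => h ?_, fun h' => h (Or.inr ⟨_, Or.inl rfl, h'⟩)⟩
      rcases h' with h' | ⟨e, he, h'⟩
      · exact Or.inl h'
      · exact Or.inr ⟨e, Or.inr he, h'⟩
    · rintro ⟨h, h'⟩ (h'' | ⟨e, rfl | he, h''⟩)
      · exact h (Or.inl h'')
      · exact h' h''
      · exact h (Or.inr ⟨e, he, h''⟩)
  have hsub2 : (D.im (insert s(a, b) E))ᶜ ⊆ (D.im E)ᶜ := fun z hz => ((him z).1 hz).1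
  obtain ⟨L, hL, hLe⟩ := D.walk_log p hp
  have hnp := arc_splits h1 (F := F) (by rw [h3, h4]; exact fun h => hab.ne (D.inj h))
    (face_open hKc hF) (by rw [← h5]; exact heF)
    (by rw [h3]; exact fun h => face_subset hF h (D.vmap_mem_im E a))
    (by rw [h4]; exact fun h => face_subset hF h (D.vmap_mem_im E b))
    (hL.mono (face_subset hF)) (fun z hz => by rw [hLe z (face_subset hF hz), h3, h4])
  rw [← h5] at hnp
  -- two different faces inside F
  have hex : ∃ x y, x ∈ F \ D.emap s(a, b) ∧ y ∈ F \ D.emap s(a, b) ∧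
      connectedComponentIn (D.im (insert s(a, b) E))ᶜ x ≠
        connectedComponentIn (D.im (insert s(a, b) E))ᶜ y := by
    by_contra hcon
    push Not at hcon
    apply hnp
    rcases (F \ D.emap s(a, b)).eq_empty_or_nonempty with h | ⟨x, hx⟩
    · rw [h]; exact isPreconnected_empty
    · have hxm : x ∈ (D.im (insert s(a, b) E))ᶜ := (him x).2 ⟨face_subset hF hx.1, hx.2⟩
      have : F \ D.emap s(a, b) = connectedComponentIn (D.im (insert s(a, b) E))ᶜ x := by
        apply subset_antisymm
        · intro y hy
          rw [hcon x y hx hy]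
          exact mem_connectedComponentIn ((him y).2 ⟨face_subset hF hy.1, hy.2⟩)
        · intro y hy
          refine ⟨?_, ((him y).1 (connectedComponentIn_subset _ _ hy)).2⟩
          rw [face_eq hF hx.1]
          exact connectedComponentIn_mono x hsub2 hy
      rw [this]; exact isPreconnected_connectedComponentIn
  obtain ⟨x, y, hx, hy, hxy⟩ := hex
  have sub1 : ∀ x, x ∈ F \ D.emap s(a, b) →
      connectedComponentIn (D.im (insert s(a, b) E))ᶜ x ∈ faces (D.im (insert s(a, b) E)) ∧
      connectedComponentIn (D.im (insert s(a, b) E))ᶜ x ∉ S.erase F := by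
    intro x hx
    have hxm : x ∈ (D.im (insert s(a, b) E))ᶜ := (him x).2 ⟨face_subset hF hx.1, hx.2⟩
    refine ⟨mem_faces hxm, ?_⟩
    intro h
    rw [Finset.mem_erase] at h
    exact h.1 (face_eq_face (hS _ h.2) hF (mem_connectedComponentIn hxm) hx.1)
  refine ⟨insert (connectedComponentIn (D.im (insert s(a, b) E))ᶜ x)
    (insert (connectedComponentIn (D.im (insert s(a, b) E))ᶜ y) (S.erase F)), ?_, ?_⟩
  · intro F' hF'
    rw [Finset.mem_insert, Finset.mem_insert] at hF'
    rcases hF' with rfl | rfl | hF'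
    · exact (sub1 x hx).1
    · exact (sub1 y hy).1
    · rw [Finset.mem_erase] at hF'
      have hF'f := hS F' hF'.2
      obtain ⟨w, hw⟩ := face_nonempty hF'f
      have hsub : F' ⊆ (D.im (insert s(a, b) E))ᶜ := by
        intro z hz
        refine (him z).2 ⟨face_subset hF'f hz, fun h => hF'.1 ?_⟩
        exact face_eq_face hF'f hF hz (heF h)
      refine ⟨w, hsub hw, subset_antisymm ?_ ?_⟩
      · exact (face_preconnected hF'f).subset_connectedComponentIn hw hsub
      · rw [face_eq hF'f hw]
        exact connectedComponentIn_mono w hsub2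
  · rw [Finset.card_insert_of_notMem, Finset.card_insert_of_notMem (sub1 y hy).2]
    · have := Finset.pred_card_le_card_erase (s := S) (a := F)
      omega
    · rw [Finset.mem_insert]
      rintro (h | h)
      · exact hxy h
      · exact (sub1 x hx).2 h

theorem compl_im_nonempty {E : Set (Sym2 V)} (hE : E ⊆ P.edgeSet) : ((D.im E)ᶜ).Nonempty := by
  rw [nonempty_compl]
  intro h
  have := D.im_compact hE
  rw [h] at this
  exact noncompact_univ ℂ this

/-- Euler lower bound on the number of faces. -/
theorem euler_lower {E₀ : Set (Sym2 V)} (hE₀ : E₀ ⊆ P.edgeSet) (T : Finset (Sym2 V))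
    (hT : ∀ e ∈ T, e ∉ E₀ ∧ ∃ a b, ∃ _ : P.Adj a b, e = s(a, b) ∧
      ∃ p : P.Walk a b, ∀ e ∈ p.edges, e ∈ E₀) :
    ∃ S : Finset (Set ℂ), (∀ F ∈ S, F ∈ faces (D.im (E₀ ∪ T))) ∧ T.card + 1 ≤ S.card := by
  classical
  induction T using Finset.induction_on with
  | empty =>
    obtain ⟨x, hx⟩ := D.compl_im_nonempty hE₀
    refine ⟨{connectedComponentIn (D.im E₀)ᶜ x}, ?_, by simp⟩
    intro F hF
    rw [Finset.mem_singleton] at hF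
    rw [hF, Finset.coe_empty, union_empty]
    exact mem_faces hx
  | @insert e T he ih =>
    obtain ⟨S, hS, hc⟩ := ih (fun x hx => hT x (Finset.mem_insert_of_mem hx))
    obtain ⟨h0, a, b, hab, rfl, p, hp⟩ := hT e (Finset.mem_insert_self _ _)
    have hsub : E₀ ∪ T ⊆ P.edgeSet := by
      rintro x (hx | hx)
      · exact hE₀ hx
      · obtain ⟨_, c, d, hcd, rfl, _⟩ := hT x (Finset.mem_insert_of_mem hx)
        exact hcd
    obtain ⟨S', hS', hc'⟩ := D.split hsub hab (by
      rintro (h | h)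
      · exact h0 h
      · exact he h) p (fun e he => Or.inl (hp e he)) S hS
    refine ⟨S', ?_, ?_⟩
    · rw [Finset.coe_insert, union_insert]
      exact hS'
    · rw [Finset.card_insert_of_notMem he]; omega

/-- At most two faces touch a connected piece attached at two points. -/
theorem two_faces {K B B' : Set ℂ} (hK : IsCompact K) (hB : IsCompact B)
    (hBlog : ∀ g : ℂ → ℂ, ContinuousOn g B → (∀ z ∈ B, g z ≠ 0) → HasLog B g)
    {a b : ℂ} (hab : K ∩ B ⊆ {a, b}) (hB' : IsPreconnected B') (hB'K : B' ⊆ Kᶜ)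
    {F₁ F₂ F₃ : Set ℂ} (h₁ : F₁ ∈ faces (K ∪ B)) (h₂ : F₂ ∈ faces (K ∪ B))
    (h₃ : F₃ ∈ faces (K ∪ B)) (t₁ : (closure F₁ ∩ B').Nonempty) (t₂ : (closure F₂ ∩ B').Nonempty)
    (t₃ : (closure F₃ ∩ B').Nonempty) (n₁₂ : F₂ ≠ F₁) (n₁₃ : F₃ ≠ F₁) (n₂₃ : F₂ ≠ F₃) : False := by
  obtain ⟨p₁, m₁⟩ := face_nonempty h₁
  obtain ⟨p₂, m₂⟩ := face_nonempty h₂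
  obtain ⟨p₃, m₃⟩ := face_nonempty h₃
  have hsub : ∀ F ∈ faces (K ∪ B), F ⊆ Kᶜ := fun F hF =>
    (face_subset hF).trans (compl_subset_compl.2 subset_union_left)
  have conn : ∀ F ∈ faces (K ∪ B), (closure F ∩ B').Nonempty → IsPreconnected (F ∪ B') := by
    rintro F hF ⟨z, hz, hz'⟩
    have h1 : IsPreconnected (insert z F) := by
      refine (face_preconnected hF).subset_closure (subset_insert z F) ?_
      exact insert_subset hz subset_closure
    have h2 := h1.union z (mem_insert z F) hz' hB'
    have : insert z F ∪ B' = F ∪ B' := by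
      rw [insert_union]; exact insert_eq_of_mem (Or.inr hz')
    rwa [this] at h2
  have hlog : ∀ F ∈ faces (K ∪ B), (closure F ∩ B').Nonempty → ∀ p ∈ F,
      HasLog K (fun z => (z - p) / (z - p₁)) := by
    intro F hF ht p hp
    have h1 := conn F hF ht
    have h2 := conn F₁ h₁ t₁
    obtain ⟨z, _, hz⟩ := t₁
    have h3 := h1.union z (Or.inr hz) (Or.inr hz) h2
    refine hasLog_of_preconnected hK h3 ?_ (Or.inl (Or.inl hp)) (Or.inr (Or.inl m₁))
    rintro w ((hw | hw) | (hw | hw))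
    · exact hsub F hF hw
    · exact hB'K hw
    · exact hsub F₁ h₁ hw
    · exact hB'K hw
  refine three_points hK hB hBlog hab (face_subset h₁ m₁) (face_subset h₂ m₂) (face_subset h₃ m₃)
    (hlog F₂ h₂ t₂ p₂ m₂) (hlog F₃ h₃ t₃ p₃ m₃) ?_ ?_ ?_
  · rw [← face_eq h₁ m₁, ← face_eq h₂ m₂]; exact n₁₂
  · rw [← face_eq h₁ m₁, ← face_eq h₃ m₃]; exact n₁₃
  · rw [← face_eq h₂ m₂, ← face_eq h₃ m₃]; exact n₂₃

theorem edge_two_faces {E : Set (Sym2 V)} (hE : E ⊆ P.edgeSet) {e : Sym2 V} (he : e ∈ E)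
    {F₁ F₂ F₃ : Set ℂ} (h₁ : F₁ ∈ faces (D.im E)) (h₂ : F₂ ∈ faces (D.im E))
    (h₃ : F₃ ∈ faces (D.im E)) (t₁ : D.touch F₁ e) (t₂ : D.touch F₂ e)
    (t₃ : D.touch F₃ e) (n₁₂ : F₂ ≠ F₁) (n₁₃ : F₃ ≠ F₁) (n₂₃ : F₂ ≠ F₃) : False := by
  have hE' : E \ {e} ⊆ P.edgeSet := fun x hx => hE hx.1
  have hdis := D.emap_disj_im hE' (hE he) (by simp)
  have hins : D.im E = D.im (E \ {e}) ∪ D.cl e := by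
    rw [← im_insert, insert_sdiff_singleton, insert_eq_of_mem he]
  rw [hins] at h₁ h₂ h₃
  induction e with
  | _ a b =>
  refine two_faces (a := D.vmap a) (b := D.vmap b) (D.im_compact hE') (D.cl_compact (hE he))
    (fun g hg h0 => D.cl_hasLog (hE he) hg h0)
    ?_ (D.emap_preconnected (hE he)) hdis h₁ h₂ h₃ t₁ t₂ t₃ n₁₂ n₁₃ n₂₃
  rintro z ⟨h1, h2 | ⟨v, hv, rfl⟩⟩
  · exact absurd h1 (hdis h2)
  · rcases Sym2.mem_iff.1 hv with rfl | rfl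
    · exact Or.inl rfl
    · exact Or.inr rfl

/-- Ball lemma -/
theorem ball_lemma {E : Set (Sym2 V)} (hE : E ⊆ P.edgeSet) {e : Sym2 V} (he : e ∈ E) {z : ℂ}
    (hz : z ∈ D.emap e) : ∃ ε > 0, ∀ y ∈ Metric.ball z ε, y ∈ D.emap e ∨
      (y ∈ (D.im E)ᶜ ∧ D.touch (connectedComponentIn (D.im E)ᶜ y) e) := by
  have hE' : E \ {e} ⊆ P.edgeSet := fun x hx => hE hx.1
  have hdis := D.emap_disj_im hE' (hE he) (by simp)
  obtain ⟨ε, hε, hb⟩ := Metric.isOpen_iff.1 (D.im_compact hE').isClosed.isOpen_compl z (hdis hz)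
  have hball : ∀ y ∈ Metric.ball z ε, y ∈ D.im E → y ∈ D.emap e := by
    intro y hy hyE
    rcases D.mem_im_iff.1 hyE with h | ⟨e', he', h⟩
    · exact absurd (D.mem_im_iff.2 (Or.inl h)) (hb hy)
    · by_cases hee : e' = e
      · exact hee ▸ h
      · exact absurd (D.mem_im_iff.2 (Or.inr (Exists.intro e' ⟨(⟨he', hee⟩ : e' ∈ E \ {e}), h⟩))) (hb hy)
  refine ⟨ε, hε, fun y hy => ?_⟩
  by_cases hyE : y ∈ D.im E
  · exact Or.inl (hball y hy hyE)
  right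
  refine ⟨hyE, ?_⟩
  set F := connectedComponentIn (D.im E)ᶜ y with hF
  have hFf : F ∈ faces (D.im E) := mem_faces hyE
  have hseg : segment ℝ y z ⊆ Metric.ball z ε :=
    (convex_ball z ε).segment_subset hy (Metric.mem_ball_self hε)
  have hcl := (D.im_compact hE).isClosed
  by_contra hnt
  -- the segment stays in F
  have : segment ℝ y z ⊆ F := by
    refine (convex_segment y z).isPreconnected.subset_of_closure_inter_subset (face_open hcl hFf)
      ⟨y, left_mem_segment ℝ y z, mem_connectedComponentIn hyE⟩ ?_
    rintro w ⟨hw, hws⟩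
    rcases face_closure hcl hFf hw with h | h
    · exact h
    · exact absurd ⟨w, hw, hball w (hseg hws) h⟩ hnt
  exact face_subset hFf (this (right_mem_segment ℝ y z))
    (D.mem_im_iff.2 (Or.inr ⟨e, he, hz⟩))

theorem exists_touching {E : Set (Sym2 V)} (hE : E ⊆ P.edgeSet) {e : Sym2 V} (he : e ∈ E) :
    ∃ F ∈ faces (D.im E), D.touch F e := by
  obtain ⟨z, hz⟩ := D.emap_nonempty (hE he)
  obtain ⟨ε, hε, hb⟩ := D.ball_lemma hE he hz
  by_contra hcon
  push Not at hcon
  induction e with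
  | _ a b =>
  obtain ⟨f, h1, h2, h3, h4, h5, h6⟩ := D.cl_arc (hE he)
  refine arc_no_ball h1 h2 hε (z := z) ?_
  intro y hy
  rw [← h6]
  rcases hb y hy with h | ⟨h, h'⟩
  · exact D.emap_subset_cl _ h
  · exact absurd h' (hcon _ (mem_faces h))

/-- A minimal cycle separating `p` and `q`. -/
theorem minimal_cycle {E : Set (Sym2 V)} (hE : E ⊆ P.edgeSet) {p q : ℂ} (hp : p ∈ (D.im E)ᶜ)
    (hq : q ∈ (D.im E)ᶜ) (hno : ¬ HasLog (D.im E) (fun z => (z - p) / (z - q))) :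
    ∃ C ⊆ E, (∃ (v : V) (c : P.Walk v v), c.IsCycle ∧ {e | e ∈ c.edges} = C) ∧
      ¬ HasLog (D.cim C) (fun z => (z - p) / (z - q)) ∧
      ∀ C' ⊂ C, HasLog (D.im C') (fun z => (z - p) / (z - q)) := by
  obtain ⟨M, hME, hM⟩ := (Set.toFinite {C | ¬ HasLog (D.im C) (fun z => (z - p) / (z - q))}).exists_le_minimal
    (a := E) hno
  have nz : ∀ x ∈ (D.im E)ᶜ, ∀ z ∈ D.im M, z - x ≠ 0 := by
    intro x hx z hz h
    rw [sub_eq_zero] at h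
    exact hx (h ▸ D.im_mono hME hz)
  obtain ⟨v, c, hc, hcM, hcn⟩ := D.exists_cycle (hME.trans hE) (g := fun z => (z - p) / (z - q))
    (by
      refine ContinuousOn.div ?_ ?_ (fun z hz => nz q hq z hz) <;> fun_prop)
    (fun z hz => div_ne_zero (nz p hp z hz) (nz q hq z hz)) hM.prop
  have hsub : {e | e ∈ c.edges} ⊆ M := hcM
  have heq : {e | e ∈ c.edges} = M := subset_antisymm hsub
    (hM.le_of_le (y := {e | e ∈ c.edges}) (fun h => hcn (h.mono (D.cim_subset_im _))) hsub)
  refine ⟨M, hME, ⟨v, c, hc, heq⟩, heq ▸ hcn, ?_⟩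
  intro C' hC'
  by_contra h
  exact hC'.2 (hM.le_of_le h hC'.1)

/-- If there are two faces, every face touches a cycle. -/
theorem not_hasLog_touched {E : Set (Sym2 V)} (hE : E ⊆ P.edgeSet) {F F' : Set ℂ}
    (hF : F ∈ faces (D.im E)) (hF' : F' ∈ faces (D.im E)) (hne : F ≠ F') {E' : Set (Sym2 V)}
    (hE'E : E' ⊆ E) (hE' : D.tE E F ⊆ E') {p q : ℂ} (hp : p ∈ F) (hq : q ∈ F') :
    ¬ HasLog (D.im E') (fun z => (z - p) / (z - q)) := by
  intro h
  have hf := D.face_of_touched hE hE'E hF (fun e he ht => hE' ⟨he, ht⟩)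
  have hqE : q ∈ (D.im E')ᶜ := compl_subset_compl.2 (D.im_mono hE'E) (face_subset hF' hq)
  have := comp_eq_of_hasLog (D.im_compact (hE'E.trans hE)) (face_subset hf hp) hqE h
  rw [← face_eq hf hp] at this
  have hqF : q ∈ F := by rw [this]; exact mem_connectedComponentIn hqE
  exact hne (face_eq_face hF hF' hqF hq)

end PlaneDr

end

section


/-- closed region bounded by `K` -/
def creg (K : Set ℂ) : Set ℂ := K ∪ {z | z ∉ K ∧ IsBounded (connectedComponentIn Kᶜ z)}

/-- vertices of an edge set -/
def vs {V : Type} (C : Set (Sym2 V)) : Set V := {v | ∃ e ∈ C, v ∈ e}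

/-- edge set of a cycle -/
def IsCyc {V : Type} (P : SimpleGraph V) (C : Set (Sym2 V)) : Prop :=
  ∃ (v : V) (c : P.Walk v v), c.IsCycle ∧ {e | e ∈ c.edges} = C

namespace PlaneDr

variable {V : Type} {P : SimpleGraph V} (D : PlaneDr P)

/-- edges between faces in `S` and faces outside `S` -/
def bd (E : Set (Sym2 V)) (S : Set (Set ℂ)) : Set (Sym2 V) :=
  {e | e ∈ E ∧ (∃ F ∈ S, D.touch F e) ∧ ∃ F ∈ faces (D.im E), F ∉ S ∧ D.touch F e}

/-- the component of `q` after removing the boundary -/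
def W (E : Set (Sym2 V)) (S : Set (Set ℂ)) (q : ℂ) : Set ℂ :=
  connectedComponentIn (D.im (D.bd E S))ᶜ q

/-- vertices incident with a face -/
def tV (E : Set (Sym2 V)) (F : Set ℂ) : Set V := vs (D.tE E F)

theorem bd_subset (E : Set (Sym2 V)) (S : Set (Set ℂ)) : D.bd E S ⊆ E := fun _ h => h.1

theorem emap_disj_cim {E : Set (Sym2 V)} (hE : E ⊆ P.edgeSet) {e : Sym2 V} (he : e ∈ P.edgeSet)
    (heE : e ∉ E) : D.emap e ⊆ (D.cim E)ᶜ := fun _ hz h =>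
  D.emap_disj_im hE he heE hz (D.cim_subset_im E h)

variable [Finite V]

theorem W_subset {E : Set (Sym2 V)} (hE : E ⊆ P.edgeSet) {S : Set (Set ℂ)}
    (hS : S ⊆ faces (D.im E)) {q : ℂ} {Fq : Set ℂ} (hFq : Fq ∈ faces (D.im E)) (hqF : q ∈ Fq)
    (hqS : Fq ∉ S) {z : ℂ} (hz : z ∈ D.W E S q) :
    (∀ F ∈ S, z ∉ F) ∧ ∀ e ∈ E, z ∈ D.emap e → ∀ F ∈ S, ¬ D.touch F e := by
  have hB : D.bd E S ⊆ P.edgeSet := (D.bd_subset E S).trans hE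
  have hcl := (D.im_compact hE).isClosed
  set A : Set ℂ := {z | z ∈ (D.im (D.bd E S))ᶜ ∧
    ((∃ F ∈ S, z ∈ F) ∨ ∃ e ∈ E, z ∈ D.emap e ∧ ∃ F ∈ S, D.touch F e)} with hA
  set A' : Set ℂ := {z | z ∈ (D.im (D.bd E S))ᶜ ∧
    ((∃ F ∈ faces (D.im E), F ∉ S ∧ z ∈ F) ∨ ∃ e ∈ E, z ∈ D.emap e ∧ ∀ F ∈ S, ¬ D.touch F e)} with hA'
  have hsubc : (D.im E)ᶜ ⊆ (D.im (D.bd E S))ᶜ :=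
    compl_subset_compl.2 (D.im_mono (D.bd_subset E S))
  have memB : ∀ e, D.emap e ⊆ D.im E ∨ True := fun _ => Or.inr trivial
  have notB : ∀ e ∈ E, ∀ z ∈ D.emap e, z ∈ (D.im (D.bd E S))ᶜ → e ∉ D.bd E S := by
    intro e _ z hz hz' h
    exact hz' (D.mem_im_iff.2 (Or.inr ⟨e, h, hz⟩))
  have hAo : IsOpen A := by
    rw [isOpen_iff_forall_mem_open]
    rintro z ⟨hzB, ⟨F, hF, hzF⟩ | ⟨e, he, hze, F, hF, ht⟩⟩
    · exact ⟨F, fun y hy => ⟨hsubc (face_subset (hS hF) hy), Or.inl ⟨F, hF, hy⟩⟩,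
        face_open hcl (hS hF), hzF⟩
    · obtain ⟨ε, hε, hb⟩ := D.ball_lemma hE he hze
      have heB := notB e he z hze hzB
      refine ⟨Metric.ball z ε, ?_, Metric.isOpen_ball, Metric.mem_ball_self hε⟩
      intro y hy
      rcases hb y hy with h | ⟨h, h'⟩
      · exact ⟨D.emap_disj_im hB (hE he) heB h, Or.inr ⟨e, he, h, F, hF, ht⟩⟩
      · refine ⟨hsubc h, Or.inl ⟨_, ?_, mem_connectedComponentIn h⟩⟩
        by_contra hn
        exact heB ⟨he, ⟨F, hF, ht⟩, ⟨_, mem_faces h, hn, h'⟩⟩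
  have hAo' : IsOpen A' := by
    rw [isOpen_iff_forall_mem_open]
    rintro z ⟨hzB, ⟨F, hF, hFS, hzF⟩ | ⟨e, he, hze, ht⟩⟩
    · exact ⟨F, fun y hy => ⟨hsubc (face_subset hF hy), Or.inl ⟨F, hF, hFS, hy⟩⟩,
        face_open hcl hF, hzF⟩
    · obtain ⟨ε, hε, hb⟩ := D.ball_lemma hE he hze
      have heB := notB e he z hze hzB
      refine ⟨Metric.ball z ε, ?_, Metric.isOpen_ball, Metric.mem_ball_self hε⟩
      intro y hy
      rcases hb y hy with h | ⟨h, h'⟩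
      · exact ⟨D.emap_disj_im hB (hE he) heB h, Or.inr ⟨e, he, h, ht⟩⟩
      · exact ⟨hsubc h, Or.inl ⟨_, mem_faces h, fun hn => ht _ hn h', mem_connectedComponentIn h⟩⟩
  have hdis : ∀ z ∈ A, z ∉ A' := by
    rintro z ⟨_, ⟨F, hF, hzF⟩ | ⟨e, he, hze, F, hF, ht⟩⟩ ⟨_, ⟨F', hF', hFS', hzF'⟩ | ⟨e', he', hze', ht'⟩⟩
    · exact hFS' (face_eq_face (hS hF) hF' hzF hzF' ▸ hF)
    · exact face_subset (hS hF) hzF (D.mem_im_iff.2 (Or.inr ⟨e', he', hze'⟩))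
    · exact face_subset hF' hzF' (D.mem_im_iff.2 (Or.inr ⟨e, he, hze⟩))
    · have : e = e' := by
        by_contra hne
        exact D.disj e (hE he) e' (hE he') hne z hze hze'
      subst this
      exact ht' F hF ht
  have hcov : (D.im (D.bd E S))ᶜ ⊆ A' ∪ A := by
    intro z hz
    by_cases hzE : z ∈ D.im E
    · rcases D.mem_im_iff.1 hzE with ⟨v, rfl⟩ | ⟨e, he, hze⟩
      · exact absurd (D.vmap_mem_im _ v) hz
      · by_cases ht : ∃ F ∈ S, D.touch F e
        · exact Or.inr ⟨hz, Or.inr ⟨e, he, hze, ht⟩⟩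
        · push Not at ht
          exact Or.inl ⟨hz, Or.inr ⟨e, he, hze, ht⟩⟩
    · by_cases hFS : connectedComponentIn (D.im E)ᶜ z ∈ S
      · exact Or.inr ⟨hz, Or.inl ⟨_, hFS, mem_connectedComponentIn hzE⟩⟩
      · exact Or.inl ⟨hz, Or.inl ⟨_, mem_faces hzE, hFS, mem_connectedComponentIn hzE⟩⟩
  have hqA : q ∈ A' := ⟨hsubc (face_subset hFq hqF), Or.inl ⟨Fq, hFq, hqS, hqF⟩⟩
  have hWA : D.W E S q ⊆ A' := by
    refine IsPreconnected.subset_left_of_subset_union hAo' hAo ?_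
      ((connectedComponentIn_subset _ _).trans hcov) ⟨q, mem_connectedComponentIn hqA.1, hqA⟩
      isPreconnected_connectedComponentIn
    rw [Set.disjoint_right]
    exact hdis
  have hzA := hWA hz
  constructor
  · intro F hF hzF
    exact hdis z ⟨hzA.1, Or.inl ⟨F, hF, hzF⟩⟩ hzA
  · intro e he hze F hF ht
    exact hdis z ⟨hzA.1, Or.inr ⟨e, he, hze, F, hF, ht⟩⟩ hzA

theorem W_anti {E : Set (Sym2 V)} (hE : E ⊆ P.edgeSet) {S S' : Set (Set ℂ)} (hSS : S ⊆ S')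
    (hS : S' ⊆ faces (D.im E)) {q : ℂ} {Fq : Set ℂ} (hFq : Fq ∈ faces (D.im E)) (hqF : q ∈ Fq)
    (hqS : Fq ∉ S') : D.W E S' q ⊆ D.W E S q := by
  have hq : q ∈ (D.im (D.bd E S'))ᶜ :=
    compl_subset_compl.2 (D.im_mono (D.bd_subset E S')) (face_subset hFq hqF)
  refine isPreconnected_connectedComponentIn.subset_connectedComponentIn
    (mem_connectedComponentIn hq) ?_
  intro z hz h
  rcases D.mem_im_iff.1 h with ⟨v, rfl⟩ | ⟨e, he, hze⟩
  · exact connectedComponentIn_subset _ _ hz (D.vmap_mem_im _ v)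
  · obtain ⟨F, hF, ht⟩ := he.2.1
    exact (D.W_subset hE hS hFq hqF hqS hz).2 e he.1 hze F (hSS hF) ht

theorem level_cycle {E : Set (Sym2 V)} (hE : E ⊆ P.edgeSet) {S : Set (Set ℂ)}
    (hS : S ⊆ faces (D.im E)) {p q : ℂ} {Fp Fq : Set ℂ} (hFq : Fq ∈ faces (D.im E)) (hqF : q ∈ Fq)
    (hqS : Fq ∉ S) (hFp : Fp ∈ S) (hpF : p ∈ Fp) :
    ∃ C ⊆ D.bd E S, IsCyc P C ∧ ¬ HasLog (D.cim C) (fun z => (z - p) / (z - q)) ∧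
      (∀ C' ⊂ C, HasLog (D.im C') (fun z => (z - p) / (z - q))) ∧
      ∀ e ∈ C, D.touch (D.W E S q) e := by
  have hB : D.bd E S ⊆ P.edgeSet := (D.bd_subset E S).trans hE
  have hq : q ∈ (D.im (D.bd E S))ᶜ :=
    compl_subset_compl.2 (D.im_mono (D.bd_subset E S)) (face_subset hFq hqF)
  have hp : p ∈ (D.im (D.bd E S))ᶜ :=
    compl_subset_compl.2 (D.im_mono (D.bd_subset E S)) (face_subset (hS hFp) hpF)
  have hW : D.W E S q ∈ faces (D.im (D.bd E S)) := mem_faces hq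
  set B' := D.tE (D.bd E S) (D.W E S q) with hB'
  have hB'B : B' ⊆ D.bd E S := D.tE_subset _ _
  have hW' := D.face_of_touched hB hB'B hW (fun e he ht => ⟨he, ht⟩)
  have hsub := compl_subset_compl.2 (D.im_mono hB'B)
  have hno : ¬ HasLog (D.im B') (fun z => (z - p) / (z - q)) := by
    intro h
    have h1 := comp_eq_of_hasLog (D.im_compact (hB'B.trans hB)) (hsub hp) (hsub hq) h
    rw [← face_eq hW' (mem_connectedComponentIn hq)] at h1
    have hpW : p ∈ D.W E S q := by rw [← h1]; exact mem_connectedComponentIn (hsub hp)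
    exact (D.W_subset hE hS hFq hqF hqS hpW).1 Fp hFp hpF
  obtain ⟨C, h1, h2, h3, h4⟩ := D.minimal_cycle (hB'B.trans hB) (hsub hp) (hsub hq) hno
  exact ⟨C, h1.trans hB'B, h2, h3, h4, fun e he => (h1 he).2⟩

/-- If all edges of `C'` touch `U` which lies in the face `O` of `cim C`, then `cim C'` lies in
`O ∪ cim C`. -/
theorem cim_subset_of_touch {C C' : Set (Sym2 V)} (hC : C ⊆ P.edgeSet) (hC' : C' ⊆ P.edgeSet)
    (hdis : ∀ e ∈ C', e ∉ C) {O U : Set ℂ} (hO : O ∈ faces (D.cim C)) (hU : U ⊆ O)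
    (ht : ∀ e ∈ C', D.touch U e) : D.cim C' ⊆ O ∪ D.cim C := by
  have hcl := (D.cim_compact hC).isClosed
  refine iUnion₂_subset ?_
  intro e he
  have hd := D.emap_disj_cim hC (hC' he) (hdis e he)
  obtain ⟨z, hz, hze⟩ := ht e he
  have hzO : z ∈ O := by
    rcases face_closure hcl hO (closure_mono hU hz) with h | h
    · exact h
    · exact absurd h (hd hze)
  have heO : D.emap e ⊆ O := by
    rw [face_eq hO hzO]
    exact (D.emap_preconnected (hC' he)).subset_connectedComponentIn hze hd
  exact (D.cl_subset_closure (hC' he)).trans ((closure_mono heO).trans (face_closure hcl hO))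

/-- Nesting of two consecutive level cycles. -/
theorem nesting {E C C' : Set (Sym2 V)} (hE : E ⊆ P.edgeSet) (hCE : C ⊆ E) (hCE' : C' ⊆ E)
    (hdis : ∀ e ∈ C', e ∉ C) {p q : ℂ} (hp : p ∈ (D.im E)ᶜ) (hq : q ∈ (D.cim C)ᶜ)
    (hno : ¬ HasLog (D.cim C) (fun z => (z - p) / (z - q)))
    (hmin : ∀ C' ⊂ C, HasLog (D.im C') (fun z => (z - p) / (z - q)))
    (hq' : q ∈ (D.im E)ᶜ)
    {U : Set ℂ} (hU : U ⊆ connectedComponentIn (D.cim C)ᶜ q) (ht : ∀ e ∈ C', D.touch U e) :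
    D.cim C' ⊆ connectedComponentIn (D.cim C)ᶜ q ∪ D.cim C ∧
    D.cim C ⊆ connectedComponentIn (D.cim C')ᶜ p ∪ D.cim C' := by
  have hC := hCE.trans hE
  have hC' := hCE'.trans hE
  have hO : connectedComponentIn (D.cim C)ᶜ q ∈ faces (D.cim C) := mem_faces hq
  have h1 := D.cim_subset_of_touch hC hC' hdis hO hU ht
  refine ⟨h1, ?_⟩
  have hpC : p ∈ (D.cim C)ᶜ := compl_subset_compl.2
    ((D.cim_mono hCE).trans (D.cim_subset_im _)) hp
  have hpC' : p ∈ (D.cim C')ᶜ := compl_subset_compl.2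
    ((D.cim_mono hCE').trans (D.cim_subset_im _)) hp
  have hpCi : p ∈ (D.im C)ᶜ := compl_subset_compl.2 (D.im_mono hCE) hp
  have hqCi : q ∈ (D.im C)ᶜ := compl_subset_compl.2 (D.im_mono hCE) hq'
  have hne : q ∉ connectedComponentIn (D.cim C)ᶜ p := by
    intro h
    exact hno (hasLog_of_preconnected (D.cim_compact hC) isPreconnected_connectedComponentIn
      (connectedComponentIn_subset _ _) (mem_connectedComponentIn hpC) h)
  have hPP : connectedComponentIn (D.cim C)ᶜ p ⊆ connectedComponentIn (D.cim C')ᶜ p := by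
    refine isPreconnected_connectedComponentIn.subset_connectedComponentIn
      (mem_connectedComponentIn hpC) ?_
    intro z hz hzC'
    rcases h1 hzC' with h | h
    · apply hne
      rw [connectedComponentIn_eq hz, ← connectedComponentIn_eq h]
      exact mem_connectedComponentIn hq
    · exact connectedComponentIn_subset _ _ hz h
  have hP0 : connectedComponentIn (D.im C)ᶜ p ⊆ connectedComponentIn (D.cim C)ᶜ p :=
    connectedComponentIn_mono p (compl_subset_compl.2 (D.cim_subset_im C))
  refine D.cim_subset_of_touch hC' hC (fun e he he' => hdis e he' he) (mem_faces hpC')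
    (hP0.trans hPP) ?_
  intro e he
  by_contra hnt
  have hss : C \ {e} ⊂ C := sdiff_singleton_ssubset.2 he
  have hf : connectedComponentIn (D.im C)ᶜ p ∈ faces (D.im (C \ {e})) := by
    refine D.face_of_touched hC hss.1 (mem_faces hpCi) ?_
    intro e' he' ht'
    refine ⟨he', ?_⟩
    rintro rfl
    exact hnt ht'
  have hsub := compl_subset_compl.2 (D.im_mono hss.1)
  have := comp_eq_of_hasLog (D.im_compact (hss.1.trans hC)) (hsub hpCi) (hsub hqCi) (hmin _ hss)
  rw [← face_eq hf (mem_connectedComponentIn hpCi)] at this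
  apply hne
  apply hP0
  rw [this]
  exact mem_connectedComponentIn (hsub hqCi)

theorem face_subset_creg {K F : Set ℂ} (hF : F ∈ faces K) (hb : IsBounded F) : F ∪ K ⊆ creg K := by
  rintro z (hz | hz)
  · exact Or.inr ⟨face_subset hF hz, by rw [← face_eq hF hz]; exact hb⟩
  · exact Or.inl hz

/-- The key lemma: nests from level functions. -/
theorem key {E : Set (Sym2 V)} (hE : E ⊆ P.edgeSet) (X : Finset V) (hX : X.card ≤ 2)
    (hXe : ∀ e ∈ E, ∃ v ∈ e, v ∉ X) (d : V → ℕ∞)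
    (hd : ∀ F ∈ faces (D.im E), ∀ a ∈ D.tV E F, ∀ b ∈ D.tV E F, a ∉ X → b ∉ X → d b ≤ d a + 1)
    {Fp Fq : Set ℂ} (hFp : Fp ∈ faces (D.im E)) (hFq : Fq ∈ faces (D.im E))
    (hpa : ∃ a ∈ D.tV E Fp, a ∉ X ∧ d a = 0) (t : ℕ)
    (hqa : ∀ a ∈ D.tV E Fq, a ∉ X → ((8 * t : ℕ) : ℕ∞) < d a) :
    ∃ Y ⊆ X, ∃ C : Fin t → Set (Sym2 V), (∀ i, C i ⊆ E ∧ IsCyc P (C i)) ∧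
      (∀ i j, i ≠ j → Disjoint (C i) (C j)) ∧ (∀ i j, i ≠ j → vs (C i) ∩ vs (C j) = Y) ∧
      ∀ i : ℕ, ∀ h : i + 1 < t, D.cim (C ⟨i + 1, h⟩) ⊆ creg (D.cim (C ⟨i, by omega⟩)) := by
  classical
  obtain ⟨p, hpF⟩ := face_nonempty hFp
  obtain ⟨q, hqF⟩ := face_nonempty hFq
  set S : ℕ → Set (Set ℂ) := fun k =>
    {F | F ∈ faces (D.im E) ∧ ∃ a ∈ D.tV E F, a ∉ X ∧ d a ≤ (k : ℕ∞)} with hS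
  have hSf : ∀ k, S k ⊆ faces (D.im E) := fun k F hF => hF.1
  have hSm : ∀ k l, k ≤ l → S k ⊆ S l := by
    rintro k l hkl F ⟨hF, a, ha, haX, had⟩
    exact ⟨hF, a, ha, haX, had.trans (by exact_mod_cast hkl)⟩
  have hpS : ∀ k, Fp ∈ S k := by
    intro k
    obtain ⟨a, ha, haX, had⟩ := hpa
    exact ⟨hFp, a, ha, haX, by rw [had]; exact zero_le⟩
  have hqS : ∀ k ≤ 8 * t, Fq ∉ S k := by
    rintro k hk ⟨_, a, ha, haX, had⟩
    have h1 := hqa a ha haX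
    have h2 : (k : ℕ∞) ≤ ((8 * t : ℕ) : ℕ∞) := by exact_mod_cast hk
    exact absurd (had.trans h2) (not_le.2 h1)
  have hex : ∀ k : Fin (8 * t), ∃ C ⊆ D.bd E (S k), IsCyc P C ∧
      ¬ HasLog (D.cim C) (fun z => (z - p) / (z - q)) ∧
      (∀ C' ⊂ C, HasLog (D.im C') (fun z => (z - p) / (z - q))) ∧
      ∀ e ∈ C, D.touch (D.W E (S k) q) e := fun k =>
    D.level_cycle hE (hSf k) hFq hqF (hqS k k.2.le) (hpS k) hpF
  choose C hCB hCyc hCno hCmin hCt using hex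
  have hCE : ∀ k, C k ⊆ E := fun k => (hCB k).trans (D.bd_subset _ _)
  have hlev : ∀ k : Fin (8 * t), ∀ v ∈ vs (C k), v ∉ X → d v = ((k : ℕ) + 1 : ℕ) := by
    rintro k v ⟨e, he, hve⟩ hvX
    obtain ⟨heE, ⟨F, ⟨hF, a, ha, haX, had⟩, ht⟩, ⟨F', hF', hF'S, ht'⟩⟩ := hCB k he
    apply le_antisymm
    · have h1 := hd F hF a ha v ⟨e, ⟨heE, ht⟩, hve⟩ haX hvX
      refine h1.trans ?_
      push_cast
      gcongr
    · have h2 : ¬ d v ≤ (k : ℕ) := fun h => hF'S ⟨hF', v, ⟨e, ⟨heE, ht'⟩, hve⟩, hvX, h⟩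
      rw [not_le] at h2
      have := Order.add_one_le_of_lt h2
      push_cast
      exact this
  have hXlev : ∀ k l : Fin (8 * t), k ≠ l → ∀ v ∈ vs (C k), v ∈ vs (C l) → v ∈ X := by
    intro k l hkl v hv hv'
    by_contra hvX
    have h1 := hlev k v hv hvX
    have h2 := hlev l v hv' hvX
    rw [h1] at h2
    have h3 : (k : ℕ) + 1 = l + 1 := by exact_mod_cast h2
    exact hkl (Fin.ext (by omega))
  have hedis : ∀ k l : Fin (8 * t), k ≠ l → ∀ e ∈ C k, e ∉ C l := by
    intro k l hkl e he he'
    obtain ⟨v, hve, hvX⟩ := hXe e (hCE k he)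
    exact hvX (hXlev k l hkl v ⟨e, he, hve⟩ ⟨e, he', hve⟩)
  have hp0 : p ∈ (D.im E)ᶜ := face_subset hFp hpF
  have hq0 : q ∈ (D.im E)ᶜ := face_subset hFq hqF
  have hcimE : ∀ k, D.cim (C k) ⊆ D.im E := fun k =>
    (D.cim_mono (hCE k)).trans (D.cim_subset_im E)
  have hqC : ∀ k, q ∈ (D.cim (C k))ᶜ := fun k => compl_subset_compl.2 (hcimE k) hq0
  have hpC : ∀ k, p ∈ (D.cim (C k))ᶜ := fun k => compl_subset_compl.2 (hcimE k) hp0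
  have hnest : ∀ k l : Fin (8 * t), k < l →
      D.cim (C l) ⊆ connectedComponentIn (D.cim (C k))ᶜ q ∪ D.cim (C k) ∧
      D.cim (C k) ⊆ connectedComponentIn (D.cim (C l))ᶜ p ∪ D.cim (C l) := by
    intro k l hkl
    refine D.nesting (U := D.W E (S l) q) hE (hCE k) (hCE l) (hedis l k hkl.ne') hp0 (hqC k) (hCno k)
      (hCmin k) hq0 ?_ (hCt l)
    refine (D.W_anti hE (hSm k l (by exact_mod_cast hkl.le)) (hSf l) hFq hqF (hqS l l.2.le)).trans ?_
    exact connectedComponentIn_mono q (compl_subset_compl.2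
      ((D.cim_mono (hCB k)).trans (D.cim_subset_im _)))
  have hne : ∀ k, connectedComponentIn (D.cim (C k))ᶜ p ≠ connectedComponentIn (D.cim (C k))ᶜ q := by
    intro k h
    refine hCno k (hasLog_of_preconnected (D.cim_compact ((hCE k).trans hE))
      isPreconnected_connectedComponentIn (connectedComponentIn_subset _ _)
      (mem_connectedComponentIn (hpC k)) ?_)
    rw [h]; exact mem_connectedComponentIn (hqC k)
  -- pigeonhole
  set κ : Fin (8 * t) → Prop × Finset V := fun k =>
    (IsBounded (connectedComponentIn (D.cim (C k))ᶜ q), X.filter (fun v => v ∈ vs (C k))) with hκ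
  have hmaps : ∀ k ∈ (Finset.univ : Finset (Fin (8 * t))),
      κ k ∈ (Finset.univ : Finset Prop) ×ˢ X.powerset := by
    intro k _
    rw [Finset.mem_product]
    exact ⟨Finset.mem_univ _, Finset.mem_powerset.2 (Finset.filter_subset _ _)⟩
  have hcard : ((Finset.univ : Finset Prop) ×ˢ X.powerset).card * t ≤
      (Finset.univ : Finset (Fin (8 * t))).card := by
    rw [Finset.card_product, Finset.card_powerset, Finset.card_univ, Fintype.card_prop,
      Finset.card_univ, Fintype.card_fin]
    have : 2 ^ X.card ≤ 2 ^ 2 := Nat.pow_le_pow_right (by norm_num) hX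
    nlinarith
  obtain ⟨⟨b, Y⟩, hbY, hfib⟩ := Finset.exists_le_card_fiber_of_mul_le_card_of_maps_to hmaps
    ⟨(True, ∅), by simp⟩ hcard
  set Q := (Finset.univ : Finset (Fin (8 * t))).filter (fun k => κ k = (b, Y)) with hQ
  have hQκ : ∀ k ∈ Q, κ k = (b, Y) := fun k hk => (Finset.mem_filter.1 hk).2
  let ι := Finset.orderEmbOfCardLe Q hfib
  have hι : ∀ i, ι i ∈ Q := fun i => Finset.orderEmbOfCardLe_mem Q hfib i
  have hYX : Y ⊆ X := by
    have := (Finset.mem_product.1 hbY).2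
    exact Finset.mem_powerset.1 this
  have hinter : ∀ k ∈ Q, ∀ l ∈ Q, k ≠ l → vs (C k) ∩ vs (C l) = Y := by
    intro k hk l hl hkl
    have e1 : X.filter (fun v => v ∈ vs (C k)) = Y := congrArg Prod.snd (hQκ k hk)
    have e2 : X.filter (fun v => v ∈ vs (C l)) = Y := congrArg Prod.snd (hQκ l hl)
    ext v
    constructor
    · rintro ⟨h1, h2⟩
      rw [← e1]
      simp [h1, hXlev k l hkl v h1 h2]
    · intro h
      have h1 : v ∈ X.filter (fun v => v ∈ vs (C k)) := by rw [e1]; exact h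
      have h2 : v ∈ X.filter (fun v => v ∈ vs (C l)) := by rw [e2]; exact h
      exact ⟨(Finset.mem_filter.1 h1).2, (Finset.mem_filter.1 h2).2⟩
  have hbdd : ∀ k ∈ Q, (IsBounded (connectedComponentIn (D.cim (C k))ᶜ q) ↔ b) := by
    intro k hk
    have e1 : IsBounded (connectedComponentIn (D.cim (C k))ᶜ q) = b := congrArg Prod.fst (hQκ k hk)
    rw [e1]
  by_cases hb : b
  · refine ⟨Y, hYX, fun i => C (ι i), fun i => ⟨hCE _, hCyc _⟩, ?_, ?_, ?_⟩
    · intro i j hij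
      rw [Set.disjoint_left]
      exact hedis _ _ (fun h => hij (ι.injective h))
    · intro i j hij
      exact hinter _ (hι i) _ (hι j) (fun h => hij (ι.injective h))
    · intro i h
      have hlt : ι ⟨i, by omega⟩ < ι ⟨i + 1, h⟩ := ι.strictMono (by simp)
      exact (hnest _ _ hlt).1.trans (face_subset_creg (mem_faces (hqC _))
        ((hbdd _ (hι _)).2 hb))
  · refine ⟨Y, hYX, fun i => C (ι (Fin.rev i)), fun i => ⟨hCE _, hCyc _⟩, ?_, ?_, ?_⟩
    · intro i j hij
      rw [Set.disjoint_left]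
      exact hedis _ _ (fun h => hij (Fin.rev_injective (ι.injective h)))
    · intro i j hij
      exact hinter _ (hι _) _ (hι _) (fun h => hij (Fin.rev_injective (ι.injective h)))
    · intro i h
      have hlt : ι (Fin.rev ⟨i + 1, h⟩) < ι (Fin.rev ⟨i, by omega⟩) :=
        ι.strictMono (Fin.rev_lt_rev.2 (by simp))
      refine (hnest _ _ hlt).2.trans (face_subset_creg (mem_faces (hpC _)) ?_)
      by_contra hnb
      refine hne _ (unbounded_comp_eq (D.cim_compact ((hCE _).trans hE)) hnb ?_)
      exact fun h => hb ((hbdd _ (hι _)).1 h)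

end PlaneDr

end

section


theorem forest_card {V : Type} [Fintype V] [Nonempty V] (F : SimpleGraph V) (hF : F.IsAcyclic) :
    F.edgeSet.ncard + 1 ≤ Fintype.card V := by
  classical
  obtain ⟨T, hFT, -, hT⟩ := SimpleGraph.Connected.exists_isTree_le_of_le_of_isAcyclic
    (G := (⊤ : SimpleGraph V)) (H := F) SimpleGraph.connected_top le_top hF
  rw [← hT.card_edgeFinset, ← Set.ncard_coe_finset, SimpleGraph.coe_edgeFinset]
  have := Set.ncard_le_ncard (SimpleGraph.edgeSet_mono hFT) (Set.toFinite _)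
  omega

namespace PlaneDr

variable {V : Type} {P : SimpleGraph V} (D : PlaneDr P)

theorem euler_count [Fintype V] [Nonempty V] :
    ∃ S : Finset (Set ℂ), (∀ F ∈ S, F ∈ faces (D.im P.edgeSet)) ∧
      P.edgeSet.ncard + 2 ≤ S.card + Fintype.card V := by
  classical
  obtain ⟨F, hFP, hF, hr⟩ := P.exists_isAcyclic_reachable_eq_le
  have hsub := SimpleGraph.edgeSet_mono hFP
  have hfin : (P.edgeSet \ F.edgeSet).Finite := Set.toFinite _
  obtain ⟨S, hS, hc⟩ := D.euler_lower (E₀ := F.edgeSet) hsub hfin.toFinset (by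
    intro e he
    rw [Set.Finite.mem_toFinset] at he
    refine ⟨he.2, ?_⟩
    induction e with
    | _ a b =>
    refine ⟨a, b, he.1, rfl, ?_⟩
    have h1 : F.Reachable a b := by
      rw [hr]; exact SimpleGraph.Adj.reachable he.1
    obtain ⟨p⟩ := h1
    refine ⟨p.mapLe hFP, ?_⟩
    intro e he
    rw [SimpleGraph.Walk.edges_mapLe_eq_edges] at he
    exact p.edges_subset_edgeSet he)
  rw [Set.Finite.coe_toFinset, Set.union_sdiff_cancel hsub] at hS
  refine ⟨S, hS, ?_⟩
  have h2 : hfin.toFinset.card = (P.edgeSet \ F.edgeSet).ncard := (Set.ncard_eq_toFinset_card _ hfin).symm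
  have h3 := Set.ncard_sdiff_add_ncard_of_subset hsub (Set.toFinite _)
  have h4 := forest_card F hF
  omega

theorem face_cycle [Finite V] {E : Set (Sym2 V)} (hE : E ⊆ P.edgeSet) {F F' : Set ℂ}
    (hF : F ∈ faces (D.im E)) (hF' : F' ∈ faces (D.im E)) (hne : F ≠ F') {E' : Set (Sym2 V)}
    (hE'E : E' ⊆ E) (hE' : D.tE E F ⊆ E') :
    ∃ (v : V) (c : P.Walk v v), c.IsCycle ∧ ∀ e ∈ c.edges, e ∈ E' := by
  obtain ⟨p, hp⟩ := face_nonempty hF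
  obtain ⟨q, hq⟩ := face_nonempty hF'
  have hno := D.not_hasLog_touched hE hF hF' hne hE'E hE' hp hq
  have hp' : ∀ z ∈ D.im E', z - p ≠ 0 := fun z hz h => face_subset hF hp (by
    rw [← sub_eq_zero.1 h]; exact D.im_mono hE'E hz)
  have hq' : ∀ z ∈ D.im E', z - q ≠ 0 := fun z hz h => face_subset hF' hq (by
    rw [← sub_eq_zero.1 h]; exact D.im_mono hE'E hz)
  obtain ⟨v, c, h1, h2, -⟩ := D.exists_cycle (hE'E.trans hE)
    (ContinuousOn.div (by fun_prop) (by fun_prop) hq')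
    (fun z hz => div_ne_zero (hp' z hz) (hq' z hz)) hno
  exact ⟨v, c, h1, h2⟩

theorem three_le_tE [Finite V] {E : Set (Sym2 V)} (hE : E ⊆ P.edgeSet) {F F' : Set ℂ}
    (hF : F ∈ faces (D.im E)) (hF' : F' ∈ faces (D.im E)) (hne : F ≠ F') :
    3 ≤ (D.tE E F).ncard ∧ ((D.tE E F).ncard = 3 → ∀ a ∈ D.tV E F, ∀ b ∈ D.tV E F, a ≠ b →
      P.Adj a b) := by
  classical
  obtain ⟨v, c, hc, hs⟩ := D.face_cycle hE hF hF' hne (D.tE_subset E F) subset_rfl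
  have hfin : (D.tE E F).Finite := Set.toFinite _
  have h1 : ((c.edges.toFinset : Finset (Sym2 V)) : Set (Sym2 V)) ⊆ D.tE E F := by
    intro e he
    exact hs e (by simpa using he)
  have h2 : c.edges.toFinset.card = c.length := by
    rw [List.toFinset_card_of_nodup hc.edges_nodup, SimpleGraph.Walk.length_edges]
  have h3 := Set.ncard_le_ncard h1 hfin
  rw [Set.ncard_coe_finset] at h3
  have h4 := hc.three_le_length
  refine ⟨by omega, fun h5 => ?_⟩
  have h6 := Set.eq_of_subset_of_ncard_le h1 (by rw [Set.ncard_coe_finset]; omega) hfin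
  have h7 : c.length = 3 := by omega
  unfold tV vs
  rw [← h6]
  rintro a ⟨e, he, ha⟩ b ⟨e', he', hb⟩ hab
  simp only [List.coe_toFinset, Set.mem_ofPred_eq] at he he'
  cases c with
  | nil => simp at h7
  | cons k1 c =>
  cases c with
  | nil => simp at h7
  | cons k2 c =>
  cases c with
  | nil => simp at h7
  | cons k3 c =>
  cases c with
  | cons k4 c => simp at h7
  | nil =>
  simp only [SimpleGraph.Walk.edges_cons, SimpleGraph.Walk.edges_nil, List.mem_cons,
    List.not_mem_nil, or_false] at he he'
  have := k1.symm
  have := k2.symm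
  have := k3.symm
  rcases he with rfl | rfl | rfl <;> rcases he' with rfl | rfl | rfl <;>
    rw [Sym2.mem_iff] at ha hb <;> rcases ha with rfl | rfl <;> rcases hb with rfl | rfl <;>
    first | assumption | exact absurd rfl hab

theorem sum_tE [Finite V] {E : Set (Sym2 V)} (hE : E ⊆ P.edgeSet) (T : Finset (Set ℂ))
    (hT : ∀ F ∈ T, F ∈ faces (D.im E)) : ∑ F ∈ T, (D.tE E F).ncard ≤ 2 * E.ncard := by
  classical
  have hfin : E.Finite := Set.toFinite _
  have h1 : ∀ F ∈ T, (D.tE E F).ncard = ∑ e ∈ hfin.toFinset, if D.touch F e then 1 else 0 := by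
    intro F _
    rw [← Finset.card_filter, ← Set.ncard_coe_finset]
    congr 1
    ext e
    simp [tE]
  rw [Finset.sum_congr rfl h1, Finset.sum_comm, Set.ncard_eq_toFinset_card E hfin, mul_comm,
    ← smul_eq_mul]
  refine Finset.sum_le_card_nsmul _ _ _ ?_
  intro e he
  rw [← Finset.card_filter]
  by_contra hcon
  push Not at hcon
  obtain ⟨a, b, c, ha, hb, hc, h1, h2, h3⟩ := Finset.two_lt_card_iff.1 hcon
  simp only [Finset.mem_filter] at ha hb hc
  exact D.edge_two_faces hE (hfin.mem_toFinset.1 he) (hT _ ha.1) (hT _ hb.1) (hT _ hc.1) ha.2 hb.2 hc.2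
    h1.symm h2.symm h3

theorem tV_ncard [Finite V] (E : Set (Sym2 V)) (F : Set ℂ) :
    (D.tV E F).ncard ≤ 2 * (D.tE E F).ncard := by
  classical
  have hfin : (D.tE E F).Finite := Set.toFinite _
  have : D.tV E F ⊆ ((hfin.toFinset.biUnion (fun e => e.toFinset) : Finset V) : Set V) := by
    rintro v ⟨e, he, hv⟩
    simp only [Finset.coe_biUnion, Set.mem_iUnion]
    exact ⟨e, by simpa using he, by simpa using hv⟩
  refine (Set.ncard_le_ncard this (Finset.finite_toSet _)).trans ?_
  rw [Set.ncard_coe_finset, Set.ncard_eq_toFinset_card _ hfin, mul_comm]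
  refine Finset.card_biUnion_le_card_mul _ _ _ ?_
  intro e _
  rw [Sym2.card_toFinset]
  split_ifs <;> omega

/-- near-triangulation structure -/
theorem near_tri [Fintype V] (c : ℕ) (hn : c + 1 ≤ Fintype.card V)
    (hm : 3 * Fintype.card V ≤ P.edgeSet.ncard + c) :
    (∀ F ∈ faces (D.im P.edgeSet), (D.tE P.edgeSet F).ncard ≤ c) ∧
    ∃ Z : Finset V, Z.card ≤ c * (2 * c) ∧ ∀ F ∈ faces (D.im P.edgeSet), ∀ a ∈ D.tV P.edgeSet F,
      ∀ b ∈ D.tV P.edgeSet F, a ≠ b → (a ∈ Z ∧ b ∈ Z) ∨ P.Adj a b := by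
  classical
  have : Nonempty V := Fintype.card_pos_iff.1 (by omega)
  set E := P.edgeSet with hEdef
  have hE : E ⊆ P.edgeSet := subset_rfl
  obtain ⟨S, hS, hc⟩ := D.euler_count
  rw [← hEdef] at hS hc
  have hS2 : 1 < S.card := by omega
  have h3 : ∀ F ∈ faces (D.im E), 3 ≤ (D.tE E F).ncard ∧ ((D.tE E F).ncard = 3 →
      ∀ a ∈ D.tV E F, ∀ b ∈ D.tV E F, a ≠ b → P.Adj a b) := by
    intro F hF
    obtain ⟨F', hF', hne⟩ := Finset.exists_mem_ne hS2 F
    exact D.three_le_tE hE hF (hS _ hF') hne.symm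
  have hA : ∀ T : Finset (Set ℂ), (∀ F ∈ T, F ∈ faces (D.im E)) → S ⊆ T →
      ∑ F ∈ T, ((D.tE E F).ncard - 3) + 3 ≤ c := by
    intro T hT hST
    have h4 := D.sum_tE hE T hT
    have h5 : ∑ F ∈ T, (D.tE E F).ncard = ∑ F ∈ T, ((D.tE E F).ncard - 3) + 3 * T.card := by
      rw [mul_comm, ← smul_eq_mul, ← Finset.sum_const, ← Finset.sum_add_distrib]
      refine Finset.sum_congr rfl fun F hF => ?_
      have := (h3 F (hT F hF)).1
      omega
    have h6 := Finset.card_le_card hST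
    omega
  have hB : ∀ F ∈ faces (D.im E), (D.tE E F).ncard ≤ c := by
    intro F hF
    have h4 := hA (insert F S) (by
      intro F' hF'
      rcases Finset.mem_insert.1 hF' with rfl | h
      · exact hF
      · exact hS _ h) (Finset.subset_insert _ _)
    have h5 := Finset.single_le_sum (f := fun F => (D.tE E F).ncard - 3) (fun _ _ => Nat.zero_le _)
      (Finset.mem_insert_self F S)
    omega
  refine ⟨hB, ?_⟩
  have hfin : (faces (D.im E)).Finite := by
    by_contra hinf
    obtain ⟨T, hT, hTc⟩ := (show (faces (D.im E)).Infinite from hinf).exists_subset_card_eq (2 * E.ncard + 1)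
    have h4 := D.sum_tE hE T (fun F hF => hT hF)
    have h5 := Finset.card_nsmul_le_sum T (fun F => (D.tE E F).ncard) 3
      (fun F hF => (h3 F (hT hF)).1)
    rw [hTc, smul_eq_mul] at h5
    omega
  set FF := hfin.toFinset
  set bad := FF.filter (fun F => 4 ≤ (D.tE E F).ncard) with hbad
  have hbc : bad.card ≤ c := by
    have h4 := hA FF (fun F hF => hfin.mem_toFinset.1 hF) (fun F hF => hfin.mem_toFinset.2 (hS F hF))
    have h5 : bad.card ≤ ∑ F ∈ FF, ((D.tE E F).ncard - 3) := by
      rw [hbad, Finset.card_filter]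
      refine Finset.sum_le_sum fun F _ => ?_
      split_ifs <;> omega
    omega
  refine ⟨bad.biUnion (fun F => (Set.toFinite (D.tV E F)).toFinset), ?_, ?_⟩
  · refine (Finset.card_biUnion_le_card_mul _ _ (2 * c) ?_).trans (Nat.mul_le_mul_right _ hbc)
    intro F hF
    rw [← Set.ncard_eq_toFinset_card]
    have := hB F (hfin.mem_toFinset.1 (Finset.mem_filter.1 hF).1)
    have := D.tV_ncard E F
    omega
  · intro F hF a ha b hb hab
    by_cases h4 : (D.tE E F).ncard = 3
    · exact Or.inr ((h3 F hF).2 h4 a ha b hb hab)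
    · left
      have h5 := (h3 F hF).1
      have hFb : F ∈ bad := by
        rw [hbad, Finset.mem_filter]
        exact ⟨hfin.mem_toFinset.2 hF, by omega⟩
      constructor <;> rw [Finset.mem_biUnion]
      · exact ⟨F, hFb, by simpa using ha⟩
      · exact ⟨F, hFb, by simpa using hb⟩

end PlaneDr

end

section


theorem ball_count {V : Type} [Finite V] (H : SimpleGraph V) (m : ℕ)
    (hH : ∀ v, (H.neighborSet v).ncard ≤ m) (u : V) (R : ℕ) :
    {w | H.edist u w ≤ R}.ncard ≤ (m + 1) ^ R := by
  classical
  induction R with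
  | zero =>
    have : {w | H.edist u w ≤ (0 : ℕ)} ⊆ {u} := by
      intro w hw
      simp only [Nat.cast_zero, nonpos_iff_eq_zero, Set.mem_ofPred_eq,
        SimpleGraph.edist_eq_zero_iff] at hw
      exact hw.symm
    simpa using Set.ncard_le_ncard this (Set.toFinite _)
  | succ R ih =>
    have hfin : {w | H.edist u w ≤ R}.Finite := Set.toFinite _
    have hsub : {w | H.edist u w ≤ (R + 1 : ℕ)} ⊆ ((hfin.toFinset.biUnion
        (fun x => insert x (Set.toFinite (H.neighborSet x)).toFinset) : Finset V) : Set V) := by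
      intro w hw
      have hne : H.edist u w ≠ ⊤ := ne_top_of_le_ne_top (ENat.natCast_ne_top _) hw
      obtain ⟨p, hp⟩ := SimpleGraph.exists_walk_of_edist_ne_top hne
      have hl : p.length ≤ R + 1 := by
        have : (p.length : ℕ∞) ≤ (R + 1 : ℕ) := hp.trans_le hw
        exact_mod_cast this
      simp only [Finset.coe_biUnion, Set.mem_iUnion, Finset.mem_coe, Finset.mem_insert,
        Set.Finite.mem_toFinset, exists_prop, Set.mem_ofPred_eq]
      cases h : p.reverse with
      | nil => exact ⟨u, by simp, Or.inl rfl⟩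
      | @cons _ x _ hx q =>
        refine ⟨x, ?_, Or.inr hx.symm⟩
        refine (SimpleGraph.Walk.edist_le q.reverse).trans ?_
        have h2 := congrArg SimpleGraph.Walk.length h
        simp only [SimpleGraph.Walk.length_reverse, SimpleGraph.Walk.length_cons] at h2 ⊢
        exact_mod_cast (by omega : q.length ≤ R)
    refine (Set.ncard_le_ncard hsub (Finset.finite_toSet _)).trans ?_
    rw [Set.ncard_coe_finset, pow_succ]
    refine (Finset.card_biUnion_le_card_mul _ _ (m + 1) ?_).trans (Nat.mul_le_mul_right _ ?_)
    · intro x _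
      refine (Finset.card_insert_le _ _).trans ?_
      rw [← Set.ncard_eq_toFinset_card]
      exact Nat.add_le_add_right (hH x) 1
    · rw [← Set.ncard_eq_toFinset_card]
      exact ih

theorem exists_far {V : Type} [Finite V] (H : SimpleGraph V) (m : ℕ)
    (hH : ∀ v, (H.neighborSet v).ncard ≤ m) (u : V) (R : ℕ) (A : Set V)
    (hA : (m + 1) ^ R < A.ncard) : ∃ w ∈ A, (R : ℕ∞) < H.edist u w := by
  by_contra hcon
  push Not at hcon
  have := Set.ncard_le_ncard (s := A) (t := {w | H.edist u w ≤ R}) hcon (Set.toFinite _)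
  have := ball_count H m hH u R
  omega

theorem edist_step {V : Type} (H : SimpleGraph V) (u a b : V) (h : a = b ∨ H.Adj a b) :
    H.edist u b ≤ H.edist u a + 1 := by
  rcases h with rfl | h
  · exact le_self_add
  · have := H.edist_triangle (u := u) (v := a) (w := b)
    rwa [SimpleGraph.edist_eq_one_iff_adj.2 h] at this

/-- bound for the star lemma -/
def starBound (m : ℕ) : ℕ → ℕ
  | 0 => 1
  | R + 1 => 1 + m * (R + 2) * starBound m R

theorem star_lemma {V : Type} [Finite V] (H : SimpleGraph V) (m R : ℕ) (ρ : V) (W : Set V)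
    (hm : 0 < m)
    (hW : ∀ w ∈ W, ∃ p : H.Walk w ρ, p.length ≤ R) (hc : starBound m R < W.ncard) :
    ∃ (x : V) (A : Finset V) (p : ∀ w : A, H.Walk w x), A.card = m ∧ (∀ w ∈ A, w ∈ W ∧ w ≠ x) ∧
      (∀ w, (p w).IsPath) ∧ ∀ w w', w ≠ w' → ∀ y ∈ (p w).support, y ∈ (p w').support → y = x := by
  classical
  induction R generalizing ρ W with
  | zero =>
    exfalso
    have : W ⊆ {ρ} := by
      intro w hw
      obtain ⟨p, hp⟩ := hW w hw
      exact SimpleGraph.Walk.eq_of_length_eq_zero (Nat.le_zero.1 hp)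
    have := Set.ncard_le_ncard this (Set.toFinite _)
    rw [Set.ncard_singleton] at this
    simp only [starBound] at hc
    omega
  | succ R ih =>
    have hW' : ∀ w : V, ∃ p : w ∈ W → H.Walk w ρ, ∀ h : w ∈ W, (p h).IsPath ∧ (p h).length ≤ R + 1 := by
      intro w
      by_cases h : w ∈ W
      · obtain ⟨p, hp⟩ := hW w h
        exact ⟨fun _ => p.bypass, fun _ => ⟨p.bypass_isPath, p.length_bypass_le_length.trans hp⟩⟩
      · exact ⟨fun h' => absurd h' h, fun h' => absurd h' h⟩
    choose p hp using hW'
    by_cases hlong : ∃ y, y ≠ ρ ∧ starBound m R < {w | ∃ h : w ∈ W, y ∈ (p w h).support}.ncard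
    · obtain ⟨y, hy, hyc⟩ := hlong
      obtain ⟨x, A, p', h1, h2, h3⟩ := ih y {w | ∃ h : w ∈ W, y ∈ (p w h).support} (by
        rintro w ⟨h, hw⟩
        refine ⟨(p w h).takeUntil y hw, ?_⟩
        have := SimpleGraph.Walk.length_takeUntil_lt_length hw hy
        have := (hp w h).2
        omega) hyc
      exact ⟨x, A, p', h1, fun w hw => ⟨(h2 w hw).1.1, (h2 w hw).2⟩, h3⟩
    push Not at hlong
    have main : ∀ k ≤ m, ∃ (A : Finset V) (hA : ∀ w ∈ A, w ∈ W), A.card = k ∧ (∀ w ∈ A, w ≠ ρ) ∧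
        ∀ w (hw : w ∈ A), ∀ w' (hw' : w' ∈ A), w ≠ w' →
          ∀ y ∈ (p w (hA w hw)).support, y ∈ (p w' (hA w' hw')).support → y = ρ := by
      intro k
      induction k with
      | zero => exact fun _ => ⟨∅, by simp, by simp, by simp, by simp⟩
      | succ k ihk =>
        intro hk
        obtain ⟨A, hA, hAc, hAρ, hAd⟩ := ihk (by omega)
        set U : Finset V := A.attach.biUnion (fun w => (p w (hA w w.2)).support.toFinset) with hU
        have hUc : U.card ≤ m * (R + 2) := by
          refine (Finset.card_biUnion_le_card_mul _ _ (R + 2) ?_).trans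
            (Nat.mul_le_mul_right _ (by rw [Finset.card_attach]; omega))
          intro w _
          refine (List.toFinset_card_le _).trans ?_
          rw [SimpleGraph.Walk.length_support]
          have := (hp w (hA w w.2)).2
          omega
        have hex : ∃ w, ∃ h : w ∈ W, w ≠ ρ ∧ ∀ y ∈ (p w h).support, y ∈ U → y = ρ := by
          by_contra hcon
          push Not at hcon
          have hsub : W ⊆ ((insert ρ ((U.erase ρ).biUnion (fun y =>
              (Set.toFinite {w | ∃ h : w ∈ W, y ∈ (p w h).support}).toFinset)) : Finset V) : Set V) := by
            intro w hw
            rw [Finset.coe_insert]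
            by_cases hwρ : w = ρ
            · exact Or.inl hwρ
            right
            obtain ⟨y, h1, h2, h3⟩ := hcon w hw hwρ
            rw [Finset.mem_coe, Finset.mem_biUnion]
            refine ⟨y, Finset.mem_erase.2 ⟨h3, h2⟩, ?_⟩
            rw [Set.Finite.mem_toFinset]
            exact ⟨hw, h1⟩
          have h1 := Set.ncard_le_ncard hsub (Finset.finite_toSet _)
          rw [Set.ncard_coe_finset] at h1
          have h2 := (h1.trans (Finset.card_insert_le _ _)).trans (Nat.add_le_add_right
            (Finset.card_biUnion_le_card_mul _ _ (starBound m R) (by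
              intro y hy
              rw [← Set.ncard_eq_toFinset_card]
              exact hlong y (Finset.ne_of_mem_erase hy))) 1)
          have h3 : (U.erase ρ).card * starBound m R ≤ m * (R + 2) * starBound m R :=
            Nat.mul_le_mul_right _ ((Finset.card_erase_le).trans hUc)
          simp only [starBound] at hc
          omega
        obtain ⟨w, hw, hwρ, hwU⟩ := hex
        have hUmem : ∀ w' (h : w' ∈ A), ∀ y ∈ (p w' (hA w' h)).support, y ∈ U := by
          intro w' h y hy
          rw [hU, Finset.mem_biUnion]
          exact ⟨⟨w', h⟩, Finset.mem_attach _ _, by simpa using hy⟩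
        have hwA : w ∉ A := fun h => hwρ (hwU w (SimpleGraph.Walk.start_mem_support _)
          (hUmem w h w (SimpleGraph.Walk.start_mem_support _)))
        refine ⟨insert w A, ?_, ?_, ?_, ?_⟩
        · intro w' h
          rcases Finset.mem_insert.1 h with rfl | h
          · exact hw
          · exact hA _ h
        · rw [Finset.card_insert_of_notMem hwA, hAc]
        · intro w' h
          rcases Finset.mem_insert.1 h with rfl | h
          · exact hwρ
          · exact hAρ _ h
        · intro w₁ h₁ w₂ h₂ hne y hy₁ hy₂
          rcases Finset.mem_insert.1 h₁ with rfl | h₁' <;> rcases Finset.mem_insert.1 h₂ with rfl | h₂'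
          · exact absurd rfl hne
          · exact hwU y hy₁ (hUmem _ h₂' y hy₂)
          · exact hwU y hy₂ (hUmem _ h₁' y hy₁)
          · exact hAd _ h₁' _ h₂' hne y hy₁ hy₂
    obtain ⟨A, hA, hAc, hAρ, hAd⟩ := main m le_rfl
    exact ⟨ρ, A, fun w => p w (hA w w.2), hAc, fun w hw => ⟨hA w hw, hAρ w hw⟩,
      fun w => (hp w _).1, fun w w' hne y h1 h2 => hAd w w.2 w' w'.2 (fun h => hne (Subtype.ext h)) y h1 h2⟩

namespace PlaneDr

variable {V : Type} {P : SimpleGraph V} (D : PlaneDr P)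

/-- the combinatorial form of the conclusion -/
def HasNest (t : ℕ) : Prop :=
  ∃ Y : Finset V, Y.card ≤ 2 ∧ ∃ C : Fin t → Set (Sym2 V),
    (∀ i, C i ⊆ P.edgeSet ∧ IsCyc P (C i)) ∧ (∀ i j, i ≠ j → Disjoint (C i) (C j)) ∧
    (∀ i j, i ≠ j → vs (C i) ∩ vs (C j) = Y) ∧
    ∀ i : ℕ, ∀ h : i + 1 < t, D.cim (C ⟨i + 1, h⟩) ⊆ creg (D.cim (C ⟨i, by omega⟩))

theorem key' [Finite V] {E : Set (Sym2 V)} (hE : E ⊆ P.edgeSet) (X : Finset V) (hX : X.card ≤ 2)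
    (hXe : ∀ e ∈ E, ∃ v ∈ e, v ∉ X) (d : V → ℕ∞)
    (hd : ∀ F ∈ faces (D.im E), ∀ a ∈ D.tV E F, ∀ b ∈ D.tV E F, a ∉ X → b ∉ X → d b ≤ d a + 1)
    {u w : V} {e₁ e₂ : Sym2 V} (he₁ : e₁ ∈ E) (he₂ : e₂ ∈ E) (hu : u ∈ e₁) (hw : w ∈ e₂)
    (huX : u ∉ X) (hwX : w ∉ X) (t : ℕ)
    (hdu : d u = 0) (hdw : ((8 * t + 1 : ℕ) : ℕ∞) < d w) : D.HasNest t := by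
  obtain ⟨Fp, hFp, hp⟩ := D.exists_touching hE he₁
  obtain ⟨Fq, hFq, hq⟩ := D.exists_touching hE he₂
  have hwq : w ∈ D.tV E Fq := ⟨e₂, ⟨he₂, hq⟩, hw⟩
  obtain ⟨Y, hY, C, h1, h2, h3, h4⟩ := D.key hE X hX hXe d hd hFp hFq
    ⟨u, ⟨e₁, ⟨he₁, hp⟩, hu⟩, huX, hdu⟩ t (by
      intro a ha haX
      have h5 := hd Fq hFq a ha w hwq haX hwX
      have h6 := hdw.trans_le h5
      by_contra h7
      push Not at h7
      refine absurd h6 (not_lt.2 ?_)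
      push_cast
      push_cast at h7
      gcongr)
  exact ⟨Y, (Finset.card_le_card hY).trans hX, C, fun i => ⟨(h1 i).1.trans hE, (h1 i).2⟩, h2, h3, h4⟩

/-- cofaciality graph -/
def cof (E : Set (Sym2 V)) (X : Finset V) : SimpleGraph V where
  Adj a b := a ≠ b ∧ (a ∉ X ∧ b ∉ X) ∧ ∃ F ∈ faces (D.im E), a ∈ D.tV E F ∧ b ∈ D.tV E F
  symm := ⟨fun _ _ h => ⟨h.1.symm, h.2.1.symm, by
    obtain ⟨F, h1, h2, h3⟩ := h.2.2
    exact ⟨F, h1, h3, h2⟩⟩⟩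
  loopless := ⟨fun _ h => h.1 rfl⟩

theorem key_cof [Finite V] {E : Set (Sym2 V)} (hE : E ⊆ P.edgeSet) (X : Finset V) (hX : X.card ≤ 1)
    {u w : V} {e₁ e₂ : Sym2 V} (he₁ : e₁ ∈ E) (he₂ : e₂ ∈ E) (hu : u ∈ e₁) (hw : w ∈ e₂)
    (huX : u ∉ X) (hwX : w ∉ X) (t : ℕ)
    (hdw : ((8 * t + 1 : ℕ) : ℕ∞) < (D.cof E X).edist u w) : D.HasNest t := by
  classical
  refine D.key' hE X (by omega) ?_ (fun a => (D.cof E X).edist u a) ?_ he₁ he₂ hu hw huX hwX t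
    (SimpleGraph.edist_self) hdw
  · intro e he
    induction e with
    | _ a b =>
    by_contra hcon
    push Not at hcon
    have h1 := hcon a (Sym2.mem_mk_left _ _)
    have h2 := hcon b (Sym2.mem_mk_right _ _)
    exact (hE he : P.Adj a b).ne (Finset.card_le_one.1 hX a h1 b h2)
  · intro F hF a ha b hb haX hbX
    refine edist_step _ u a b ?_
    by_cases hab : a = b
    · exact Or.inl hab
    · exact Or.inr ⟨hab, ⟨haX, hbX⟩, F, hF, ha, hb⟩

theorem case_low [Fintype V] (c Δ t : ℕ) (hn : c + 1 ≤ Fintype.card V)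
    (hm : 3 * Fintype.card V ≤ P.edgeSet.ncard + c) (hdeg : ∀ v, (P.neighborSet v).ncard ≤ Δ)
    (hbig : ((c * (2 * c) + Δ + 1) ^ (8 * t + 1)) ^ 2 + c < Fintype.card V) : D.HasNest t := by
  classical
  obtain ⟨-, Z, hZc, hZ⟩ := D.near_tri c hn hm
  set E := P.edgeSet with hEd
  set A : Set V := {v | ∃ e ∈ E, v ∈ e} with hA
  have hAc : E.ncard ≤ A.ncard ^ 2 := by
    have h1 : E ⊆ (fun p : V × V => s(p.1, p.2)) '' (A ×ˢ A) := by
      intro e he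
      induction e with
      | _ a b =>
      exact ⟨(a, b), ⟨⟨_, he, Sym2.mem_mk_left _ _⟩, ⟨_, he, Sym2.mem_mk_right _ _⟩⟩, rfl⟩
    refine (Set.ncard_le_ncard h1 (Set.toFinite _)).trans ((Set.ncard_image_le (Set.toFinite _)).trans ?_)
    rw [Set.ncard_prod, sq]
  have hAb : (c * (2 * c) + Δ + 1) ^ (8 * t + 1) < A.ncard := by
    by_contra hcon
    push Not at hcon
    have := Nat.pow_le_pow_left hcon 2
    omega
  have hne : A.Nonempty := Set.nonempty_of_ncard_ne_zero (by omega)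
  obtain ⟨u, e₁, he₁, hu⟩ := hne
  obtain ⟨w, ⟨e₂, he₂, hw⟩, hd⟩ := exists_far (D.cof E ∅) (c * (2 * c) + Δ) (by
    intro a
    have h1 : (D.cof E ∅).neighborSet a ⊆ (Z : Set V) ∪ P.neighborSet a := by
      rintro b ⟨h1, -, F, hF, ha, hb⟩
      rcases hZ F hF a ha b hb h1 with h | h
      · exact Or.inl h.2
      · exact Or.inr h
    refine (Set.ncard_le_ncard h1 (Set.toFinite _)).trans ((Set.ncard_union_le _ _).trans ?_)
    rw [Set.ncard_coe_finset]
    exact Nat.add_le_add hZc (hdeg a)) u (8 * t + 1) A hAb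
  exact D.key_cof (E := E) subset_rfl ∅ (by simp) he₁ he₂ hu hw (by simp) (by simp) t hd

end PlaneDr

end

section


theorem no_cycle_in_path {V : Type} {P : SimpleGraph V} {a b : V} (q : P.Walk a b) (hq : q.IsPath)
    {u : V} (c : P.Walk u u) (hc : c.IsCycle) (hs : ∀ e ∈ c.edges, e ∈ q.edges) : False := by
  classical
  induction q with
  | nil =>
    have h1 := hc.three_le_length
    rw [← SimpleGraph.Walk.length_edges] at h1
    obtain ⟨e, he⟩ := List.exists_mem_of_length_pos (l := c.edges) (by omega)
    simpa using hs e he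
  | @cons a y b h q ih =>
    rw [SimpleGraph.Walk.cons_isPath_iff] at hq
    have hz : ∀ z, s(a, z) ∈ c.edges → z = y := by
      intro z hz
      rcases List.mem_cons.1 (SimpleGraph.Walk.edges_cons h q ▸ hs _ hz) with h1 | h1
      · rw [Sym2.eq_iff] at h1
        rcases h1 with ⟨-, h1⟩ | ⟨h1, h2⟩
        · exact h1
        · exact h2.trans h1
      · exact absurd (q.fst_mem_support_of_mem_edges h1) hq.2
    by_cases ha : a ∈ c.support
    · have h1 := hc.ncard_neighborSet_toSubgraph_eq_two ha
      have h2 : c.toSubgraph.neighborSet a ⊆ {y} := by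
        intro z h3
        have : s(a, z) ∈ c.toSubgraph.edgeSet := h3
        exact hz z (by simpa [SimpleGraph.Walk.mem_edges_toSubgraph] using this)
      have h3 := Set.ncard_le_ncard h2 (Set.finite_singleton y)
      rw [Set.ncard_singleton] at h3
      omega
    · refine ih hq.1 (fun e he => ?_)
      rcases List.mem_cons.1 (SimpleGraph.Walk.edges_cons h q ▸ hs _ he) with h1 | h1
      · subst h1
        exact absurd (c.fst_mem_support_of_mem_edges he) ha
      · exact h1

namespace PlaneDr
variable {V : Type} {P : SimpleGraph V} (D : PlaneDr P)

theorem mem_cim_iff {E : Set (Sym2 V)} {z : ℂ} :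
    z ∈ D.cim E ↔ (∃ v ∈ vs E, D.vmap v = z) ∨ ∃ e ∈ E, z ∈ D.emap e := by
  constructor
  · intro h
    obtain ⟨e, he, h | ⟨v, hv, h⟩⟩ := mem_iUnion₂.1 h
    · exact Or.inr ⟨e, he, h⟩
    · exact Or.inl ⟨v, ⟨e, he, hv⟩, h⟩
  · rintro (⟨v, ⟨e, he, hv⟩, rfl⟩ | ⟨e, he, h⟩)
    · exact mem_iUnion₂.2 ⟨e, he, D.vmap_mem_cl hv⟩
    · exact mem_iUnion₂.2 ⟨e, he, D.emap_subset_cl _ h⟩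

theorem vmap_mem_cim {E : Set (Sym2 V)} (hE : E ⊆ P.edgeSet) {v : V} (h : D.vmap v ∈ D.cim E) :
    v ∈ vs E := by
  rcases D.mem_cim_iff.1 h with ⟨u, hu, h⟩ | ⟨e, he, h⟩
  · rwa [← D.inj h]
  · exact absurd h (D.avoid e (hE he) v)

theorem emap_not_cim {E : Set (Sym2 V)} (hE : E ⊆ P.edgeSet) {e : Sym2 V} (he : e ∈ P.edgeSet)
    {z : ℂ} (hz : z ∈ D.emap e) (h : z ∈ D.cim E) : e ∈ E := by
  by_contra hcon
  exact D.emap_disj_im hE he hcon hz (D.cim_subset_im E h)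

theorem edges_sub {a b : V} (q : P.Walk a b) : {e | e ∈ q.edges} ⊆ P.edgeSet :=
  fun _ he => q.edges_subset_edgeSet he

theorem vs_edges_sub {a b : V} (q : P.Walk a b) {y : V} (hy : y ∈ vs {e | e ∈ q.edges}) :
    y ∈ q.support := by
  obtain ⟨e, he, hy⟩ := hy
  exact q.mem_support_of_mem_edges he hy

theorem edges_cons_eq {a y b : V} (h : P.Adj a y) (q : P.Walk y b) :
    {e | e ∈ (SimpleGraph.Walk.cons h q).edges} = insert s(a, y) {e | e ∈ q.edges} := by
  ext e; simp

variable [Finite V]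

theorem path_hasLog {a b : V} (q : P.Walk a b) (hq : q.IsPath) {g : ℂ → ℂ}
    (hg : ContinuousOn g (D.cim {e | e ∈ q.edges}))
    (h0 : ∀ z ∈ D.cim {e | e ∈ q.edges}, g z ≠ 0) : HasLog (D.cim {e | e ∈ q.edges}) g := by
  induction q with
  | nil =>
    refine ⟨fun _ => 0, by fun_prop, ?_⟩
    intro z hz
    simp [cim] at hz
  | @cons a y b h q ih =>
    rw [SimpleGraph.Walk.cons_isPath_iff] at hq
    rw [edges_cons_eq, cim_insert] at hg h0 ⊢
    have he : s(a, y) ∈ P.edgeSet := h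
    obtain ⟨α, hα, eα⟩ := D.cl_hasLog he (hg.mono subset_union_left) (fun z hz => h0 z (Or.inl hz))
    obtain ⟨β, hβ, eβ⟩ := ih hq.1 (hg.mono subset_union_right) (fun z hz => h0 z (Or.inr hz))
    by_cases hy : D.vmap y ∈ D.cim {e | e ∈ q.edges}
    · have hyl : D.vmap y ∈ D.cl s(a, y) := D.vmap_mem_cl (Sym2.mem_mk_right _ _)
      refine hasLog_glue (D.cl_compact he).isClosed (D.cim_compact (edges_sub q)).isClosed hα hβ eα eβ
        (c := α (D.vmap y) - β (D.vmap y)) ?_ ?_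
      · rw [Complex.exp_sub, eα _ hyl, eβ _ hy, div_self (h0 _ (Or.inl hyl))]
      · intro z hz1 hz2
        have : z = D.vmap y := by
          rcases hz1 with hz1 | ⟨v, hv, rfl⟩
          · have := D.emap_not_cim (edges_sub q) he hz1 hz2
            exact absurd (q.fst_mem_support_of_mem_edges this) hq.2
          · have h2 := vs_edges_sub q (D.vmap_mem_cim (edges_sub q) hz2)
            rcases Sym2.mem_iff.1 hv with rfl | rfl
            · exact absurd h2 hq.2
            · rfl
        rw [this]; ring
    · refine hasLog_glue (D.cl_compact he).isClosed (D.cim_compact (edges_sub q)).isClosed hα hβ eα eβ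
        (c := 0) (by simp) ?_
      intro z hz1 hz2
      exfalso
      rcases hz1 with hz1 | ⟨v, hv, rfl⟩
      · have := D.emap_not_cim (edges_sub q) he hz1 hz2
        exact absurd (q.fst_mem_support_of_mem_edges this) hq.2
      · have h2 := vs_edges_sub q (D.vmap_mem_cim (edges_sub q) hz2)
        rcases Sym2.mem_iff.1 hv with rfl | rfl
        · exact absurd h2 hq.2
        · exact hy hz2

theorem cl_minus {a y : V} (h : P.Adj a y) : IsPreconnected (D.cl s(a, y) \ {D.vmap a}) := by
  have he : s(a, y) ∈ P.edgeSet := h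
  refine (D.emap_preconnected he).subset_closure ?_ (sdiff_subset.trans (D.cl_subset_closure he))
  intro z hz
  exact ⟨D.emap_subset_cl _ hz, fun hza => D.avoid _ he a (by rwa [mem_singleton_iff.1 hza] at hz)⟩

theorem hop {a b : V} (q : P.Walk a b) (hq : q.IsPath) (hab : a ≠ b) :
    IsPreconnected (D.cim {e | e ∈ q.edges} \ {D.vmap b}) ∧
      D.vmap a ∈ D.cim {e | e ∈ q.edges} \ {D.vmap b} := by
  induction q with
  | nil => exact absurd rfl hab
  | @cons a y b h q ih =>
    rw [SimpleGraph.Walk.cons_isPath_iff] at hq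
    have he : s(a, y) ∈ P.edgeSet := h
    rw [edges_cons_eq, cim_insert]
    refine ⟨?_, Or.inl (D.vmap_mem_cl (Sym2.mem_mk_left _ _)), fun hh => hab (D.inj hh)⟩
    by_cases hy : y = b
    · subst hy
      have hnil := SimpleGraph.Walk.nil_iff_eq_nil.1 (SimpleGraph.Walk.isPath_iff_nil.1 hq.1)
      subst hnil
      have := D.cl_minus h.symm
      rw [Sym2.eq_swap] at this
      simpa [cim] using this
    · obtain ⟨h1, h2⟩ := ih hq.1 hy
      have h3 : D.vmap b ∉ D.cl s(a, y) := by
        rintro (h4 | ⟨v, hv, h4⟩)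
        · exact D.avoid _ he _ h4
        · have := D.inj h4
          subst this
          rcases Sym2.mem_iff.1 hv with rfl | rfl
          · exact hab rfl
          · exact hy rfl
      rw [union_sdiff_distrib, sdiff_singleton_eq_self h3]
      exact IsPreconnected.union (D.vmap y) (D.vmap_mem_cl (Sym2.mem_mk_right _ _)) h2
        (D.cl_preconnected he) h1

end PlaneDr

/-- internally disjoint paths from `v` to `x` -/
structure Theta {V : Type} (P : SimpleGraph V) (ι : Type) where
  v : V
  x : V
  w : ι → V
  adj : ∀ i, P.Adj v (w i)
  p : ∀ i, P.Walk (w i) x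
  path : ∀ i, (p i).IsPath
  hv : ∀ i, v ∉ (p i).support
  hw : ∀ i, w i ≠ x
  disj : ∀ i j, i ≠ j → ∀ y ∈ (p i).support, y ∈ (p j).support → y = x

namespace Theta
variable {V : Type} {P : SimpleGraph V} {ι : Type} (Θ : Theta P ι)

/-- the path -/
def q (i : ι) : P.Walk Θ.v Θ.x := .cons (Θ.adj i) (Θ.p i)

/-- edges of the path -/
def E (i : ι) : Set (Sym2 V) := {e | e ∈ (Θ.q i).edges}

/-- all edges -/
def U : Set (Sym2 V) := ⋃ i, Θ.E i

theorem q_path (i : ι) : (Θ.q i).IsPath := (SimpleGraph.Walk.cons_isPath_iff _ _).2 ⟨Θ.path i, Θ.hv i⟩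

theorem E_sub (i : ι) : Θ.E i ⊆ P.edgeSet := PlaneDr.edges_sub _

theorem U_sub : Θ.U ⊆ P.edgeSet := iUnion_subset Θ.E_sub

theorem E_sub_U (i : ι) : Θ.E i ⊆ Θ.U := subset_iUnion _ i

theorem E_eq (i : ι) : Θ.E i = insert s(Θ.v, Θ.w i) {e | e ∈ (Θ.p i).edges} :=
  PlaneDr.edges_cons_eq _ _

theorem first_mem (i : ι) : s(Θ.v, Θ.w i) ∈ Θ.E i := by rw [E_eq]; exact mem_insert _ _

theorem supp {i : ι} {a : V} (ha : a ∈ vs (Θ.E i)) (hav : a ≠ Θ.v) : a ∈ (Θ.p i).support := by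
  have := PlaneDr.vs_edges_sub (Θ.q i) ha
  rw [q, SimpleGraph.Walk.support_cons, List.mem_cons] at this
  exact this.resolve_left hav

theorem internal {i : ι} {e : Sym2 V} (he : e ∈ Θ.E i) : ∃ a ∈ e, a ≠ Θ.v ∧ a ≠ Θ.x := by
  rw [E_eq] at he
  rcases he with rfl | he
  · exact ⟨Θ.w i, Sym2.mem_mk_right _ _, (Θ.adj i).ne', Θ.hw i⟩
  · induction e with
    | _ a b =>
    have hab : P.Adj a b := (Θ.p i).edges_subset_edgeSet he
    have ha : a ≠ Θ.v := fun h => Θ.hv i (h ▸ (Θ.p i).fst_mem_support_of_mem_edges he)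
    have hb : b ≠ Θ.v := fun h => Θ.hv i (h ▸ (Θ.p i).snd_mem_support_of_mem_edges he)
    by_cases hax : a = Θ.x
    · exact ⟨b, Sym2.mem_mk_right _ _, hb, fun h => hab.ne (hax.trans h.symm)⟩
    · exact ⟨a, Sym2.mem_mk_left _ _, ha, hax⟩

theorem uniq {i j : ι} {a : V} (hi : a ∈ vs (Θ.E i)) (hj : a ∈ vs (Θ.E j)) (hav : a ≠ Θ.v)
    (hax : a ≠ Θ.x) : i = j := by
  by_contra hij
  exact hax (Θ.disj i j hij a (Θ.supp hi hav) (Θ.supp hj hav))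

theorem E_uniq {i j : ι} {e : Sym2 V} (hi : e ∈ Θ.E i) (hj : e ∈ Θ.E j) : i = j := by
  obtain ⟨a, ha, h1, h2⟩ := Θ.internal hi
  exact Θ.uniq ⟨e, hi, ha⟩ ⟨e, hj, ha⟩ h1 h2

variable [Finite V] (D : PlaneDr P)

/-- face touches path -/
def tp (F : Set ℂ) (i : ι) : Prop := ∃ e ∈ Θ.E i, D.touch F e

theorem path_two {i : ι} {F₁ F₂ F₃ : Set ℂ} (h₁ : F₁ ∈ faces (D.im Θ.U)) (h₂ : F₂ ∈ faces (D.im Θ.U))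
    (h₃ : F₃ ∈ faces (D.im Θ.U)) (t₁ : Θ.tp D F₁ i) (t₂ : Θ.tp D F₂ i) (t₃ : Θ.tp D F₃ i)
    (n₁₂ : F₂ ≠ F₁) (n₁₃ : F₃ ≠ F₁) (n₂₃ : F₂ ≠ F₃) : False := by
  set K : Set ℂ := D.vmap '' {y | y ∉ vs (Θ.E i) ∨ y = Θ.v ∨ y = Θ.x} ∪ D.cim (Θ.U \ Θ.E i) with hK
  have hU' : Θ.U \ Θ.E i ⊆ P.edgeSet := sdiff_subset.trans Θ.U_sub
  have hKB : D.im Θ.U = K ∪ D.cim (Θ.E i) := by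
    ext z
    constructor
    · rintro (⟨y, rfl⟩ | h)
      · by_cases hy : y ∈ vs (Θ.E i)
        · right
          exact D.mem_cim_iff.2 (Or.inl ⟨y, hy, rfl⟩)
        · left; left
          exact ⟨y, Or.inl hy, rfl⟩
      · obtain ⟨e, he, h⟩ := mem_iUnion₂.1 h
        by_cases hei : e ∈ Θ.E i
        · exact Or.inr (D.cl_subset_cim hei h)
        · exact Or.inl (Or.inr (D.cl_subset_cim (show e ∈ Θ.U \ Θ.E i from ⟨he, hei⟩) h))
    · rintro ((⟨y, -, rfl⟩ | h) | h)
      · exact D.vmap_mem_im _ _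
      · exact D.cim_subset_im _ (D.cim_mono sdiff_subset h)
      · exact D.cim_subset_im _ (D.cim_mono (Θ.E_sub_U i) h)
  rw [hKB] at h₁ h₂ h₃
  have hcap : ∀ z ∈ K, z ∈ D.cim (Θ.E i) → z = D.vmap Θ.v ∨ z = D.vmap Θ.x := by
    intro z hzK hzB
    rcases D.mem_cim_iff.1 hzB with ⟨y, hy, rfl⟩ | ⟨e, he, hz⟩
    · by_contra hcon
      push Not at hcon
      have hyv : y ≠ Θ.v := fun h => hcon.1 (by rw [h])
      have hyx : y ≠ Θ.x := fun h => hcon.2 (by rw [h])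
      rcases hzK with ⟨y', hy', h⟩ | h
      · have := D.inj h
        subst this
        rcases hy' with h | h | h
        · exact h hy
        · exact hyv h
        · exact hyx h
      · obtain ⟨e, ⟨he, hei⟩, hye⟩ := D.vmap_mem_cim hU' h
        obtain ⟨j, hj⟩ := mem_iUnion.1 he
        have := Θ.uniq hy ⟨e, hj, hye⟩ hyv hyx
        subst this
        exact hei hj
    · exfalso
      rcases hzK with ⟨y', hy', rfl⟩ | h
      · exact D.avoid e (Θ.E_sub i he) _ hz
      · exact (D.emap_not_cim hU' (Θ.E_sub i he) hz h).2 he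
  have hB' : IsPreconnected ((D.cl s(Θ.v, Θ.w i) \ {D.vmap Θ.v}) ∪
      (D.cim {e | e ∈ (Θ.p i).edges} \ {D.vmap Θ.x})) := by
    obtain ⟨h1, h2⟩ := D.hop (Θ.p i) (Θ.path i) (Θ.hw i)
    exact IsPreconnected.union (D.vmap (Θ.w i)) ⟨D.vmap_mem_cl (Sym2.mem_mk_right _ _),
      fun h => (Θ.adj i).ne' (D.inj h)⟩ h2 (D.cl_minus (Θ.adj i)) h1
  have hemap : ∀ e ∈ Θ.E i, D.emap e ⊆ (D.cl s(Θ.v, Θ.w i) \ {D.vmap Θ.v}) ∪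
      (D.cim {e | e ∈ (Θ.p i).edges} \ {D.vmap Θ.x}) := by
    intro e he z hz
    have hav : ∀ u, z ≠ D.vmap u := fun u h => D.avoid e (Θ.E_sub i he) u (h ▸ hz)
    rw [E_eq] at he
    rcases he with rfl | he
    · exact Or.inl ⟨D.emap_subset_cl _ hz, hav _⟩
    · exact Or.inr ⟨D.mem_cim_iff.2 (Or.inr ⟨e, he, hz⟩), hav _⟩
  have htt : ∀ F, Θ.tp D F i → (closure F ∩ ((D.cl s(Θ.v, Θ.w i) \ {D.vmap Θ.v}) ∪
      (D.cim {e | e ∈ (Θ.p i).edges} \ {D.vmap Θ.x}))).Nonempty := by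
    rintro F ⟨e, he, z, hz1, hz2⟩
    exact ⟨z, hz1, hemap e he hz2⟩
  refine PlaneDr.two_faces (a := D.vmap Θ.v) (b := D.vmap Θ.x) (K := K) (B := D.cim (Θ.E i)) ?_
    (D.cim_compact (Θ.E_sub i)) (fun g hg h0 => D.path_hasLog (Θ.q i) (Θ.q_path i) hg h0) ?_ hB' ?_
    h₁ h₂ h₃ (htt _ t₁) (htt _ t₂) (htt _ t₃) n₁₂ n₁₃ n₂₃
  · exact ((Set.toFinite _).isCompact).union (D.cim_compact hU')
  · rintro z ⟨h1, h2⟩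
    exact hcap z h1 h2
  · intro z hz hzK
    rcases hz with ⟨hz1, hz2⟩ | ⟨hz1, hz2⟩
    · have hzB : z ∈ D.cim (Θ.E i) := D.cl_subset_cim (Θ.first_mem i) hz1
      rcases hcap z hzK hzB with h | h
      · exact hz2 h
      · subst h
        rcases hz1 with h | ⟨u, hu, h⟩
        · exact D.avoid _ (Θ.E_sub i (Θ.first_mem i)) _ h
        · have := D.inj h
          subst this
          rcases Sym2.mem_iff.1 hu with h | h
          · exact hz2 (by rw [h]; rfl)
          · exact Θ.hw i h.symm
    · have hzB : z ∈ D.cim (Θ.E i) := by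
        rw [E_eq, PlaneDr.cim_insert]
        exact Or.inr hz1
      rcases hcap z hzK hzB with h | h
      · subst h
        exact Θ.hv i (PlaneDr.vs_edges_sub _ (D.vmap_mem_cim (PlaneDr.edges_sub _) hz1))
      · exact hz2 h

theorem face_two {F F' : Set ℂ} (hF : F ∈ faces (D.im Θ.U)) (hF' : F' ∈ faces (D.im Θ.U))
    (hne : F ≠ F') (i₀ : ι) : ∃ i j, i ≠ j ∧ Θ.tp D F i ∧ Θ.tp D F j := by
  have h1 : ∀ i, ∃ j, j ≠ i ∧ Θ.tp D F j := by
    intro i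
    by_contra hcon
    push Not at hcon
    obtain ⟨u, c, hc, hs⟩ := D.face_cycle Θ.U_sub hF hF' hne (Θ.E_sub_U i) (by
      rintro e ⟨he, ht⟩
      obtain ⟨j, hj⟩ := mem_iUnion.1 he
      by_cases hji : j = i
      · exact hji ▸ hj
      · exact absurd ⟨e, hj, ht⟩ (hcon j hji))
    exact no_cycle_in_path (Θ.q i) (Θ.q_path i) c hc hs
  obtain ⟨i, -, hi⟩ := h1 i₀
  obtain ⟨j, hj, hj'⟩ := h1 i
  exact ⟨i, j, hj.symm, hi, hj'⟩

theorem face_count [Fintype ι] (i₀ : ι) :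
    ∃ S : Finset (Set ℂ), (∀ F ∈ S, F ∈ faces (D.im Θ.U)) ∧ Fintype.card ι ≤ S.card := by
  classical
  set T : Finset (Sym2 V) := (Finset.univ.erase i₀).image (fun i => s(Θ.v, Θ.w i)) with hT
  have hTc : T.card = Fintype.card ι - 1 := by
    rw [hT, Finset.card_image_of_injOn, Finset.card_erase_of_mem (Finset.mem_univ _), Finset.card_univ]
    intro i _ j _ hij
    exact Θ.E_uniq (Θ.first_mem i) (by simp only at hij; rw [hij]; exact Θ.first_mem j)
  have hTm : ∀ e ∈ T, ∃ i, i ≠ i₀ ∧ s(Θ.v, Θ.w i) = e := by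
    intro e he
    obtain ⟨i, hi, rfl⟩ := Finset.mem_image.1 he
    exact ⟨i, Finset.ne_of_mem_erase hi, rfl⟩
  have hTU : (T : Set (Sym2 V)) ⊆ Θ.U := by
    intro e he
    obtain ⟨i, -, rfl⟩ := hTm e he
    exact Θ.E_sub_U i (Θ.first_mem i)
  obtain ⟨S, hS, hc⟩ := D.euler_lower (E₀ := Θ.U \ T) (sdiff_subset.trans Θ.U_sub) T (by
    intro e he
    refine ⟨fun h => h.2 he, ?_⟩
    obtain ⟨i, hi, rfl⟩ := hTm e he
    refine ⟨Θ.v, Θ.w i, Θ.adj i, rfl, (Θ.q i₀).append (Θ.p i).reverse, ?_⟩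
    intro e he
    rw [SimpleGraph.Walk.edges_append, List.mem_append, SimpleGraph.Walk.edges_reverse,
      List.mem_reverse] at he
    rcases he with he | he
    · refine ⟨Θ.E_sub_U i₀ he, fun h => ?_⟩
      obtain ⟨j, hj, rfl⟩ := hTm e h
      exact hj (Θ.E_uniq (Θ.first_mem j) he)
    · refine ⟨Θ.E_sub_U i (by rw [E_eq]; exact Or.inr he), fun h => ?_⟩
      obtain ⟨j, hj, rfl⟩ := hTm e h
      exact Θ.hv i ((Θ.p i).fst_mem_support_of_mem_edges he))
  rw [sdiff_union_of_subset hTU] at hS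
  exact ⟨S, hS, by omega⟩

theorem face_le_two [Fintype ι] (hι : 2 ≤ Fintype.card ι) {F : Set ℂ} (hF : F ∈ faces (D.im Θ.U))
    {i j k : ι} (hi : Θ.tp D F i) (hj : Θ.tp D F j) (hk : Θ.tp D F k) (hij : i ≠ j) (hik : i ≠ k)
    (hjk : j ≠ k) : False := by
  classical
  obtain ⟨S, hS, hc⟩ := Θ.face_count D i
  set T := insert F S with hTd
  have hT : ∀ F ∈ T, F ∈ faces (D.im Θ.U) := by
    intro F' hF'
    rcases Finset.mem_insert.1 hF' with rfl | h
    · exact hF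
    · exact hS _ h
  have hTc : S.card ≤ T.card := Finset.card_le_card (Finset.subset_insert _ _)
  have h1 : ∑ F ∈ T, (Finset.univ.filter (Θ.tp D F)).card ≤ 2 * Fintype.card ι := by
    simp only [Finset.card_filter]
    rw [Finset.sum_comm, mul_comm, ← smul_eq_mul, ← Finset.card_univ]
    refine Finset.sum_le_card_nsmul _ _ _ ?_
    intro e _
    rw [← Finset.card_filter]
    by_contra hcon
    push Not at hcon
    obtain ⟨a, b, c, ha, hb, hc, h1, h2, h3⟩ := Finset.two_lt_card_iff.1 hcon
    simp only [Finset.mem_filter] at ha hb hc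
    exact Θ.path_two D (hT _ ha.1) (hT _ hb.1) (hT _ hc.1) ha.2 hb.2 hc.2 h1.symm h2.symm h3
  have h2 : ∑ F ∈ T, 2 < ∑ F ∈ T, (Finset.univ.filter (Θ.tp D F)).card := by
    refine Finset.sum_lt_sum ?_ ⟨F, Finset.mem_insert_self _ _, ?_⟩
    · intro F' hF'
      obtain ⟨F'', hF'', hne⟩ := Finset.exists_mem_ne (by omega : 1 < T.card) F'
      obtain ⟨a, b, hab, ha, hb⟩ := Θ.face_two D (hT _ hF') (hT _ hF'') hne.symm i
      exact Finset.one_lt_card.2 ⟨a, by simpa using ha, b, by simpa using hb, hab⟩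
    · exact Finset.two_lt_card_iff.2 ⟨i, j, k, by simpa using hi, by simpa using hj, by simpa using hk,
        hij, hik, hjk⟩
  rw [Finset.sum_const, smul_eq_mul] at h2
  omega

/-- adjacency of paths -/
def pg : SimpleGraph ι where
  Adj i j := i ≠ j ∧ ∃ F ∈ faces (D.im Θ.U), Θ.tp D F i ∧ Θ.tp D F j
  symm := ⟨fun _ _ h => ⟨h.1.symm, by
    obtain ⟨F, h1, h2, h3⟩ := h.2
    exact ⟨F, h1, h3, h2⟩⟩⟩
  loopless := ⟨fun _ h => h.1 rfl⟩

theorem pg_deg [Fintype ι] (hι : 2 ≤ Fintype.card ι) (i : ι) :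
    ((Θ.pg D).neighborSet i).ncard ≤ 2 := by
  by_contra hcon
  push Not at hcon
  obtain ⟨a, ⟨hia, F₁, f₁, i₁, t₁⟩, b, ⟨hib, F₂, f₂, i₂, t₂⟩, c, ⟨hic, F₃, f₃, i₃, t₃⟩, hab, hac, hbc⟩ :=
    (Set.two_lt_ncard (Set.toFinite _)).1 hcon
  refine Θ.path_two D f₁ f₂ f₃ i₁ i₂ i₃ ?_ ?_ ?_
  · rintro rfl
    exact Θ.face_le_two D hι f₁ i₁ t₁ t₂ hia hib hab
  · rintro rfl
    exact Θ.face_le_two D hι f₁ i₁ t₁ t₃ hia hic hac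
  · rintro rfl
    exact Θ.face_le_two D hι f₂ i₂ t₂ t₃ hib hic hbc

theorem hasNest [Fintype ι] (Θ : Theta P ι) (D : PlaneDr P) (t : ℕ) (hι : 3 ^ (8 * t + 1) < Fintype.card ι) : D.HasNest t := by
  classical
  have h2 : 2 ≤ Fintype.card ι := by
    have := Nat.one_le_pow (8 * t + 1) 3 (by norm_num)
    omega
  have hne : Nonempty ι := Fintype.card_pos_iff.1 (by omega)
  obtain ⟨i₀⟩ := hne
  obtain ⟨j, -, hj⟩ := exists_far (Θ.pg D) 2 (Θ.pg_deg D h2) i₀ (8 * t + 1) Set.univ (by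
    rw [Set.ncard_univ, Nat.card_eq_fintype_card]; exact hι)
  let idx : V → ι := fun a => if h : ∃ i, a ∈ vs (Θ.E i) then h.choose else i₀
  have hidx : ∀ i a, a ∈ vs (Θ.E i) → a ∉ ({Θ.v, Θ.x} : Finset V) → idx a = i := by
    intro i a ha hax
    simp only [Finset.mem_insert, Finset.mem_singleton, not_or] at hax
    have h : ∃ i, a ∈ vs (Θ.E i) := ⟨i, ha⟩
    have : idx a = h.choose := dif_pos h
    rw [this]
    exact Θ.uniq h.choose_spec ha hax.1 hax.2
  have hwm : ∀ i, Θ.w i ∈ vs (Θ.E i) := fun i => ⟨_, Θ.first_mem i, Sym2.mem_mk_right _ _⟩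
  have hwx : ∀ i, Θ.w i ∉ ({Θ.v, Θ.x} : Finset V) := by
    intro i
    simp only [Finset.mem_insert, Finset.mem_singleton, not_or]
    exact ⟨(Θ.adj i).ne', Θ.hw i⟩
  refine D.key' Θ.U_sub {Θ.v, Θ.x} Finset.card_le_two ?_ (fun a => (Θ.pg D).edist i₀ (idx a)) ?_
    (Θ.E_sub_U i₀ (Θ.first_mem i₀)) (Θ.E_sub_U j (Θ.first_mem j)) (Sym2.mem_mk_right _ _)
    (Sym2.mem_mk_right _ _) (hwx i₀) (hwx j) t ?_ ?_
  · intro e he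
    obtain ⟨i, hi⟩ := mem_iUnion.1 he
    obtain ⟨a, ha, h1, h2⟩ := Θ.internal hi
    exact ⟨a, ha, by simp [h1, h2]⟩
  · rintro F hF a ⟨e, ⟨he, het⟩, hae⟩ b ⟨e', ⟨he', het'⟩, hbe⟩ haX hbX
    obtain ⟨i, hi⟩ := mem_iUnion.1 he
    obtain ⟨k, hk⟩ := mem_iUnion.1 he'
    rw [hidx i a ⟨e, hi, hae⟩ haX, hidx k b ⟨e', hk, hbe⟩ hbX]
    refine edist_step _ _ _ _ ?_
    by_cases hik : i = k
    · exact Or.inl hik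
    · exact Or.inr ⟨hik, F, hF, ⟨e, hi, het⟩, ⟨e', hk, het'⟩⟩
  · rw [hidx i₀ _ (hwm i₀) (hwx i₀)]
    exact SimpleGraph.edist_self
  · rw [hidx j _ (hwm j) (hwx j)]
    exact hj

end Theta

end

section

namespace PlaneDr
variable {V : Type} {P : SimpleGraph V} (D : PlaneDr P)

/-- isolate a vertex -/
def iso (P : SimpleGraph V) (v : V) : SimpleGraph V where
  Adj a b := P.Adj a b ∧ a ≠ v ∧ b ≠ v
  symm := ⟨fun _ _ h => ⟨h.1.symm, h.2.2, h.2.1⟩⟩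
  loopless := ⟨fun _ h => h.1.ne rfl⟩

theorem iso_le (P : SimpleGraph V) (v : V) : iso P v ≤ P := fun _ _ h => h.1

theorem iso_support {v a b : V} (p : (iso P v).Walk a b) (ha : a ≠ v) : v ∉ p.support := by
  induction p with
  | nil => simpa using ha.symm
  | cons h p ih =>
    rw [SimpleGraph.Walk.support_cons, List.mem_cons, not_or]
    exact ⟨ha.symm, ih h.2.2⟩

theorem case_high [Fintype V] (c t : ℕ) (hn : c + 1 ≤ Fintype.card V)
    (hm : 3 * Fintype.card V ≤ P.edgeSet.ncard + c) (v : V)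
    (hdeg : (c * (2 * c) + 1) * starBound (3 ^ (8 * t + 1) + 1) (8 * t + 1) < (P.neighborSet v).ncard) :
    D.HasNest t := by
  classical
  obtain ⟨-, Z, hZc, hZ⟩ := D.near_tri c hn hm
  obtain ⟨u, hu⟩ : (P.neighborSet v).Nonempty := Set.nonempty_of_ncard_ne_zero (by omega)
  have huv : P.Adj v u := hu
  by_cases hfar : ∃ w ∈ P.neighborSet v, ((8 * t + 1 : ℕ) : ℕ∞) < (D.cof P.edgeSet {v}).edist u w
  · obtain ⟨w, hw, hd⟩ := hfar
    have hwv : P.Adj v w := hw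
    exact D.key_cof (E := P.edgeSet) subset_rfl {v} (by simp) (e₁ := s(v, u)) (e₂ := s(v, w)) huv hwv
      (Sym2.mem_mk_right _ _) (Sym2.mem_mk_right _ _) (by simpa using huv.ne')
      (by simpa using hwv.ne') t hd
  push Not at hfar
  have hwalk : ∀ w, ∀ q : (D.cof P.edgeSet {v}).Walk w u,
      ∃ ρ ∈ insert u Z, ∃ p : (iso P v).Walk w ρ, p.length ≤ q.length := by
    intro w q
    induction q with
    | nil => exact ⟨_, Finset.mem_insert_self _ _, .nil, le_rfl⟩
    | @cons a y b h q ih =>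
      obtain ⟨hay, ⟨ha, hy⟩, F, hF, haF, hyF⟩ := h
      rcases hZ F hF a haF y hyF hay with h1 | h1
      · exact ⟨a, Finset.mem_insert_of_mem h1.1, .nil, by simp⟩
      · obtain ⟨ρ, hρ, p, hp⟩ := ih hu huv hfar
        refine ⟨ρ, hρ, .cons (show (iso P v).Adj a y from ⟨h1, by simpa using ha, by simpa using hy⟩) p, ?_⟩ 
        exact Nat.succ_le_succ hp
  set B := starBound (3 ^ (8 * t + 1) + 1) (8 * t + 1) with hB
  have hpig : ∃ ρ ∈ insert u Z, B < {w | w ∈ P.neighborSet v ∧ ∃ p : (iso P v).Walk w ρ,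
      p.length ≤ 8 * t + 1}.ncard := by
    by_contra hcon
    push Not at hcon
    have hsub : P.neighborSet v ⊆ (((insert u Z).biUnion (fun ρ => (Set.toFinite {w | w ∈ P.neighborSet v ∧
        ∃ p : (iso P v).Walk w ρ, p.length ≤ 8 * t + 1}).toFinset) : Finset V) : Set V) := by
      intro w hw
      have h1 := hfar w hw
      have hne : (D.cof P.edgeSet {v}).edist u w ≠ ⊤ := ne_top_of_le_ne_top (ENat.natCast_ne_top _) h1
      obtain ⟨q, hq⟩ := SimpleGraph.exists_walk_of_edist_ne_top hne
      have hl : q.length ≤ 8 * t + 1 := by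
        have : (q.length : ℕ∞) ≤ (8 * t + 1 : ℕ) := hq.trans_le h1
        exact_mod_cast this
      obtain ⟨ρ, hρ, p, hp⟩ := hwalk w q.reverse
      rw [SimpleGraph.Walk.length_reverse] at hp
      rw [Finset.mem_coe, Finset.mem_biUnion]
      refine ⟨ρ, hρ, ?_⟩
      rw [Set.Finite.mem_toFinset]
      exact ⟨hw, p, hp.trans hl⟩
    have h1 := Set.ncard_le_ncard hsub (Finset.finite_toSet _)
    rw [Set.ncard_coe_finset] at h1
    have h2 := h1.trans (Finset.card_biUnion_le_card_mul _ _ B (by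
      intro ρ hρ
      rw [← Set.ncard_eq_toFinset_card]
      exact hcon ρ hρ))
    have h3 : (insert u Z).card ≤ c * (2 * c) + 1 :=
      (Finset.card_insert_le _ _).trans (Nat.add_le_add_right hZc 1)
    have h4 := Nat.mul_le_mul_right B h3
    omega
  obtain ⟨ρ, -, hρ⟩ := hpig
  obtain ⟨x, A, p, hAc, hA, hpp, hpd⟩ := star_lemma (iso P v) (3 ^ (8 * t + 1) + 1) (8 * t + 1) ρ _
    (Nat.succ_pos _) (fun w hw => hw.2) hρ
  let Θ : Theta P A :=
    { v := v
      x := x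
      w := fun i => i
      adj := fun i => (hA i i.2).1.1
      p := fun i => (p i).mapLe (iso_le P v)
      path := fun i => (SimpleGraph.Walk.isPath_mapLe _).2 (hpp i)
      hv := fun i => by
        rw [SimpleGraph.Walk.support_mapLe_eq_support]
        have : P.Adj v i := (hA i i.2).1.1
        exact iso_support (p i) this.ne'
      hw := fun i => (hA i i.2).2
      disj := fun i j hij y h1 h2 => by
        rw [SimpleGraph.Walk.support_mapLe_eq_support] at h1 h2
        exact hpd i j hij y h1 h2 }
  refine Θ.hasNest D t ?_
  rw [Fintype.card_coe, hAc]
  omega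

theorem planar_main (c t : ℕ) : ∃ N : ℕ, ∀ (V : Type) [Fintype V] (P : SimpleGraph V) (D : PlaneDr P),
    N ≤ Fintype.card V → 3 * Fintype.card V ≤ P.edgeSet.ncard + c → D.HasNest t := by
  set Δ := (c * (2 * c) + 1) * starBound (3 ^ (8 * t + 1) + 1) (8 * t + 1) with hΔ
  refine ⟨((c * (2 * c) + Δ + 1) ^ (8 * t + 1)) ^ 2 + c + 1, ?_⟩
  intro V _ P D hN hm
  by_cases h : ∀ v, (P.neighborSet v).ncard ≤ Δ
  · exact D.case_low c Δ t (by omega) hm h (by omega)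
  · push Not at h
    obtain ⟨v, hv⟩ := h
    exact D.case_high c t (by omega) hm v hv

end PlaneDr

end

theorem mem_closedRegion {s : Set Plane} {p : Plane}
    (h : Complex.equivRealProdCLM.symm p ∈ creg (Complex.equivRealProdCLM.symm '' s)) :
    p ∈ closedRegion s := by
  set Φ := Complex.equivRealProdCLM.symm with hΦ
  rcases h with h | ⟨h, hb⟩
  · left
    obtain ⟨q, hq, h⟩ := h
    rwa [← Φ.injective h]
  · have hp : p ∉ s := fun hp => h ⟨p, hp, rfl⟩
    refine Or.inr ⟨hp, ?_⟩
    have h1 := Φ.toHomeomorph.image_connectedComponentIn (s := sᶜ) (x := p) hp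
    have h2 : Φ.toHomeomorph '' sᶜ = (Φ '' s)ᶜ := Set.image_compl_eq Φ.bijective
    rw [h2] at h1
    have h3 : connectedComponentIn sᶜ p = Φ.symm '' (connectedComponentIn (Φ '' s)ᶜ (Φ p)) := by
      have h4 : connectedComponentIn (Φ '' s)ᶜ (Φ p) = Φ '' connectedComponentIn sᶜ p := h1.symm
      rw [h4, Set.image_image]
      simp
    rw [h3]
    exact Φ.symm.lipschitz.isBounded_image hb

/-- the graph of uncrossed edges -/
def Drawing.unc (γ : Drawing G) : SimpleGraph V where
  Adj a b := G.Adj a b ∧ ∀ e' ∈ G.edgeSet, s(a, b) ≠ e' → γ.emap s(a, b) ∩ γ.emap e' = ∅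
  symm := ⟨fun a b h => ⟨h.1.symm, by rw [Sym2.eq_swap]; exact h.2⟩⟩
  loopless := ⟨fun _ h => h.1.ne rfl⟩

theorem Drawing.unc_le (γ : Drawing G) : γ.unc ≤ G := fun _ _ h => h.1

theorem Drawing.mem_unc (γ : Drawing G) {e : Sym2 V} : e ∈ γ.unc.edgeSet ↔
    e ∈ G.edgeSet ∧ ∀ e' ∈ G.edgeSet, e ≠ e' → γ.emap e ∩ γ.emap e' = ∅ := by
  induction e with
  | _ a b => exact Iff.rfl

/-- the plane drawing of the uncrossed edges -/
def Drawing.plane (γ : Drawing G) : PlaneDr γ.unc where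
  vmap v := Complex.equivRealProdCLM.symm (γ.vmap v)
  emap e := Complex.equivRealProdCLM.symm '' γ.emap e
  inj := Complex.equivRealProdCLM.symm.injective.comp γ.vmap_inj
  arc u v h := by
    obtain ⟨f, h1, h2, h3, h4, h5⟩ := γ.arc s(u, v) h.1 u v rfl
    refine ⟨fun x => Complex.equivRealProdCLM.symm (f x),
      Complex.equivRealProdCLM.symm.continuous.comp_continuousOn h1,
      Complex.equivRealProdCLM.symm.injective.comp_injOn h2, by simp only [h3], by simp only [h4], ?_⟩
    rw [h5, Set.image_image]
  avoid e he v := by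
    rintro ⟨p, hp, h⟩
    rw [Complex.equivRealProdCLM.symm.injective h] at hp
    exact γ.avoid e (γ.mem_unc.1 he).1 v hp
  disj e he e' he' hne z := by
    rintro ⟨p, hp, rfl⟩ ⟨q, hq, h⟩
    rw [Complex.equivRealProdCLM.symm.injective h] at hq
    have := (γ.mem_unc.1 he).2 e' (γ.mem_unc.1 he').1 hne
    exact (Set.mem_empty_iff_false p).1 (this ▸ ⟨hp, hq⟩)

theorem Drawing.crossed_count [Finite V] (γ : Drawing G) (hg : γ.Generic) (hf : γ.crossings.Finite) :
    G.edgeSet.ncard ≤ γ.unc.edgeSet.ncard + 2 * γ.crossings.ncard := by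
  classical
  have hsub : γ.unc.edgeSet ⊆ G.edgeSet := SimpleGraph.edgeSet_mono γ.unc_le
  have h1 := Set.ncard_sdiff_add_ncard_of_subset hsub (Set.toFinite _)
  have hfin : (G.edgeSet \ γ.unc.edgeSet).Finite := Set.toFinite _
  have hex : ∀ e, ∃ p, e ∈ G.edgeSet \ γ.unc.edgeSet → p ∈ γ.crossings ∧ p ∈ γ.emap e := by
    intro e
    by_cases he : e ∈ G.edgeSet \ γ.unc.edgeSet
    · have h2 := he.2
      rw [γ.mem_unc] at h2
      push Not at h2
      obtain ⟨e', he', hne, p, hp⟩ := h2 he.1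
      exact ⟨p, fun _ => ⟨⟨e, he.1, e', he', hne, hp.1, hp.2⟩, hp.1⟩⟩
    · exact ⟨0, fun h => absurd h he⟩
  choose f hf' using hex
  have h2 := Finset.card_le_mul_card_image_of_maps_to (s := hfin.toFinset) (t := hf.toFinset) (f := f)
    (fun e he => hf.mem_toFinset.2 (hf' e (hfin.mem_toFinset.1 he)).1) 2 (by
      intro p _
      by_contra hcon
      push Not at hcon
      obtain ⟨a, b, c, ha, hb, hc, n1, n2, n3⟩ := Finset.two_lt_card_iff.1 hcon
      simp only [Finset.mem_filter, Set.Finite.mem_toFinset] at ha hb hc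
      have ka := (hf' a ha.1).2
      have kb := (hf' b hb.1).2
      have kc := (hf' c hc.1).2
      rw [ha.2] at ka
      rw [hb.2] at kb
      rw [hc.2] at kc
      rcases hg.1 p a ha.1.1 b hb.1.1 c hc.1.1 ka kb kc with h | h | h
      · exact n1 h
      · exact n2 h
      · exact n3 h)
  rw [← Set.ncard_eq_toFinset_card _ hfin, ← Set.ncard_eq_toFinset_card _ hf] at h2
  omega

theorem Drawing.transfer [Finite V] (γ : Drawing G) (t : ℕ) (h : γ.plane.HasNest t) :
    ∃ s ∈ ({0, 1, 2} : Set ℕ), ∃ C : Fin t → G.Subgraph, γ.IsSNest s C := by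
  classical
  obtain ⟨Y, hY, C, h1, h2, h3, h4⟩ := h
  have hex : ∀ i, ∃ H : G.Subgraph, IsCycleSubgraph H ∧ H.edgeSet = C i ∧ H.verts = vs (C i) := by
    intro i
    obtain ⟨v, c, hc, hcC⟩ := (h1 i).2
    have hc' : (c.mapLe γ.unc_le).IsCycle := (SimpleGraph.Walk.isCycle_mapLe γ.unc_le).2 hc
    have hnil : ¬ (c.mapLe γ.unc_le).Nil := hc'.not_nil
    refine ⟨(c.mapLe γ.unc_le).toSubgraph, ⟨SimpleGraph.Walk.toSubgraph_connected _, Set.toFinite _, ?_⟩,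
      ?_, ?_⟩
    · intro w hw
      exact hc'.ncard_neighborSet_toSubgraph_eq_two (by simpa using hw)
    · ext e
      rw [SimpleGraph.Walk.mem_edges_toSubgraph, SimpleGraph.Walk.edges_mapLe_eq_edges, ← hcC]
      rfl
    · ext w
      rw [SimpleGraph.Walk.mem_verts_toSubgraph,
        SimpleGraph.Walk.mem_support_iff_exists_mem_edges_of_not_nil hnil,
        SimpleGraph.Walk.edges_mapLe_eq_edges, ← hcC]
      rfl
  choose H hH hHe hHv using hex
  have him : ∀ i, γ.plane.cim (C i) = Complex.equivRealProdCLM.symm '' γ.image (H i) := by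
    intro i
    ext z
    rw [PlaneDr.mem_cim_iff, Drawing.image, hHe, hHv]
    constructor
    · rintro (⟨v, hv, rfl⟩ | ⟨e, he, p, hp, rfl⟩)
      · exact ⟨γ.vmap v, Or.inl ⟨v, hv, rfl⟩, rfl⟩
      · exact ⟨p, Or.inr (mem_iUnion₂.2 ⟨e, he, hp⟩), rfl⟩
    · rintro ⟨p, ⟨v, hv, rfl⟩ | hp, rfl⟩
      · exact Or.inl ⟨v, hv, rfl⟩
      · obtain ⟨e, he, hp⟩ := mem_iUnion₂.1 hp
        exact Or.inr ⟨e, he, p, hp, rfl⟩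
  refine ⟨Y.card, ?_, H, ⟨hH, ?_, ?_, ?_⟩, Y, Finset.finite_toSet _, Set.ncard_coe_finset _, ?_⟩
  · simp only [Set.mem_insert_iff, Set.mem_singleton_iff]
    omega
  · intro i j hij
    rw [hHe, hHe]
    exact h2 i j hij
  · intro i e he
    rw [hHe] at he
    exact (γ.mem_unc.1 ((h1 i).1 he)).2
  · intro i hi p hp
    apply mem_closedRegion
    rw [← him]
    refine h4 i hi ?_
    rw [him]
    exact ⟨p, hp, rfl⟩
  · intro i j hij
    rw [hHv, hHv]
    exact h3 i j hij

/-- **Lemma 4 of the paper.** For all integers `ℓ, r, t ≥ 0` there is an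
`n₀` such that every simple graph on `n ≥ n₀` vertices of average degree at least
`6 − r/n`, drawn generically with at most `ℓ` crossings, contains an `s`-nest of size
`t` for some `s ∈ {0,1,2}`. -/
theorem statement3 (ℓ r t : ℕ) :
    ∃ n₀ : ℕ, ∀ (V : Type) [Fintype V] (G : SimpleGraph V),
      n₀ ≤ Fintype.card V →
      (6 : ℝ) - r / Fintype.card V ≤ 2 * G.edgeSet.ncard / Fintype.card V →
      ∀ γ : Drawing G, γ.Generic → γ.crossings.Finite → γ.crossings.ncard ≤ ℓ →
      ∃ s ∈ ({0, 1, 2} : Set ℕ), ∃ C : Fin t → G.Subgraph, γ.IsSNest s C := by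
  obtain ⟨N, hN⟩ := PlaneDr.planar_main (2 * ℓ + r) t
  refine ⟨N + 1, ?_⟩
  intro V _ G hn hm γ hg hf hl
  refine γ.transfer t (hN V _ γ.plane (by omega) ?_)
  have h1 := γ.crossed_count hg hf
  have hpos : (0 : ℝ) < Fintype.card V := by
    have : 0 < Fintype.card V := by omega
    exact_mod_cast this
  have h2 : (6 : ℝ) * Fintype.card V ≤ 2 * G.edgeSet.ncard + r := by
    have h3 := mul_le_mul_of_nonneg_right hm hpos.le
    rw [sub_mul, div_mul_cancel₀ _ hpos.ne', div_mul_cancel₀ _ hpos.ne'] at h3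
    linarith
  have h4 : 6 * Fintype.card V ≤ 2 * G.edgeSet.ncard + r := by exact_mod_cast h2
  omega

end CrossingPaper
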